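/- arXiv:1907.12936 — 2 statements merged into one kernel-verified Lean document; each statement's English description precedes it below -/
import Mathlib

section
/- Let K be a field of characteristic zero, let W be a K-vector space of dimension d, and let GL(W) act on U = End(W)^{⊕k} by simultaneous conjugation: g·(M₁,…,M_k) = (gM₁g⁻¹,…,gM_kg⁻¹). Then for every n ≥ 0, dim (K[U]^{GL(W)})ₙ = Σ_{n₁+⋯+n_k=n} Σ_{λ⊢n, r(λ)≤d} Σ_{λ₁⊢n₁} ⋯ Σ_{λ_k⊢n_k} (c^λ_{(λᵢ)})², where c^λ_{(λᵢ)} is the iterated Littlewood–Richardson coefficient. -/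
open CategoryTheory MonoidalCategory

open PowerSeries

/-- The space of `Γ`-invariant homogeneous polynomial functions of degree `n` on `U`
(for the action `act` of `Γ` on `U`): functions `U → K` which are restrictions to the
diagonal of an `n`-multilinear form (over a field of characteristic zero this is exactly
the degree-`n` homogeneous polynomial functions) and which are invariant under `act`.
This is the `n`-th homogeneous component `(K[U]^Γ)ₙ` of the invariant ring. -/
def invariantPolynomials (K : Type) [Field K] {U Γ : Type} [AddCommGroup U] [Module K U]
    (act : Γ → U → U) (n : ℕ) : Submodule K (U → K) where
  carrier := {F | (∃ m : MultilinearMap K (fun _ : Fin n => U) K, ∀ u, F u = m fun _ => u) ∧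
    ∀ γ u, F (act γ u) = F u}
  add_mem' := by
    rintro F G ⟨⟨mF, hF⟩, hFi⟩ ⟨⟨mG, hG⟩, hGi⟩
    refine ⟨⟨mF + mG, fun u => ?_⟩, fun γ u => ?_⟩
    · simp [hF, hG]
    · simp [Pi.add_apply, hFi γ u, hGi γ u]
  zero_mem' := by
    refine ⟨⟨0, fun u => ?_⟩, fun γ u => rfl⟩
    simp
  smul_mem' := by
    rintro c F ⟨⟨mF, hF⟩, hFi⟩
    refine ⟨⟨c • mF, fun u => ?_⟩, fun γ u => ?_⟩
    · simp [hF]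
    · simp [Pi.smul_apply, hFi γ u]

/-- The simultaneous conjugation action of `GL(W)` on `End(W)^{⊕k}`:
`g · (M₁, …, M_k) = (g M₁ g⁻¹, …, g M_k g⁻¹)`. -/
def conjAction (K : Type) [Field K] (W : Type) [AddCommGroup W] [Module K W] (k : ℕ) :
    (W ≃ₗ[K] W) → (Fin k → W →ₗ[K] W) → (Fin k → W →ₗ[K] W) :=
  fun g M i => g.toLinearMap ∘ₗ M i ∘ₗ g.symm.toLinearMap

/-- `listBlock L t` is the index of the block containing `t` when `{0,1,2,…}` is divided
into consecutive blocks of sizes `L = [l₁, l₂, …]`: it is the number of partial sums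
`l₁, l₁+l₂, …` that are `≤ t`. -/
def listBlock (L : List ℕ) (t : ℕ) : ℕ :=
  (L.scanl (· + ·) 0).tail.countP fun s => decide (s ≤ t)

/-- `listCol L t` is the position of `t` within its block (the column index of the cell `t`
in the canonical filling of the Young diagram with row lengths `L`). -/
def listCol (L : List ℕ) (t : ℕ) : ℕ :=
  t - ((L.scanl (· + ·) 0).filter fun s => decide (s ≤ t)).foldr max 0

/-- The parts of a partition, listed in weakly decreasing order. -/
def partsList {m : ℕ} (mu : Nat.Partition m) : List ℕ := (mu.parts.sort (· ≤ ·)).reverse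

/-- The subgroup of permutations of `Fin N` preserving the fibers of `f` pointwise on values,
i.e. `{σ | f ∘ σ = f}`. -/
def stabSubgroup (N : ℕ) (f : Fin N → ℕ) : Subgroup (Equiv.Perm (Fin N)) where
  carrier := {σ | ∀ t, f (σ t) = f t}
  one_mem' := fun _ => rfl
  mul_mem' := by
    intro σ τ hσ hτ t
    have h1 : f (σ (τ t)) = f (τ t) := hσ (τ t)
    have h2 : f (τ t) = f t := hτ t
    simpa [Equiv.Perm.mul_apply, h2] using h1
  inv_mem' := by
    intro σ hσ t
    have h1 : f (σ (σ⁻¹ t)) = f (σ⁻¹ t) := hσ (σ⁻¹ t)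
    simpa using h1.symm

instance stabDecidable' (N : ℕ) (f : Fin N → ℕ) : DecidablePred (· ∈ stabSubgroup N f) :=
  fun σ => decidable_of_iff (∀ t, f (σ t) = f t) Iff.rfl

/-- The row function of the canonical tableau of the partition `mu` of `m`, placed on the
block `[o, o+m)` of `{0, …, N−1}`; points outside the block get their own distinct values
(so that the stabilizer of this function consists of the permutations fixing the complement
of the block pointwise and preserving the rows of the tableau). -/
def shiftedRowFn (N o m : ℕ) (mu : Nat.Partition m) : Fin N → ℕ := fun t =>
  if o ≤ t.val ∧ t.val < o + m then N + listBlock (partsList mu) (t.val - o) else t.val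

/-- Column analogue of `shiftedRowFn`. -/
def shiftedColFn (N o m : ℕ) (mu : Nat.Partition m) : Fin N → ℕ := fun t =>
  if o ≤ t.val ∧ t.val < o + m then N + listCol (partsList mu) (t.val - o) else t.val

/-- The Young symmetrizer of the partition `mu` of `m`, for the canonical tableau placed on
the block `[o, o+m)` of `{0, …, N−1}`, as an element of the group algebra `K[S_N]`:
`(Σ_{p ∈ row group} p) · (Σ_{q ∈ column group} sgn(q) q)`. -/
noncomputable def blockYoungSymmetrizer (K : Type) [Field K] (N o m : ℕ)
    (mu : Nat.Partition m) : MonoidAlgebra K (Equiv.Perm (Fin N)) :=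
  (∑ p : stabSubgroup N (shiftedRowFn N o m mu),
      MonoidAlgebra.single (p : Equiv.Perm (Fin N)) (1 : K)) *
  (∑ q : stabSubgroup N (shiftedColFn N o m mu),
      MonoidAlgebra.single (q : Equiv.Perm (Fin N))
        ((Equiv.Perm.sign (q : Equiv.Perm (Fin N)) : ℤ) : K))

/-- The Specht module of the partition `lam` of `n`, realized as the left ideal
`K[Sₙ]·e_lam` of the group algebra generated by the Young symmetrizer of `lam`,
i.e. as a module over the group algebra `K[Sₙ]` (equivalently, a representation of `Sₙ`). -/
noncomputable def spechtIdeal (K : Type) [Field K] (n : ℕ) (lam : Nat.Partition n) :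
    Submodule (MonoidAlgebra K (Equiv.Perm (Fin n))) (MonoidAlgebra K (Equiv.Perm (Fin n))) :=
  Submodule.span _ {blockYoungSymmetrizer K n 0 n lam}

/-- The Specht module of `lam ⊢ n` as an object of the category `Rep K Sₙ` of
representations of the symmetric group, via the equivalence of `Rep K Sₙ` with the category
of modules over the group algebra. -/
noncomputable def specht (K : Type) [Field K] (n : ℕ) (lam : Nat.Partition n) :
    Rep K (Equiv.Perm (Fin n)) :=
  Rep.equivalenceModuleMonoidAlgebra.inverse.obj
    (ModuleCat.of (MonoidAlgebra K (Equiv.Perm (Fin n))) (spechtIdeal K n lam))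

/-- The Kronecker coefficient `g(λ,μ,ν)`: the multiplicity of the Specht module `S_ν` in
`S_λ ⊗ S_μ` (diagonal `Sₙ`-action), computed (over a field of characteristic zero, where
the Specht modules are absolutely irreducible) as `dim Hom_{Sₙ}(S_ν, S_λ ⊗ S_μ)`. -/
noncomputable def kron (K : Type) [Field K] {n : ℕ} (lam mu nu : Nat.Partition n) : ℕ :=
  Module.finrank K (specht K n nu ⟶ specht K n lam ⊗ specht K n mu)

/-- `blockOffset ν i = ν₁ + ⋯ + ν_{i-1}` is the starting point of the `i`-th consecutive
block of sizes given by `ν`. -/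
def blockOffset {k : ℕ} (ν : Fin k → ℕ) (i : Fin k) : ℕ :=
  ∑ j ∈ Finset.univ.filter (fun j => j < i), ν j

/-- The representation `Ind_{S_{ν₁}×⋯×S_{ν_k}}^{Sₙ}(S_{λ₁} ⊠ ⋯ ⊠ S_{λ_k})` of `Sₙ` induced
from the external tensor product of the Specht modules `S_{λᵢ}` of the Young subgroup
`S_{ν₁}×⋯×S_{ν_k}`, realized as the left ideal of `K[Sₙ]` generated by the product of the
Young symmetrizers of the `λᵢ` for tableaux placed on the consecutive blocks of sizes `νᵢ`
of `{0,…,n−1}`. -/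
noncomputable def inducedYoung (K : Type) [Field K] (n : ℕ) {k : ℕ} (ν : Fin k → ℕ)
    (lams : ∀ i, Nat.Partition (ν i)) : Rep K (Equiv.Perm (Fin n)) :=
  Rep.equivalenceModuleMonoidAlgebra.inverse.obj
    (ModuleCat.of (MonoidAlgebra K (Equiv.Perm (Fin n)))
      (Submodule.span (MonoidAlgebra K (Equiv.Perm (Fin n)))
        {(List.ofFn fun i : Fin k =>
            blockYoungSymmetrizer K n (blockOffset ν i) (ν i) (lams i)).prod}))

/-- The iterated Littlewood–Richardson coefficient `c^λ_{(λᵢ)}`: the multiplicity of the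
Specht module `S_λ` in `Ind_{S_{ν₁}×⋯×S_{ν_k}}^{Sₙ}(S_{λ₁} ⊠ ⋯ ⊠ S_{λ_k})`, computed
(over a field of characteristic zero) as the dimension of the `Sₙ`-equivariant Hom space. -/
noncomputable def iteratedLR (K : Type) [Field K] (n : ℕ) {k : ℕ} (ν : Fin k → ℕ)
    (lams : ∀ i, Nat.Partition (ν i)) (lam : Nat.Partition n) : ℕ :=
  Module.finrank K (inducedYoung K n ν lams ⟶ specht K n lam)

section GroupAlgebra

variable {K : Type*} [Field K] {G : Type*} [Group G] {H : Type*} [Group H] {J : Type*}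

instance monoidAlgebra_finite [Finite G] : Module.Finite K (MonoidAlgebra K G) :=
  Module.Finite.of_basis (MonoidAlgebra.basis G K)

theorem trace_mulLeft_monoidAlgebra [Fintype G] (x : MonoidAlgebra K G) :
    LinearMap.trace K _ (LinearMap.mulLeft K x) = Fintype.card G * x.coeff 1 := by
  classical
  rw [LinearMap.trace_eq_matrix_trace K (MonoidAlgebra.basis G K), Matrix.trace]
  have : ∀ g : G, (LinearMap.toMatrix (MonoidAlgebra.basis G K) (MonoidAlgebra.basis G K)
      (LinearMap.mulLeft K x)).diag g = x.coeff 1 := by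
    intro g
    rw [Matrix.diag_apply, LinearMap.toMatrix_apply, MonoidAlgebra.basis_apply]
    change (x * MonoidAlgebra.single g 1).coeff g = _
    rw [MonoidAlgebra.coeff_mul_single_apply]
    simp
  rw [Finset.sum_congr rfl fun g _ => this g]
  simp

theorem coeff_one_eq_zero_of_sq [CharZero K] [Finite G] {x : MonoidAlgebra K G} (h : x * x = 0) :
    x.coeff 1 = 0 := by
  have := Fintype.ofFinite G
  have h1 : IsNilpotent (LinearMap.mulLeft K x) :=
    ⟨2, by rw [pow_two, Module.End.mul_eq_comp, ← LinearMap.mulLeft_mul, h]; ext; simp⟩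
  have h2 := (LinearMap.isNilpotent_trace_of_isNilpotent h1).eq_zero
  rw [trace_mulLeft_monoidAlgebra] at h2
  simpa using h2

theorem coeff_one_ne_zero_of_quasi_idempotent [CharZero K] [Finite G] {x : MonoidAlgebra K G}
    {c : K} (hc : c ≠ 0) (h : x * x = c • x) (hx : x ≠ 0) : x.coeff 1 ≠ 0 := by
  have := Fintype.ofFinite G
  intro h0
  have hid : IsIdempotentElem (LinearMap.mulLeft K (c⁻¹ • x)) := by
    rw [IsIdempotentElem, Module.End.mul_eq_comp, ← LinearMap.mulLeft_mul]
    congr 1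
    rw [smul_mul_smul_comm, h, smul_smul, mul_assoc, inv_mul_cancel₀ hc, mul_one]
  have htr : LinearMap.trace K _ (LinearMap.mulLeft K (c⁻¹ • x)) = 0 := by
    rw [trace_mulLeft_monoidAlgebra, MonoidAlgebra.coeff_smul_apply, h0]
    simp
  have h2 := LinearMap.IsIdempotentElem.eq_zero_of_trace_eq_zero hid htr
  have h3 := LinearMap.congr_fun h2 1
  simp only [LinearMap.mulLeft_apply, mul_one, LinearMap.zero_apply, smul_eq_zero, _root_.inv_eq_zero]
    at h3
  exact h3.elim hc hx

/-- The sum of the conjugates of `x` under the images of the elements of `H`. -/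
noncomputable def conjSum [Fintype H] (Ψ : H →* G) (x : MonoidAlgebra K G) : MonoidAlgebra K G :=
  ∑ h, MonoidAlgebra.of K G (Ψ h) * x * MonoidAlgebra.of K G (Ψ h⁻¹)

theorem of_inv_mul_of (Ψ : H →* G) (h : H) :
    MonoidAlgebra.of K G (Ψ h⁻¹) * MonoidAlgebra.of K G (Ψ h) = 1 := by
  rw [← map_mul, ← map_mul, inv_mul_cancel, map_one, map_one]

theorem conjSum_commute [Fintype H] (Ψ : H →* G) (x : MonoidAlgebra K G) (h : H) :
    Commute (MonoidAlgebra.of K G (Ψ h)) (conjSum Ψ x) := by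
  rw [Commute, SemiconjBy, conjSum, Finset.mul_sum, Finset.sum_mul]
  refine Fintype.sum_equiv (Equiv.mulLeft h) _ _ fun g => ?_
  simp only [Equiv.coe_mulLeft, mul_inv_rev, map_mul, mul_assoc]
  congr 3
  rw [of_inv_mul_of, mul_one]

theorem coeff_one_conjSum [Fintype H] (Ψ : H →* G) (x : MonoidAlgebra K G) :
    (conjSum Ψ x).coeff 1 = Fintype.card H * x.coeff 1 := by
  rw [conjSum, MonoidAlgebra.coeff_sum, Finsupp.finsetSum_apply]
  simp [MonoidAlgebra.of_apply, MonoidAlgebra.coeff_mul_single_apply,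
    MonoidAlgebra.coeff_single_mul_apply]

/-- The span of the image of `H` in the group algebra of `G`. -/
noncomputable def groupSpan (K : Type*) [Field K] (Ψ : H →* G) :
    Submodule K (MonoidAlgebra K G) :=
  Submodule.span K (Set.range fun h => MonoidAlgebra.of K G (Ψ h))

theorem commute_of_mem_groupSpan {Ψ : H →* G} {x b : MonoidAlgebra K G}
    (hx : ∀ h, Commute (MonoidAlgebra.of K G (Ψ h)) x) (hb : b ∈ groupSpan K Ψ) :
    Commute b x := by
  induction hb using Submodule.span_induction with
  | mem y hy => obtain ⟨h, rfl⟩ := hy; exact hx h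
  | zero => exact Commute.zero_left _
  | add y z _ _ hy hz => exact hy.add_left hz
  | smul c y _ hy => exact hy.smul_left c

theorem groupSpan_id : groupSpan K (MonoidHom.id G) = ⊤ := by
  rw [eq_top_iff]
  intro x _
  induction x using MonoidAlgebra.induction_on with
  | of g => exact Submodule.subset_span ⟨g, rfl⟩
  | add f g hf hg => exact add_mem (hf trivial) (hg trivial)
  | smul r f hf => exact Submodule.smul_mem _ _ (hf trivial)

theorem conjSum_mul_self [CharZero K] [Fintype H] [Finite G] {Ψ : H →* G} {f : MonoidAlgebra K G}
    (sandwich : ∀ h, ∃ s : K, f * MonoidAlgebra.of K G (Ψ h) * f = s • f)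
    {c : K} (hc : c ≠ 0) (hf2 : f * f = c • f) (hmem : f ∈ groupSpan K Ψ) (hf : f ≠ 0) :
    ∃ s : K, s ≠ 0 ∧ conjSum Ψ f * f = s • f := by
  have hτ := coeff_one_ne_zero_of_quasi_idempotent hc hf2 hf
  choose s hs using sandwich
  have hcomm := commute_of_mem_groupSpan (conjSum_commute Ψ f) hmem
  have h1 : f * conjSum Ψ f * f = (∑ h, s h * s h⁻¹) • f := by
    rw [conjSum, Finset.mul_sum, Finset.sum_mul, Finset.sum_smul]
    refine Finset.sum_congr rfl fun h _ => ?_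
    calc f * (MonoidAlgebra.of K G (Ψ h) * f * MonoidAlgebra.of K G (Ψ h⁻¹)) * f
        = (f * MonoidAlgebra.of K G (Ψ h) * f) * MonoidAlgebra.of K G (Ψ h⁻¹) * f := by
          simp only [mul_assoc]
      _ = _ := by rw [hs, smul_mul_assoc, smul_mul_assoc, hs, smul_smul]
  have h2 : conjSum Ψ f * f = (c⁻¹ * ∑ h, s h * s h⁻¹) • f := by
    rw [mul_smul, ← h1, hcomm.eq, mul_assoc, hf2, mul_smul_comm, smul_smul, inv_mul_cancel₀ hc,
      one_smul]
  refine ⟨_, ?_, h2⟩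
  intro h0
  rw [h0, zero_smul] at h2
  have h3 : conjSum Ψ f * conjSum Ψ f = 0 := by
    nth_rewrite 1 [conjSum]
    rw [Finset.sum_mul]
    refine Finset.sum_eq_zero fun h _ => ?_
    rw [mul_assoc, (conjSum_commute Ψ f h⁻¹).eq, mul_assoc, ← mul_assoc f, ← hcomm.eq.symm, h2,
      zero_mul, mul_zero]
  have h4 := coeff_one_eq_zero_of_sq h3
  rw [coeff_one_conjSum] at h4
  rcases mul_eq_zero.1 h4 with h5 | h5
  · exact Fintype.card_ne_zero (Nat.cast_eq_zero.1 h5)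
  · exact hτ h5

end GroupAlgebra

section GroupAlgebra

variable {K : Type*} [Field K] {G : Type*} [Group G] {H : Type*} [Group H] {J : Type*}

/-- A family `f` of quasi-idempotents of the group algebra of `H`, pushed to the group algebra
of `G` along `Ψ : H →* G`, which generate pairwise non-isomorphic absolutely irreducible left
ideals and such that every irreducible representation of `H` occurs. -/
structure SymmetrizerSystem (Ψ : H →* G) (f : J → MonoidAlgebra K G) : Prop where
  sandwich : ∀ j h, ∃ s : K, f j * MonoidAlgebra.of K G (Ψ h) * f j = s • f j
  ortho : ∀ i j h, i ≠ j → f i * MonoidAlgebra.of K G (Ψ h) * f j = 0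
  idem : ∀ j, ∃ c : K, c ≠ 0 ∧ f j * f j = c • f j
  mem : ∀ j, f j ∈ groupSpan K Ψ
  complete : 1 ∈ Submodule.span K
    {x | ∃ j h h', x = MonoidAlgebra.of K G (Ψ h) * f j * MonoidAlgebra.of K G (Ψ h')}

theorem card_le_card_conjClasses {ι : Type*} [Fintype ι] [Finite G]
    {v : ι → MonoidAlgebra K G} (hv : LinearIndependent K v) (hc : ∀ i x, Commute (v i) x) :
    Fintype.card ι ≤ Nat.card (ConjClasses G) := by
  classical
  have := Fintype.ofFinite (ConjClasses G)
  let L : MonoidAlgebra K G →ₗ[K] (ConjClasses G → K) :=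
    { toFun := fun x c => x.coeff c.out
      map_add' := fun x y => by ext; simp [MonoidAlgebra.coeff_add]
      map_smul' := fun c x => by ext; simp }
  have hL : LinearIndependent K (L ∘ v) := by
    refine hv.map ?_
    rw [Submodule.disjoint_def]
    intro x hx hLx
    have hcx : ∀ y, Commute x y := by
      intro y
      clear hLx
      induction hx using Submodule.span_induction with
      | mem x hx => obtain ⟨i, rfl⟩ := hx; exact hc i y
      | zero => exact Commute.zero_left _
      | add a b _ _ ha hb => exact ha.add_left hb
      | smul c a _ ha => exact ha.smul_left c
    refine MonoidAlgebra.coeff_injective (Finsupp.ext fun g => ?_)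
    have h1 : x.coeff ((ConjClasses.mk g).out) = 0 := congrFun hLx (ConjClasses.mk g)
    have h2 : IsConj ((ConjClasses.mk g).out) g :=
      ConjClasses.mk_eq_mk_iff_isConj.1 (Quotient.out_eq _)
    obtain ⟨u, hu⟩ := isConj_iff.1 h2
    have h3 := congrArg (fun y => y.coeff (u * (ConjClasses.mk g).out))
      (hcx (MonoidAlgebra.single u 1)).eq
    simp only [MonoidAlgebra.coeff_mul_single_apply, MonoidAlgebra.coeff_single_mul_apply,
      inv_mul_cancel_left, hu, mul_one, one_mul, h1] at h3
    simpa using h3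
  have := hL.fintype_card_le_finrank
  simpa [Nat.card_eq_fintype_card] using this


theorem exists_central_idempotents [CharZero K] [Finite G] [Fintype J]
    {e : J → MonoidAlgebra K G}
    (sandwich : ∀ j g, ∃ s : K, e j * MonoidAlgebra.of K G g * e j = s • e j)
    (ortho : ∀ i j x, i ≠ j → e i * x * e j = 0)
    (hτ : ∀ j, (e j).coeff 1 ≠ 0)
    (hcard : Nat.card (ConjClasses G) ≤ Fintype.card J) :
    SymmetrizerSystem (MonoidHom.id G) e ∧
    ∃ z : J → MonoidAlgebra K G, (∀ j x, Commute (z j) x) ∧ (∀ j, z j * e j = e j) ∧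
      (∀ i j, i ≠ j → z i * e j = 0) ∧ ∑ j, z j = 1 := by
  classical
  have := Fintype.ofFinite G
  have idem : ∀ j, ∃ c : K, c ≠ 0 ∧ e j * e j = c • e j := by
    intro j
    obtain ⟨c, hc⟩ := sandwich j 1
    rw [map_one, mul_one] at hc
    refine ⟨c, ?_, hc⟩
    rintro rfl
    rw [zero_smul] at hc
    exact hτ j (coeff_one_eq_zero_of_sq hc)
  have hne : ∀ j, e j ≠ 0 := fun j h => hτ j (by simp [h])
  have hZ : ∀ j, ∃ s : K, s ≠ 0 ∧ conjSum (MonoidHom.id G) (e j) * e j = s • e j := by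
    intro j
    obtain ⟨c, hc, h⟩ := idem j
    exact conjSum_mul_self (sandwich j) hc h (by rw [groupSpan_id]; trivial) (hne j)
  choose s hs hse using hZ
  let z : J → MonoidAlgebra K G := fun j => (s j)⁻¹ • conjSum (MonoidHom.id G) (e j)
  have hzc : ∀ j x, Commute (z j) x := fun j x =>
    (commute_of_mem_groupSpan (conjSum_commute (MonoidHom.id G) (e j))
      (by rw [groupSpan_id]; trivial : x ∈ groupSpan K (MonoidHom.id G))).symm.smul_left _
  have hze : ∀ j, z j * e j = e j := fun j => by
    rw [smul_mul_assoc, hse, smul_smul, inv_mul_cancel₀ (hs j), one_smul]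
  have hz0 : ∀ i j, i ≠ j → z i * e j = 0 := by
    intro i j hij
    rw [smul_mul_assoc, conjSum, Finset.sum_mul, Finset.sum_eq_zero, smul_zero]
    intro h _
    rw [mul_assoc, mul_assoc, ← mul_assoc (e i), ortho i j _ hij, mul_zero]
  have hzz : ∀ i j, z i * z j = if i = j then z j else 0 := by
    intro i j
    have : ∀ g, z i * (MonoidAlgebra.of K G ((MonoidHom.id G) g) * e j *
        MonoidAlgebra.of K G ((MonoidHom.id G) g⁻¹)) = MonoidAlgebra.of K G ((MonoidHom.id G) g) *
        (z i * e j) * MonoidAlgebra.of K G ((MonoidHom.id G) g⁻¹) := fun g => by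
      rw [← mul_assoc, ← mul_assoc, (hzc i _).eq, mul_assoc _ (z i)]
    change z i * ((s j)⁻¹ • conjSum (MonoidHom.id G) (e j)) = _
    rw [mul_smul_comm, conjSum, Finset.mul_sum]
    simp_rw [this]
    split_ifs with hij
    · subst hij
      rw [hze]; rfl
    · simp [hz0 i j hij]
  have hzne : ∀ j, z j ≠ 0 := fun j h => hne j (by rw [← hze j, h, zero_mul])
  have hsum : ∑ j, z j = 1 := by
    by_contra hne1
    let y : MonoidAlgebra K G := 1 - ∑ j, z j
    have hy : y ≠ 0 := fun h => hne1 (sub_eq_zero.1 h).symm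
    have hzy : ∀ i, z i * y = 0 := fun i => by
      simp [y, mul_sub, Finset.mul_sum, hzz]
    have hyc : ∀ x, Commute y x := fun x =>
      (Commute.one_left x).sub_left (Commute.sum_left _ _ _ fun j _ => hzc j x)
    have hyy : y * y = y := by
      nth_rewrite 1 [show y = 1 - ∑ j, z j from rfl]
      rw [sub_mul, Finset.sum_mul, Finset.sum_eq_zero fun i _ => hzy i, one_mul, sub_zero]
    let v : Option J → MonoidAlgebra K G := fun o => o.elim y z
    have hvc : ∀ o x, Commute (v o) x := by
      rintro (_ | j) x
      exacts [hyc x, hzc j x]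
    have hvv : ∀ o o', v o * v o' = if o = o' then v o' else 0 := by
      rintro (_ | i) (_ | j)
      · simpa [v] using hyy
      · simp only [v, Option.elim, reduceCtorEq, if_false]; rw [(hyc _).eq, hzy]
      · simp only [v, Option.elim, reduceCtorEq, if_false]; rw [hzy]
      · simp [v, hzz]
    have hvne : ∀ o, v o ≠ 0 := by
      rintro (_ | j)
      exacts [hy, hzne j]
    have hli : LinearIndependent K v := by
      rw [Fintype.linearIndependent_iff]
      intro c hc o
      have := congrArg (v o * ·) hc
      simp only [Finset.mul_sum, mul_smul_comm, hvv, mul_zero, smul_ite, smul_zero,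
        Finset.sum_ite_eq, Finset.mem_univ, if_true] at this
      exact (smul_eq_zero.1 this).resolve_right (hvne o)
    have := card_le_card_conjClasses hli hvc
    rw [Fintype.card_option] at this
    omega
  refine ⟨⟨sandwich, fun i j h hij => ortho i j _ hij, idem,
    fun j => by rw [groupSpan_id]; trivial, ?_⟩, z, hzc, hze, hz0, hsum⟩
  rw [← hsum]
  refine sum_mem fun j _ => Submodule.smul_mem _ _ (sum_mem fun g _ => Submodule.subset_span ?_)
  exact ⟨j, g, g⁻¹, rfl⟩

end GroupAlgebra

section GroupAlgebra

variable {K : Type*} [Field K] {G : Type*} [Group G] {H : Type*} [Group H] {J L : Type*}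

/-- The subspace `x A y` of an algebra `A`. -/
def corner {A : Type*} [Ring A] [Algebra K A] (x y : A) : Submodule K A :=
  LinearMap.range (LinearMap.mulLeft K x ∘ₗ LinearMap.mulRight K y)

theorem mem_corner {A : Type*} [Ring A] [Algebra K A] {x y u : A} :
    u ∈ corner (K := K) x y ↔ ∃ a, x * (a * y) = u := Iff.rfl

namespace SymmetrizerSystem

variable {Ψ : H →* G} {f : J → MonoidAlgebra K G} {e : L → MonoidAlgebra K G}

theorem map_one_eq_zero (hf : SymmetrizerSystem Ψ f) {M : Type*} [AddCommGroup M] [Module K M]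
    (T : MonoidAlgebra K G →ₗ[K] M)
    (h : ∀ j h h', T (MonoidAlgebra.of K G (Ψ h) * f j * MonoidAlgebra.of K G (Ψ h')) = 0) :
    T 1 = 0 := by
  have : Submodule.span K
    {x | ∃ j h h', x = MonoidAlgebra.of K G (Ψ h) * f j * MonoidAlgebra.of K G (Ψ h')} ≤
      LinearMap.ker T := by
    rw [Submodule.span_le]
    rintro _ ⟨j, a, b, rfl⟩
    exact h j a b
  exact this hf.complete

theorem ortho_of_id (he : SymmetrizerSystem (MonoidHom.id G) e) {i j : L} (hij : i ≠ j)
    (x : MonoidAlgebra K G) : e i * x * e j = 0 := by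
  induction x using MonoidAlgebra.induction_on with
  | of g => exact he.ortho i j g hij
  | add a b ha hb => rw [mul_add, add_mul, ha, hb, add_zero]
  | smul r a ha => rw [mul_smul_comm, smul_mul_assoc, ha, smul_zero]

theorem sandwich_of_id (he : SymmetrizerSystem (MonoidHom.id G) e) (j : L)
    (x : MonoidAlgebra K G) : ∃ s : K, e j * x * e j = s • e j := by
  induction x using MonoidAlgebra.induction_on with
  | of g => exact he.sandwich j g
  | add a b ha hb =>
    obtain ⟨s, hs⟩ := ha
    obtain ⟨t, ht⟩ := hb
    exact ⟨s + t, by rw [mul_add, add_mul, hs, ht, add_smul]⟩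
  | smul r a ha =>
    obtain ⟨s, hs⟩ := ha
    exact ⟨r * s, by rw [mul_smul_comm, smul_mul_assoc, hs, smul_smul]⟩

theorem eq_zero_of_forall_mul (he : SymmetrizerSystem (MonoidHom.id G) e) {a : MonoidAlgebra K G}
    (h : ∀ l x, a * (x * e l) = 0) : a = 0 := by
  have := he.map_one_eq_zero (LinearMap.mulLeft K a) fun l g g' => by
    rw [LinearMap.mulLeft_apply, ← mul_assoc, h, zero_mul]
  simpa using this

theorem eq_zero_of_forall_mul_left (he : SymmetrizerSystem (MonoidHom.id G) e)
    {a : MonoidAlgebra K G} (h : ∀ l x, e l * x * a = 0) : a = 0 := by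
  have := he.map_one_eq_zero (LinearMap.mulRight K a) fun l g g' => by
    rw [LinearMap.mulRight_apply, mul_assoc, mul_assoc, ← mul_assoc (e l), h, mul_zero]
  simpa using this

/-- The pairing `(w, u) ↦ τ(w u)` of `e A f` with `f A e`, where `τ` is the coefficient at `1`. -/
noncomputable def cornerPairing (x y : MonoidAlgebra K G) :
    corner (K := K) x y →ₗ[K] Module.Dual K (corner (K := K) y x) :=
  LinearMap.mk₂ K (fun w u => (w.1 * u.1).coeff 1)
    (fun _ _ _ => by simp [add_mul]) (fun _ _ _ => by simp)
    (fun _ _ _ => by simp [mul_add]) (fun _ _ _ => by simp)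

theorem cornerPairing_apply (x y : MonoidAlgebra K G) (w : corner (K := K) x y)
    (u : corner (K := K) y x) : cornerPairing x y w u = (w.1 * u.1).coeff 1 := rfl

theorem cornerPairing_surjective [CharZero K] [Finite G] (hf : SymmetrizerSystem Ψ f)
    (he : SymmetrizerSystem (MonoidHom.id G) e) (j : J) (l : L) :
    Function.Surjective (cornerPairing (e l) (f j)) := by
  have : cornerPairing (e l) (f j) = (cornerPairing (e l) (f j)).flip.flip := rfl
  rw [this, LinearMap.flip_surjective_iff₁, injective_iff_map_eq_zero]
  rintro ⟨u, hu⟩ h0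
  obtain ⟨a, rfl⟩ := mem_corner.1 hu
  obtain ⟨c, hc, hff⟩ := hf.idem j
  obtain ⟨c', hc', hee⟩ := he.idem l
  rw [Submodule.mk_eq_zero]
  by_cases hel : e l = 0
  · simp [hel]
  refine he.eq_zero_of_forall_mul_left fun m x => ?_
  by_cases hm : m = l
  · subst hm
    obtain ⟨t, ht⟩ := he.sandwich_of_id m (x * (f j * a))
    have h1 := LinearMap.congr_fun h0 ⟨e m * (x * f j), mem_corner.2 ⟨x, rfl⟩⟩
    rw [LinearMap.flip_apply, cornerPairing_apply] at h1
    have h2 : e m * (x * f j) * (f j * (a * e m)) = (c * t) • e m := by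
      calc _ = e m * (x * ((f j * f j) * a)) * e m := by simp only [mul_assoc]
        _ = _ := by simp only [hff, smul_mul_assoc, mul_smul_comm, ht, smul_smul]
    simp only [h2, MonoidAlgebra.coeff_smul_apply, LinearMap.zero_apply, smul_eq_mul] at h1
    have h3 : t = 0 := by
      simpa [hc, coeff_one_ne_zero_of_quasi_idempotent hc' hee hel] using h1
    rw [h3, zero_smul] at ht
    simpa only [mul_assoc] using ht
  · have := he.ortho_of_id hm (x * (f j * a))
    simpa only [mul_assoc] using this

theorem conjSum_mul_corner [CharZero K] [Fintype H] [Finite G] (hf : SymmetrizerSystem Ψ f)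
    (he : SymmetrizerSystem (MonoidHom.id G) e) {j : J} {l : L} (hj : f j ≠ 0) (hl : e l ≠ 0)
    (u : corner (K := K) (f j) (e l)) (w : corner (K := K) (e l) (f j)) :
    ∃ κ : K, κ ≠ 0 ∧ ∀ u' : corner (K := K) (f j) (e l),
      conjSum Ψ (u.1 * w.1) * u'.1 = (κ * (cornerPairing (e l) (f j) w u')) • u.1 := by
  obtain ⟨c, hc, hff⟩ := hf.idem j
  obtain ⟨c', hc', hee⟩ := he.idem l
  obtain ⟨κ, hκ, hZ⟩ := conjSum_mul_self (hf.sandwich j) hc hff (hf.mem j) hj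
  have hτ := coeff_one_ne_zero_of_quasi_idempotent hc' hee hl
  refine ⟨κ * c' / (c * (e l).coeff 1), div_ne_zero (mul_ne_zero hκ hc') (mul_ne_zero hc hτ), ?_⟩
  rintro ⟨u', hu'⟩
  obtain ⟨u, hu⟩ := u
  obtain ⟨w, hw⟩ := w
  obtain ⟨x, rfl⟩ := mem_corner.1 hu
  obtain ⟨y, rfl⟩ := mem_corner.1 hw
  obtain ⟨x', rfl⟩ := mem_corner.1 hu'
  choose s hs using hf.sandwich j
  obtain ⟨t, ht⟩ := he.sandwich_of_id l (y * (f j * x'))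
  have h1 : e l * (y * f j) * (f j * (x' * e l)) = (c * t) • e l := by
    calc _ = e l * (y * ((f j * f j) * x')) * e l := by simp only [mul_assoc]
      _ = _ := by simp only [hff, smul_mul_assoc, mul_smul_comm, ht, smul_smul]
  have h2 : ∀ h, MonoidAlgebra.of K G (Ψ h) * (f j * (x * e l) * (e l * (y * f j))) *
      MonoidAlgebra.of K G (Ψ h⁻¹) * (f j * (x' * e l)) =
      (t * c') • (MonoidAlgebra.of K G (Ψ h) * f j * MonoidAlgebra.of K G (Ψ h⁻¹) * f j *
        (x * e l)) := by
    intro h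
    have e1 : MonoidAlgebra.of K G (Ψ h) * f j * MonoidAlgebra.of K G (Ψ h⁻¹) * f j * (x * e l) =
        s h⁻¹ • (MonoidAlgebra.of K G (Ψ h) * f j * (x * e l)) := by
      calc _ = MonoidAlgebra.of K G (Ψ h) * (f j * MonoidAlgebra.of K G (Ψ h⁻¹) * f j) *
              (x * e l) := by simp only [mul_assoc]
        _ = _ := by rw [hs]; simp only [smul_mul_assoc, mul_smul_comm]
    calc _ = MonoidAlgebra.of K G (Ψ h) * (f j * (x * (e l * (e l * (y *
            ((f j * MonoidAlgebra.of K G (Ψ h⁻¹) * f j) * (x' * e l))))))) := by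
          simp only [mul_assoc]
      _ = s h⁻¹ • (MonoidAlgebra.of K G (Ψ h) * (f j * (x * (e l *
            (e l * (y * (f j * x')) * e l))))) := by
          rw [hs]; simp only [smul_mul_assoc, mul_smul_comm, mul_assoc]
      _ = _ := by
          rw [ht, e1]
          simp only [mul_smul_comm, hee, smul_smul, mul_assoc]
          congr 1; ring
  rw [cornerPairing_apply]
  simp only [conjSum, Finset.sum_mul, h2, h1]
  rw [← Finset.smul_sum, ← Finset.sum_mul, ← Finset.sum_mul]
  change (t * c') • (conjSum Ψ (f j) * f j * (x * e l)) = _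
  rw [hZ, smul_mul_assoc, smul_smul, MonoidAlgebra.coeff_smul_apply, smul_eq_mul]
  congr 1
  field_simp

theorem conjSum_mul_corner_eq_zero [Fintype H] (hf : SymmetrizerSystem Ψ f)
    (he : SymmetrizerSystem (MonoidHom.id G) e) {j j' : J} {l l' : L} (h : l = l' → j ≠ j')
    (u : corner (K := K) (f j) (e l)) (w : corner (K := K) (e l) (f j))
    (u' : corner (K := K) (f j') (e l')) : conjSum Ψ (u.1 * w.1) * u'.1 = 0 := by
  obtain ⟨u', hu'⟩ := u'
  obtain ⟨u, hu⟩ := u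
  obtain ⟨w, hw⟩ := w
  obtain ⟨y, rfl⟩ := mem_corner.1 hw
  obtain ⟨x', rfl⟩ := mem_corner.1 hu'
  simp only [conjSum, Finset.sum_mul]
  refine Finset.sum_eq_zero fun g _ => ?_
  have key : e l * (y * f j) * (MonoidAlgebra.of K G (Ψ g⁻¹) * (f j' * (x' * e l'))) = 0 := by
    by_cases hl : l = l'
    · calc _ = e l * (y * ((f j * MonoidAlgebra.of K G (Ψ g⁻¹) * f j') * (x' * e l'))) := by
            simp only [mul_assoc]
        _ = 0 := by rw [hf.ortho _ _ _ (h hl)]; simp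
    · calc _ = e l * (y * f j * MonoidAlgebra.of K G (Ψ g⁻¹) * f j' * x') * e l' := by
            simp only [mul_assoc]
        _ = 0 := he.ortho_of_id hl _
  calc _ = MonoidAlgebra.of K G (Ψ g) * u *
        (e l * (y * f j) * (MonoidAlgebra.of K G (Ψ g⁻¹) * (f j' * (x' * e l')))) := by
        simp only [mul_assoc]
    _ = 0 := by rw [key, mul_zero]

end SymmetrizerSystem

/-- The elements of `z A` commuting with the image of `H`. -/
def centralizerPart (Ψ : H →* G) (z : MonoidAlgebra K G) : Submodule K (MonoidAlgebra K G) where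
  carrier := {a | z * a = a ∧ ∀ h, Commute (MonoidAlgebra.of K G (Ψ h)) a}
  add_mem' ha hb := ⟨by rw [mul_add, ha.1, hb.1], fun h => (ha.2 h).add_right (hb.2 h)⟩
  zero_mem' := ⟨mul_zero _, fun _ => Commute.zero_right _⟩
  smul_mem' c a ha := ⟨by rw [mul_smul_comm, ha.1], fun h => (ha.2 h).smul_right c⟩

theorem mem_centralizerPart {Ψ : H →* G} {z a : MonoidAlgebra K G} :
    a ∈ centralizerPart Ψ z ↔ z * a = a ∧ ∀ h, Commute (MonoidAlgebra.of K G (Ψ h)) a := Iff.rfl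

namespace SymmetrizerSystem

variable {Ψ : H →* G} {f : J → MonoidAlgebra K G} {e : L → MonoidAlgebra K G}

theorem mul_mem_corner (hf : SymmetrizerSystem Ψ f) {z : MonoidAlgebra K G}
    (a : centralizerPart Ψ z) (j : J) (y : MonoidAlgebra K G) :
    ∀ u ∈ corner (K := K) (f j) y, LinearMap.mulLeft K a.1 u ∈ corner (K := K) (f j) y := by
  intro u hu
  obtain ⟨x, rfl⟩ := mem_corner.1 hu
  refine mem_corner.2 ⟨a * x, ?_⟩
  rw [LinearMap.mulLeft_apply, ← mul_assoc a.1,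
    ← (commute_of_mem_groupSpan a.2.2 (hf.mem j)).eq]
  simp only [mul_assoc]

/-- The centralizer of `H` acts on the corners `f j A e l` by left multiplication. -/
noncomputable def centralizerAction (hf : SymmetrizerSystem Ψ f) (z : MonoidAlgebra K G)
    (e : L → MonoidAlgebra K G) (P : L → Prop) :
    centralizerPart Ψ z →ₗ[K]
      ∀ p : {l // P l} × J, Module.End K (corner (K := K) (f p.2) (e p.1)) :=
  LinearMap.pi fun p =>
    { toFun := fun a => (LinearMap.mulLeft K a.1).restrict (hf.mul_mem_corner a p.2 (e p.1))
      map_add' := fun a b => by ext u; simp [add_mul]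
      map_smul' := fun c a => by ext u; simp }

theorem centralizerAction_apply (hf : SymmetrizerSystem Ψ f) (z : MonoidAlgebra K G)
    (e : L → MonoidAlgebra K G) (P : L → Prop) (a : centralizerPart Ψ z) (p : {l // P l} × J)
    (u : corner (K := K) (f p.2) (e p.1)) :
    (hf.centralizerAction z e P a p u : MonoidAlgebra K G) = a.1 * u.1 := rfl

theorem centralizerAction_injective (hf : SymmetrizerSystem Ψ f)
    (he : SymmetrizerSystem (MonoidHom.id G) e) {P : L → Prop} {z : MonoidAlgebra K G}
    (hzc : ∀ x, Commute z x) (hz0 : ∀ l, ¬ P l → z * e l = 0) :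
    Function.Injective (hf.centralizerAction z e P) := by
  rw [injective_iff_map_eq_zero]
  intro a ha
  refine Subtype.ext (he.eq_zero_of_forall_mul fun l x => ?_)
  by_cases hl : P l
  · have := hf.map_one_eq_zero (LinearMap.mulLeft K a.1 ∘ₗ LinearMap.mulRight K (x * e l))
      fun j h h' => by
        have h1 := congrArg Subtype.val (LinearMap.congr_fun (congrFun ha (⟨l, hl⟩, j))
          ⟨f j * (MonoidAlgebra.of K G (Ψ h') * x * e l), mem_corner.2 ⟨_, rfl⟩⟩)
        rw [centralizerAction_apply] at h1
        have h2 := (a.2.2 h).eq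
        calc a.1 * (MonoidAlgebra.of K G (Ψ h) * f j * MonoidAlgebra.of K G (Ψ h') * (x * e l))
            = (a.1 * MonoidAlgebra.of K G (Ψ h)) *
                (f j * (MonoidAlgebra.of K G (Ψ h') * x * e l)) := by simp only [mul_assoc]
          _ = 0 := by
              rw [← h2, mul_assoc, h1]
              simp
    simpa using this
  · rw [← a.2.1, (hzc a.1).eq, mul_assoc, ← mul_assoc z, (hzc x).eq, mul_assoc x, hz0 l hl]
    simp

theorem single_smulRight_mem_range [DecidableEq L] [DecidableEq J] [CharZero K] [Finite G]
    [Fintype H] (hf : SymmetrizerSystem Ψ f)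
    (he : SymmetrizerSystem (MonoidHom.id G) e) {P : L → Prop} {z : MonoidAlgebra K G}
    (hzc : ∀ x, Commute z x) (hz1 : ∀ l, P l → z * e l = e l) (p : {l // P l} × J)
    (φ : Module.Dual K (corner (K := K) (f p.2) (e p.1)))
    (u : corner (K := K) (f p.2) (e p.1)) :
    Pi.single p (φ.smulRight u) ∈ LinearMap.range (hf.centralizerAction z e P) := by
  by_cases h0 : f p.2 = 0 ∨ e p.1 = 0
  · have hu : u = 0 := by
      obtain ⟨u, hu⟩ := u
      obtain ⟨x, rfl⟩ := mem_corner.1 hu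
      rw [Submodule.mk_eq_zero]
      rcases h0 with h | h <;> simp [h]
    rw [hu, LinearMap.smulRight_zero, Pi.single_zero]
    exact zero_mem _
  push Not at h0
  obtain ⟨w, rfl⟩ := hf.cornerPairing_surjective he p.2 p.1 φ
  obtain ⟨κ, hκ, h⟩ := hf.conjSum_mul_corner he h0.1 h0.2 u w
  have hz : ∀ v, z * conjSum Ψ v = conjSum Ψ (z * v) := fun v => by
    simp only [conjSum, Finset.mul_sum]
    refine Finset.sum_congr rfl fun g _ => ?_
    rw [← mul_assoc, ← mul_assoc, (hzc _).eq, mul_assoc _ z]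
  have hzu : z * u.1 = u.1 := by
    obtain ⟨u, hu⟩ := u
    obtain ⟨x, rfl⟩ := mem_corner.1 hu
    change z * (f p.2 * (x * e p.1)) = (f p.2 * (x * e p.1))
    rw [← mul_assoc, (hzc _).eq, mul_assoc, ← mul_assoc z, (hzc _).eq, mul_assoc x,
      hz1 _ p.1.2]
  refine ⟨⟨κ⁻¹ • conjSum Ψ (u.1 * w.1), ?_, fun g => (conjSum_commute Ψ _ g).smul_right _⟩, ?_⟩
  · rw [mul_smul_comm, hz, ← mul_assoc, hzu]
  · funext q
    refine LinearMap.ext fun u' => Subtype.ext ?_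
    rw [centralizerAction_apply]
    simp only [smul_mul_assoc]
    by_cases hq : q = p
    · subst hq
      rw [h, smul_smul, inv_mul_cancel_left₀ hκ, Pi.single_eq_same]
      rfl
    · rw [Pi.single_eq_of_ne hq, hf.conjSum_mul_corner_eq_zero he, smul_zero]
      · rfl
      · intro h1 h2
        exact hq (Prod.ext (Subtype.ext h1.symm) h2.symm)

theorem centralizerAction_surjective [Finite J] [Finite L] [CharZero K] [Finite G] [Fintype H]
    (hf : SymmetrizerSystem Ψ f)
    (he : SymmetrizerSystem (MonoidHom.id G) e) {P : L → Prop} {z : MonoidAlgebra K G}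
    (hzc : ∀ x, Commute z x) (hz1 : ∀ l, P l → z * e l = e l) :
    Function.Surjective (hf.centralizerAction z e P) := by
  classical
  have := Fintype.ofFinite J
  have := Fintype.ofFinite L
  rw [← LinearMap.range_eq_top, eq_top_iff]
  intro S _
  rw [← Finset.univ_sum_single S]
  refine sum_mem fun p _ => ?_
  let b := Module.finBasis K (corner (K := K) (f p.2) (e p.1))
  have : S p = ∑ i, (b.coord i).smulRight (S p (b i)) := by
    refine b.ext fun i => ?_
    simp [Finsupp.single_apply]
  rw [this]
  have h2 : Pi.single p (∑ i, (b.coord i).smulRight (S p (b i))) =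
      ∑ i, Pi.single (M := fun p : {l // P l} × J =>
        Module.End K (corner (K := K) (f p.2) (e p.1))) p
        ((b.coord i).smulRight (S p (b i))) :=
    map_sum (LinearMap.single K (fun p : {l // P l} × J =>
        Module.End K (corner (K := K) (f p.2) (e p.1))) p) _ _
  rw [h2]
  exact sum_mem fun i _ => hf.single_smulRight_mem_range he hzc hz1 p _ _

theorem finrank_centralizerPart [Fintype J] [Fintype L] [CharZero K] [Finite G] [Finite H]
    (hf : SymmetrizerSystem Ψ f)
    (he : SymmetrizerSystem (MonoidHom.id G) e) (P : L → Prop) [DecidablePred P]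
    {z : MonoidAlgebra K G} (hzc : ∀ x, Commute z x) (hz1 : ∀ l, P l → z * e l = e l)
    (hz0 : ∀ l, ¬ P l → z * e l = 0) :
    Module.finrank K (centralizerPart Ψ z) =
      ∑ l, if P l then ∑ j, Module.finrank K (corner (K := K) (f j) (e l)) ^ 2 else 0 := by
  have := Fintype.ofFinite H
  rw [(LinearEquiv.ofBijective _ ⟨hf.centralizerAction_injective he hzc hz0,
    hf.centralizerAction_surjective he hzc hz1⟩).finrank_eq, Module.finrank_pi_fintype,
    Fintype.sum_prod_type, ← Finset.sum_filter,
    ← Finset.sum_subtype_of_mem (p := P)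
      (fun l => ∑ j, Module.finrank K (corner (K := K) (f j) (e l)) ^ 2)
      fun l hl => (Finset.mem_filter.1 hl).2]
  refine Finset.sum_congr (by ext l; simpa using l.2) fun l _ => Finset.sum_congr rfl fun j _ => ?_
  exact (Module.finrank_linearMap K K _ _).trans (sq _).symm

end SymmetrizerSystem

end GroupAlgebra

section YoungSymmetrizers

variable {K : Type*} [Field K] {T : Type*} [Fintype T] [DecidableEq T]

/-- The permutations preserving the fibres of `r`. -/
def fiberPerms (r : T → ℕ) : Finset (Equiv.Perm T) :=
  Finset.univ.filter fun σ => ∀ t, r (σ t) = r t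

theorem mem_fiberPerms {r : T → ℕ} {σ : Equiv.Perm T} :
    σ ∈ fiberPerms r ↔ ∀ t, r (σ t) = r t := by simp [fiberPerms]

theorem inv_mem_fiberPerms {r : T → ℕ} {σ : Equiv.Perm T} (h : σ ∈ fiberPerms r) :
    σ⁻¹ ∈ fiberPerms r := by
  rw [mem_fiberPerms] at *
  intro t
  simpa using (h (σ⁻¹ t)).symm

theorem mul_mem_fiberPerms {r : T → ℕ} {σ τ : Equiv.Perm T} (h : σ ∈ fiberPerms r)
    (h' : τ ∈ fiberPerms r) : σ * τ ∈ fiberPerms r := by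
  rw [mem_fiberPerms] at *
  intro t
  rw [Equiv.Perm.mul_apply, h, h']

theorem swap_mem_fiberPerms {r : T → ℕ} {s t : T} (h : r s = r t) :
    Equiv.swap s t ∈ fiberPerms r := by
  rw [mem_fiberPerms]
  intro u
  rw [Equiv.swap_apply_def]
  split_ifs with h1 h2
  · rw [h1, h]
  · rw [h2, h]
  · rfl

/-- The sum of the permutations preserving the fibres of `r`. -/
noncomputable def rowSym (K : Type*) [Field K] (r : T → ℕ) : MonoidAlgebra K (Equiv.Perm T) :=
  ∑ p ∈ fiberPerms r, MonoidAlgebra.single p 1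

/-- The signed sum of the permutations preserving the fibres of `c`. -/
noncomputable def colAnti (K : Type*) [Field K] (c : T → ℕ) : MonoidAlgebra K (Equiv.Perm T) :=
  ∑ q ∈ fiberPerms c, MonoidAlgebra.single q ((Equiv.Perm.sign q : ℤ) : K)

theorem of_mul_rowSym {r : T → ℕ} {σ : Equiv.Perm T} (h : σ ∈ fiberPerms r) :
    MonoidAlgebra.of K _ σ * rowSym K r = rowSym K r := by
  rw [rowSym, Finset.mul_sum]
  refine Finset.sum_bij' (fun p _ => σ * p) (fun p _ => σ⁻¹ * p)
    (fun p hp => mul_mem_fiberPerms h hp)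
    (fun p hp => mul_mem_fiberPerms (inv_mem_fiberPerms h) hp) ?_ ?_ ?_ <;>
  simp [MonoidAlgebra.single_mul_single]

theorem rowSym_mul_of {r : T → ℕ} {σ : Equiv.Perm T} (h : σ ∈ fiberPerms r) :
    rowSym K r * MonoidAlgebra.of K _ σ = rowSym K r := by
  rw [rowSym, Finset.sum_mul]
  refine Finset.sum_bij' (fun p _ => p * σ) (fun p _ => p * σ⁻¹)
    (fun p hp => mul_mem_fiberPerms hp h)
    (fun p hp => mul_mem_fiberPerms hp (inv_mem_fiberPerms h)) ?_ ?_ ?_ <;>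
  simp [MonoidAlgebra.single_mul_single]

theorem sign_mul_sign_cast (σ : Equiv.Perm T) :
    ((Equiv.Perm.sign σ : ℤ) : K) * ((Equiv.Perm.sign σ : ℤ) : K) = 1 := by
  rw [← Int.cast_mul, ← Units.val_mul, Int.units_mul_self]
  simp

theorem of_mul_colAnti {c : T → ℕ} {σ : Equiv.Perm T} (h : σ ∈ fiberPerms c) :
    MonoidAlgebra.of K _ σ * colAnti K c = ((Equiv.Perm.sign σ : ℤ) : K) • colAnti K c := by
  rw [colAnti, Finset.mul_sum, Finset.smul_sum]
  refine Finset.sum_bij' (fun p _ => σ * p) (fun p _ => σ⁻¹ * p)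
    (fun p hp => mul_mem_fiberPerms h hp)
    (fun p hp => mul_mem_fiberPerms (inv_mem_fiberPerms h) hp) ?_ ?_ ?_ <;>
  simp [MonoidAlgebra.single_mul_single, ← mul_assoc, sign_mul_sign_cast]

theorem colAnti_mul_of {c : T → ℕ} {σ : Equiv.Perm T} (h : σ ∈ fiberPerms c) :
    colAnti K c * MonoidAlgebra.of K _ σ = ((Equiv.Perm.sign σ : ℤ) : K) • colAnti K c := by
  rw [colAnti, Finset.sum_mul, Finset.smul_sum]
  refine Finset.sum_bij' (fun p _ => p * σ) (fun p _ => p * σ⁻¹)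
    (fun p hp => mul_mem_fiberPerms hp h)
    (fun p hp => mul_mem_fiberPerms hp (inv_mem_fiberPerms h)) ?_ ?_ ?_ <;>
  simp [MonoidAlgebra.single_mul_single]
  intro q _
  rw [mul_left_comm, sign_mul_sign_cast, mul_one]

theorem eq_zero_of_eq_neg {M : Type*} [AddCommGroup M] [Module K M] [CharZero K] {x : M}
    (h : x = -x) : x = 0 := by
  have h2 : (2 : K) • x = 0 := by
    rw [two_smul]
    nth_rewrite 1 [h]
    exact neg_add_cancel x
  exact (smul_eq_zero.1 h2).resolve_left two_ne_zero

theorem rowSym_mul_of_mul_colAnti [CharZero K] {r c : T → ℕ} {σ : Equiv.Perm T}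
    (h : rowSym K r * MonoidAlgebra.of K _ σ * colAnti K c ≠ 0) (s t : T) (hr : r s = r t)
    (hc : c (σ⁻¹ s) = c (σ⁻¹ t)) : s = t := by
  by_contra hst
  refine h (eq_zero_of_eq_neg (K := K) ?_)
  have h1 : MonoidAlgebra.of K _ (Equiv.swap s t) * MonoidAlgebra.of K _ σ =
      MonoidAlgebra.of K _ σ * MonoidAlgebra.of K _ (Equiv.swap (σ⁻¹ s) (σ⁻¹ t)) := by
    rw [← map_mul, ← map_mul, Equiv.swap_mul_eq_mul_swap]
  have h2 : Equiv.Perm.sign (Equiv.swap (σ⁻¹ s) (σ⁻¹ t)) = -1 :=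
    Equiv.Perm.sign_swap fun h => hst (σ⁻¹.injective h)
  calc rowSym K r * MonoidAlgebra.of K _ σ * colAnti K c
      = rowSym K r * (MonoidAlgebra.of K _ (Equiv.swap s t) * MonoidAlgebra.of K _ σ) *
          colAnti K c := by rw [← mul_assoc, rowSym_mul_of (swap_mem_fiberPerms hr)]
    _ = -(rowSym K r * MonoidAlgebra.of K _ σ * colAnti K c) := by
        rw [h1, mul_assoc, mul_assoc, of_mul_colAnti (swap_mem_fiberPerms hc), h2]
        simp [mul_assoc]

theorem colAnti_mul_of_mul_rowSym [CharZero K] {r c : T → ℕ} {σ : Equiv.Perm T}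
    (h : colAnti K c * MonoidAlgebra.of K _ σ * rowSym K r ≠ 0) (s t : T) (hr : r s = r t)
    (hc : c (σ s) = c (σ t)) : s = t := by
  by_contra hst
  refine h (eq_zero_of_eq_neg (K := K) ?_)
  have h1 : MonoidAlgebra.of K _ σ * MonoidAlgebra.of K _ (Equiv.swap s t) =
      MonoidAlgebra.of K _ (Equiv.swap (σ s) (σ t)) * MonoidAlgebra.of K _ σ := by
    rw [← map_mul, ← map_mul, Equiv.mul_swap_eq_swap_mul]
  have h2 : Equiv.Perm.sign (Equiv.swap (σ s) (σ t)) = -1 :=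
    Equiv.Perm.sign_swap fun h => hst (σ.injective h)
  calc colAnti K c * MonoidAlgebra.of K _ σ * rowSym K r
      = colAnti K c * (MonoidAlgebra.of K _ σ * MonoidAlgebra.of K _ (Equiv.swap s t)) *
          rowSym K r := by rw [mul_assoc, mul_assoc, mul_assoc, of_mul_rowSym (swap_mem_fiberPerms hr)]
    _ = -(colAnti K c * MonoidAlgebra.of K _ σ * rowSym K r) := by
        rw [h1, ← mul_assoc, colAnti_mul_of (swap_mem_fiberPerms hc), h2]
        simp

/-- `r` and `c` give the row and column of the cells of a filling, by the elements of `T`, of the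
diagram with row lengths `l`. -/
structure IsTableau (r c : T → ℕ) (l : ℕ → ℕ) : Prop where
  inj : ∀ s t, r s = r t → c s = c t → s = t
  lt : ∀ t, c t < l (r t)
  surj : ∀ i j, j < l i → ∃ t, r t = i ∧ c t = j

namespace IsTableau

variable {r c r' c' : T → ℕ} {l l' : ℕ → ℕ}

theorem card_filter_lt (h : IsTableau r c l) (i j : ℕ) :
    (Finset.univ.filter fun t => r t = i ∧ c t < j).card = min (l i) j := by
  rw [← Finset.card_range (min (l i) j)]
  refine Finset.card_bij (fun t _ => c t) ?_ ?_ ?_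
  · intro t ht
    have := h.lt t
    simp only [Finset.mem_filter, Finset.mem_univ, true_and] at ht
    rw [ht.1] at this
    simp [this, ht.2]
  · intro s hs t ht hst
    simp only [Finset.mem_filter, Finset.mem_univ, true_and] at hs ht
    exact h.inj s t (hs.1.trans ht.1.symm) hst
  · intro b hb
    simp only [Finset.mem_range, lt_min_iff] at hb
    obtain ⟨t, h1, h2⟩ := h.surj i b hb.1
    exact ⟨t, by simp [h1, h2, hb.2], h2⟩

theorem card_filter_row (h : IsTableau r c l) (i : ℕ) :
    (Finset.univ.filter fun t => r t = i).card = l i := by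
  rw [← min_self (l i), ← h.card_filter_lt]
  congr 1
  ext t
  simp only [Finset.mem_filter, Finset.mem_univ, true_and, iff_self_and]
  rintro rfl
  exact h.lt t

theorem card_filter_lt_le (h : IsTableau r c l) (hinj : ∀ s t, r s = r t → c' s = c' t → s = t)
    (i j : ℕ) : (Finset.univ.filter fun t => r t = i ∧ c' t < j).card ≤
      (Finset.univ.filter fun t => r t = i ∧ c t < j).card := by
  rw [h.card_filter_lt, le_min_iff]
  constructor
  · rw [← h.card_filter_row]
    exact Finset.card_le_card fun t => by simp +contextual
  · rw [← Finset.card_range j]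
    refine Finset.card_le_card_of_injOn c' (fun t ht => by simp at ht; simp [ht.2]) ?_
    intro s hs t ht hst
    simp only [Finset.coe_filter, Finset.mem_univ, true_and, Set.mem_ofPred_eq] at hs ht
    exact hinj s t (hs.1.trans ht.1.symm) hst

theorem card_eq_sum_card (r c : T → ℕ) (j : ℕ) :
    (Finset.univ.filter fun t => c t < j).card =
      ∑ i ∈ Finset.univ.image r, (Finset.univ.filter fun t => r t = i ∧ c t < j).card := by
  rw [Finset.card_eq_sum_card_fiberwise (f := r) (t := Finset.univ.image r)
    (fun t _ => by simp)]
  refine Finset.sum_congr rfl fun i _ => congrArg _ ?_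
  ext t
  simp [and_comm]

theorem card_lt_le (h : IsTableau r c l) (hinj : ∀ s t, r s = r t → c' s = c' t → s = t)
    (j : ℕ) : (Finset.univ.filter fun t => c' t < j).card ≤
      (Finset.univ.filter fun t => c t < j).card := by
  rw [card_eq_sum_card r c, card_eq_sum_card r c']
  exact Finset.sum_le_sum fun i _ => h.card_filter_lt_le hinj i j

theorem exists_perm (h : IsTableau r c l) (hinj : ∀ s t, r s = r t → c' s = c' t → s = t)
    (hcard : ∀ j, (Finset.univ.filter fun t => c' t < j).card =
      (Finset.univ.filter fun t => c t < j).card) :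
    ∃ π : Equiv.Perm T, ∀ t, r (π t) = r t ∧ c (π t) = c' t := by
  have h1 : ∀ t j, (Finset.univ.filter fun s => r s = r t ∧ c' s < j).card =
      (Finset.univ.filter fun s => r s = r t ∧ c s < j).card := by
    intro t j
    have := hcard j
    rw [card_eq_sum_card r c, card_eq_sum_card r c',
      Finset.sum_eq_sum_iff_of_le fun i _ => h.card_filter_lt_le hinj i j] at this
    exact this _ (by simp)
  have h2 : ∀ t, c' t < l (r t) := by
    intro t
    have h3 := h1 t (l (r t))
    rw [h.card_filter_lt, min_self, ← h.card_filter_row] at h3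
    have h4 := Finset.eq_of_subset_of_card_le (fun s => by simp +contextual) h3.ge
    have h5 : t ∈ Finset.univ.filter fun s => r s = r t := by simp
    rw [← h4] at h5
    rw [← h.card_filter_row (r t)]
    exact (Finset.mem_filter.1 h5).2.2
  choose π hπ using fun t => h.surj (r t) (c' t) (h2 t)
  have hπi : Function.Injective π := by
    intro s t hst
    have h3 := hπ s
    rw [hst] at h3
    exact hinj s t (h3.1.symm.trans (hπ t).1) (h3.2.symm.trans (hπ t).2)
  exact ⟨Equiv.ofBijective π (Finite.injective_iff_bijective.1 hπi), hπ⟩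

theorem card_filter_col (h : IsTableau r c l) (j : ℕ) {s : Finset ℕ} (hs : ∀ i, i ∈ s ↔ j < l i) :
    (Finset.univ.filter fun t => c t = j).card = s.card := by
  refine Finset.card_bij (fun t _ => r t) ?_ ?_ ?_
  · intro t ht
    rw [hs, ← (Finset.mem_filter.1 ht).2]
    exact h.lt t
  · intro t ht t' ht' heq
    exact h.inj t t' heq ((Finset.mem_filter.1 ht).2.trans (Finset.mem_filter.1 ht').2.symm)
  · intro i hi
    obtain ⟨t, h1, h2⟩ := h.surj i j ((hs i).1 hi)
    exact ⟨t, by simp [h2], h1⟩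

theorem mul_mul_mem_span [CharZero K] (h : IsTableau r c l) (x : MonoidAlgebra K (Equiv.Perm T)) :
    ∃ s : K, rowSym K r * x * colAnti K c = s • (rowSym K r * colAnti K c) := by
  induction x using MonoidAlgebra.induction_on with
  | of σ =>
    by_cases h0 : rowSym K r * MonoidAlgebra.of K _ σ * colAnti K c = 0
    · exact ⟨0, by rw [h0, zero_smul]⟩
    obtain ⟨π, hπ⟩ := h.exists_perm (c' := fun t => c (σ⁻¹ t)) (rowSym_mul_of_mul_colAnti h0)
      fun j => Finset.card_equiv σ⁻¹ (by simp)
    have h1 : σ = π⁻¹ * (π * σ) := by simp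
    refine ⟨((Equiv.Perm.sign (π * σ) : ℤ) : K), ?_⟩
    rw [h1, map_mul, ← mul_assoc,
      rowSym_mul_of (inv_mem_fiberPerms (mem_fiberPerms.2 fun t => (hπ t).1)), mul_assoc,
      of_mul_colAnti (mem_fiberPerms.2 fun t => ?_), mul_smul_comm, ← h1]
    rw [Equiv.Perm.mul_apply, (hπ _).2, ← Equiv.Perm.mul_apply, inv_mul_cancel, Equiv.Perm.one_apply]
  | add a b ha hb =>
    obtain ⟨s, hs⟩ := ha
    obtain ⟨t, ht⟩ := hb
    exact ⟨s + t, by rw [mul_add, add_mul, hs, ht, add_smul]⟩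
  | smul r a ha =>
    obtain ⟨s, hs⟩ := ha
    exact ⟨r * s, by rw [mul_smul_comm, smul_mul_assoc, hs, smul_smul]⟩

theorem coeff_one (h : IsTableau r c l) : (rowSym K r * colAnti K c).coeff 1 = 1 := by
  have h0 : ∀ p ∈ fiberPerms r, ∀ q ∈ fiberPerms c, p * q = 1 → p = 1 ∧ q = 1 := by
    intro p hp q hq hpq
    have hq' : q = p⁻¹ := (inv_eq_of_mul_eq_one_right hpq).symm
    have hp' := inv_mem_fiberPerms hq
    rw [hq', inv_inv] at hp'
    have : p = 1 := Equiv.ext fun t =>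
      h.inj _ _ (mem_fiberPerms.1 hp t) (mem_fiberPerms.1 hp' t)
    exact ⟨this, by rw [hq', this, inv_one]⟩
  have h1 : (1 : Equiv.Perm T) ∈ fiberPerms r := by simp [mem_fiberPerms]
  have h1' : (1 : Equiv.Perm T) ∈ fiberPerms c := by simp [mem_fiberPerms]
  simp only [rowSym, colAnti, Finset.sum_mul, Finset.mul_sum, MonoidAlgebra.single_mul_single,
    MonoidAlgebra.coeff_sum, Finsupp.finsetSum_apply]
  rw [Finset.sum_comm, Finset.sum_eq_single_of_mem 1 h1, Finset.sum_eq_single_of_mem 1 h1']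
  · simp
  · intro q hq hne
    rw [MonoidAlgebra.coeff_single, Finsupp.single_apply, if_neg]
    exact fun hh => hne (h0 1 h1 q hq hh).2
  · intro p hp hne
    refine Finset.sum_eq_zero fun q hq => ?_
    rw [MonoidAlgebra.coeff_single, Finsupp.single_apply, if_neg]
    exact fun hh => hne (h0 p hp q hq hh).1

theorem mul_mul_eq_zero [CharZero K] (h : IsTableau r c l) (h' : IsTableau r' c' l')
    (hne : ∃ j, (Finset.univ.filter fun t => c t = j).card ≠
      (Finset.univ.filter fun t => c' t = j).card) (x : MonoidAlgebra K (Equiv.Perm T)) :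
    rowSym K r * colAnti K c * x * (rowSym K r' * colAnti K c') = 0 := by
  by_contra h0
  have h1 : ∃ σ, rowSym K r * MonoidAlgebra.of K _ σ * colAnti K c' ≠ 0 := by
    by_contra hh
    push Not at hh
    have key : ∀ y, rowSym K r * y * colAnti K c' = 0 := by
      intro y
      induction y using MonoidAlgebra.induction_on with
      | of σ => exact hh σ
      | add a b ha hb => rw [mul_add, add_mul, ha, hb, add_zero]
      | smul r a ha => rw [mul_smul_comm, smul_mul_assoc, ha, smul_zero]
    refine h0 ?_
    simpa only [mul_assoc] using key (colAnti K c * x * rowSym K r')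
  have h2 : ∃ σ, colAnti K c * MonoidAlgebra.of K _ σ * rowSym K r' ≠ 0 := by
    by_contra hh
    push Not at hh
    have key : ∀ y, colAnti K c * y * rowSym K r' = 0 := by
      intro y
      induction y using MonoidAlgebra.induction_on with
      | of σ => exact hh σ
      | add a b ha hb => rw [mul_add, add_mul, ha, hb, add_zero]
      | smul r a ha => rw [mul_smul_comm, smul_mul_assoc, ha, smul_zero]
    refine h0 ?_
    calc _ = rowSym K r * (colAnti K c * x * rowSym K r') * colAnti K c' := by
          simp only [mul_assoc]
      _ = 0 := by rw [key]; simp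
  obtain ⟨σ, hσ⟩ := h1
  obtain ⟨τ, hτ⟩ := h2
  have h3 : ∀ j, (Finset.univ.filter fun t => c' t < j).card ≤
      (Finset.univ.filter fun t => c t < j).card := fun j =>
    (Finset.card_equiv σ (by simp)).trans_le
      (h.card_lt_le (c' := fun t => c' (σ⁻¹ t)) (rowSym_mul_of_mul_colAnti hσ) j)
  have h4 : ∀ j, (Finset.univ.filter fun t => c t < j).card ≤
      (Finset.univ.filter fun t => c' t < j).card := fun j =>
    (Finset.card_equiv τ⁻¹ (by simp)).trans_le
      (h'.card_lt_le (c' := fun t => c (τ t)) (colAnti_mul_of_mul_rowSym hτ) j)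
  obtain ⟨j, hj⟩ := hne
  have h5 : ∀ c : T → ℕ, (Finset.univ.filter fun t => c t < j + 1).card =
      (Finset.univ.filter fun t => c t < j).card + (Finset.univ.filter fun t => c t = j).card := by
    intro c
    rw [← Finset.card_union_of_disjoint]
    · congr 1
      ext t
      simp only [Finset.mem_filter, Finset.mem_univ, true_and, Finset.mem_union]
      omega
    · rw [Finset.disjoint_filter]
      intro t _ h1 h2
      omega
  have := h5 c
  have := h5 c'
  have := h3 j
  have := h4 j
  have := h3 (j + 1)
  have := h4 (j + 1)
  omega

end IsTableau

end YoungSymmetrizers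

section CanonicalTableaux

theorem listBlock_cons (a : ℕ) (L : List ℕ) (t : ℕ) :
    listBlock (a :: L) t = if t < a then 0 else listBlock L (t - a) + 1 := by
  have key : ∀ (b : ℕ) (L : List ℕ) (u : ℕ), u < b →
      (L.scanl (· + ·) b).countP (fun s => decide (s ≤ u)) = 0 := by
    intro b L
    induction L generalizing b with
    | nil => intro u hu; simp [hu]
    | cons x L ih =>
      intro u hu
      rw [List.scanl_cons, List.countP_cons, ih _ _ (by omega)]
      simp [hu]
  have key2 : ∀ (b : ℕ) (L : List ℕ) (c u : ℕ),
      (L.scanl (· + ·) (b + c)).countP (fun s => decide (s ≤ b + u)) =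
        (L.scanl (· + ·) c).countP (fun s => decide (s ≤ u)) := by
    intro b L
    induction L with
    | nil => intro c u; simp
    | cons x L ih =>
      intro c u
      rw [List.scanl_cons, List.scanl_cons, List.countP_cons, List.countP_cons, add_assoc, ih]
      simp
  rw [listBlock, List.scanl_cons, List.tail_cons, zero_add]
  split_ifs with h
  · exact key _ _ _ h
  · obtain ⟨u, rfl⟩ := Nat.exists_eq_add_of_le (not_lt.1 h)
    have e := key2 a L 0 u
    rw [add_zero] at e
    rw [e, Nat.add_sub_cancel_left, listBlock]
    cases L <;> simp

theorem listCol_cons (a : ℕ) (L : List ℕ) (t : ℕ) :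
    listCol (a :: L) t = if t < a then t else listCol L (t - a) := by
  have key : ∀ (b : ℕ) (L : List ℕ) (u : ℕ), u < b →
      (L.scanl (· + ·) b).filter (fun s => decide (s ≤ u)) = [] := by
    intro b L
    induction L generalizing b with
    | nil => intro u hu; simp [hu]
    | cons x L ih =>
      intro u hu
      rw [List.scanl_cons, List.filter_cons_of_neg (by simp [hu]), ih _ _ (by omega)]
  have key2 : ∀ (b : ℕ) (L : List ℕ) (c u : ℕ),
      (L.scanl (· + ·) (b + c)).filter (fun s => decide (s ≤ b + u)) =
        ((L.scanl (· + ·) c).filter (fun s => decide (s ≤ u))).map (b + ·) := by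
    intro b L
    induction L with
    | nil => intro c u; by_cases h : c ≤ u <;> simp [h]
    | cons x L ih =>
      intro c u
      rw [List.scanl_cons, List.scanl_cons, List.filter_cons, List.filter_cons, add_assoc, ih]
      by_cases h : c ≤ u <;> simp [h]
  have key3 : ∀ (b : ℕ) (L : List ℕ), L ≠ [] → (L.map (b + ·)).foldr max 0 = b + L.foldr max 0 := by
    intro b L
    induction L with
    | nil => intro h; exact absurd rfl h
    | cons x L ih =>
      intro _
      by_cases h : L = []
      · simp [h]
      · rw [List.map_cons, List.foldr_cons, ih h, List.foldr_cons]
        omega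
  rw [listCol, List.scanl_cons, zero_add, List.filter_cons_of_pos (by simp), List.foldr_cons]
  split_ifs with h
  · rw [key _ _ _ h]
    simp
  · obtain ⟨u, rfl⟩ := Nat.exists_eq_add_of_le (not_lt.1 h)
    have e := key2 a L 0 u
    rw [add_zero] at e
    rw [e, key3, Nat.add_sub_cancel_left, listCol]
    · omega
    · cases L <;> simp

theorem listCol_lt (L : List ℕ) (t : ℕ) (ht : t < L.sum) :
    listCol L t < L.getD (listBlock L t) 0 := by
  induction L generalizing t with
  | nil => simp at ht
  | cons a L ih =>
    rw [listCol_cons, listBlock_cons]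
    split_ifs with h
    · simpa using h
    · rw [List.sum_cons] at ht
      simpa using ih (t - a) (by omega)

theorem listBlock_listCol_injective (L : List ℕ) (s t : ℕ) (hs : s < L.sum) (ht : t < L.sum)
    (hb : listBlock L s = listBlock L t) (hc : listCol L s = listCol L t) : s = t := by
  induction L generalizing s t with
  | nil => simp at ht
  | cons a L ih =>
    rw [listCol_cons, listCol_cons] at hc
    rw [listBlock_cons, listBlock_cons] at hb
    rw [List.sum_cons] at hs ht
    by_cases h1 : s < a <;> by_cases h2 : t < a <;> simp only [h1, h2, if_true, if_false] at hb hc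
    · exact hc
    · omega
    · omega
    · have := ih (s - a) (t - a) (by omega) (by omega) (by omega) hc
      omega

theorem exists_listBlock_listCol (L : List ℕ) (i j : ℕ) (h : j < L.getD i 0) :
    ∃ t < L.sum, listBlock L t = i ∧ listCol L t = j := by
  induction L generalizing i with
  | nil => simp at h
  | cons a L ih =>
    cases i with
    | zero =>
      have h : j < a := by simpa using h
      exact ⟨j, by rw [List.sum_cons]; omega, by simp [listBlock_cons, h],
        by simp [listCol_cons, h]⟩
    | succ i =>
      obtain ⟨t, h1, h2, h3⟩ := ih i (by simpa using h)
      exact ⟨a + t, by rw [List.sum_cons]; omega, by simp [listBlock_cons, h2],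
        by simp [listCol_cons, h3]⟩

theorem countP_eq_card_filter (L : List ℕ) (j : ℕ) :
    L.countP (fun a => decide (j < a)) =
      ((Finset.range L.length).filter fun i => j < L.getD i 0).card := by
  induction L with
  | nil => simp
  | cons a L ih =>
    rw [List.countP_cons, ih, List.length_cons, Finset.card_filter, Finset.card_filter,
      Finset.sum_range_succ']
    simp

variable {m : ℕ}

theorem partsList_coe (mu : Nat.Partition m) : (partsList mu : Multiset ℕ) = mu.parts := by
  rw [partsList, Multiset.coe_reverse, Multiset.sort_eq]

theorem partsList_sum (mu : Nat.Partition m) : (partsList mu).sum = m := by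
  rw [← Multiset.sum_coe, partsList_coe, mu.parts_sum]

/-- The row function of the canonical tableau. -/
def rowFn (mu : Nat.Partition m) : Fin m → ℕ := fun t => listBlock (partsList mu) t

/-- The column function of the canonical tableau. -/
def colFn (mu : Nat.Partition m) : Fin m → ℕ := fun t => listCol (partsList mu) t

theorem isTableau (mu : Nat.Partition m) :
    IsTableau (rowFn mu) (colFn mu) fun i => (partsList mu).getD i 0 where
  inj s t h1 h2 := Fin.ext (listBlock_listCol_injective (partsList mu) s t
    (by rw [partsList_sum]; exact s.2) (by rw [partsList_sum]; exact t.2) h1 h2)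
  lt t := listCol_lt _ _ (by rw [partsList_sum]; exact t.2)
  surj i j h := by
    obtain ⟨t, h1, h2, h3⟩ := exists_listBlock_listCol _ i j h
    rw [partsList_sum] at h1
    exact ⟨⟨t, h1⟩, h2, h3⟩

theorem card_colFn (mu : Nat.Partition m) (j : ℕ) :
    (Finset.univ.filter fun t => colFn mu t = j).card = mu.parts.countP (j < ·) := by
  rw [← partsList_coe, Multiset.coe_countP, countP_eq_card_filter]
  refine (isTableau mu).card_filter_col j fun i => ?_
  rw [Finset.mem_filter, Finset.mem_range, and_iff_right_iff_imp]
  intro h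
  by_contra hi
  rw [List.getD_eq_default _ _ (not_lt.1 hi)] at h
  omega

theorem exists_card_colFn_ne {lam mu : Nat.Partition m} (h : lam ≠ mu) :
    ∃ j, (Finset.univ.filter fun t => colFn lam t = j).card ≠
      (Finset.univ.filter fun t => colFn mu t = j).card := by
  by_contra! hh
  refine h (Nat.Partition.ext (Multiset.ext.2 fun a => ?_))
  simp only [card_colFn] at hh
  rcases a with _ | a
  · rw [Multiset.count_eq_zero_of_notMem, Multiset.count_eq_zero_of_notMem]
    · exact fun h => (mu.parts_pos h).ne' rfl
    · exact fun h => (lam.parts_pos h).ne' rfl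
  · have key : ∀ s : Multiset ℕ, s.countP (a < ·) = s.count (a + 1) + s.countP (a + 1 < ·) := by
      intro s
      induction s using Multiset.induction_on with
      | empty => simp
      | cons x s ih =>
        rw [Multiset.countP_cons, Multiset.count_cons, Multiset.countP_cons, ih]
        split_ifs <;> omega
    have h1 := key lam.parts
    have h2 := key mu.parts
    rw [hh] at h1
    have := hh (a + 1)
    omega

/-- The Young symmetrizer of the canonical tableau. -/
noncomputable def youngSym (K : Type*) [Field K] (mu : Nat.Partition m) :
    MonoidAlgebra K (Equiv.Perm (Fin m)) :=
  rowSym K (rowFn mu) * colAnti K (colFn mu)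

theorem blockYoungSymmetrizer_eq (K : Type) [Field K] (N o : ℕ) (mu : Nat.Partition m) :
    blockYoungSymmetrizer K N o m mu =
      rowSym K (shiftedRowFn N o m mu) * colAnti K (shiftedColFn N o m mu) := by
  rw [blockYoungSymmetrizer, rowSym, colAnti]
  congr 1
  · exact (Finset.sum_subtype _ (fun x => mem_fiberPerms)
      fun p => MonoidAlgebra.single p (1 : K)).symm
  · exact (Finset.sum_subtype _ (fun x => mem_fiberPerms)
      fun p => MonoidAlgebra.single p ((Equiv.Perm.sign p : ℤ) : K)).symm

theorem blockYoungSymmetrizer_zero (K : Type) [Field K] (mu : Nat.Partition m) :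
    blockYoungSymmetrizer K m 0 m mu = youngSym K mu := by
  have h1 : fiberPerms (shiftedRowFn m 0 m mu) = fiberPerms (rowFn mu) := by
    ext σ; simp [mem_fiberPerms, shiftedRowFn, rowFn]
  have h2 : fiberPerms (shiftedColFn m 0 m mu) = fiberPerms (colFn mu) := by
    ext σ; simp [mem_fiberPerms, shiftedColFn, colFn]
  rw [blockYoungSymmetrizer_eq, youngSym, rowSym, colAnti, h1, h2]
  rfl

theorem card_conjClasses_perm_le : Nat.card (ConjClasses (Equiv.Perm (Fin m))) ≤
    Fintype.card (Nat.Partition m) := by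
  rw [← Nat.card_eq_fintype_card]
  let F : ConjClasses (Equiv.Perm (Fin m)) → Nat.Partition (Fintype.card (Fin m)) :=
    Quotient.lift (fun σ => σ.partition) fun σ τ h => Equiv.Perm.partition_eq_of_isConj.1 h
  have hF : Function.Injective F := by
    intro a b
    induction a using Quotient.inductionOn
    induction b using Quotient.inductionOn
    intro h
    exact Quotient.sound (Equiv.Perm.partition_eq_of_isConj.2 h)
  have := Nat.card_le_card_of_injective F hF
  rwa [Fintype.card_fin] at this

theorem youngSym_system (K : Type*) [Field K] [CharZero K] (m : ℕ) :
    SymmetrizerSystem (MonoidHom.id (Equiv.Perm (Fin m)))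
      (youngSym K : Nat.Partition m → MonoidAlgebra K (Equiv.Perm (Fin m))) ∧
    ∃ z : Nat.Partition m → MonoidAlgebra K (Equiv.Perm (Fin m)), (∀ j x, Commute (z j) x) ∧
      (∀ j, z j * youngSym K j = youngSym K j) ∧
      (∀ i j, i ≠ j → z i * youngSym K j = 0) ∧ ∑ j, z j = 1 := by
  refine exists_central_idempotents (fun mu g => ?_) (fun lam mu x h =>
    (isTableau lam).mul_mul_eq_zero (isTableau mu) (exists_card_colFn_ne h) x)
    (fun mu => by rw [youngSym, (isTableau mu).coeff_one]; exact one_ne_zero)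
    card_conjClasses_perm_le
  obtain ⟨s, hs⟩ := (isTableau mu).mul_mul_mem_span (K := K)
    (colAnti K (colFn mu) * MonoidAlgebra.of K _ g * rowSym K (rowFn mu))
  exact ⟨s, by simpa only [youngSym, mul_assoc] using hs⟩

/-- The central idempotent of the partitions satisfying `P`. -/
theorem exists_central_projection (K : Type*) [Field K] [CharZero K] (m : ℕ)
    (P : Nat.Partition m → Prop) : ∃ z : MonoidAlgebra K (Equiv.Perm (Fin m)),
      (∀ x, Commute z x) ∧ (∀ l, P l → z * youngSym K l = youngSym K l) ∧
      ∀ l, ¬ P l → z * youngSym K l = 0 := by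
  classical
  obtain ⟨-, z, hz, h1, h0, -⟩ := youngSym_system K m
  refine ⟨∑ l ∈ Finset.univ.filter P, z l, fun x => Commute.sum_left _ _ _ fun l _ => hz l x,
    fun l hl => ?_, fun l hl => ?_⟩
  · rw [Finset.sum_mul, Finset.sum_eq_single_of_mem l (by simpa using hl) fun i _ hi => h0 i l hi,
      h1]
  · rw [Finset.sum_mul]
    refine Finset.sum_eq_zero fun i hi => h0 i l ?_
    rintro rfl
    exact hl (by simpa using hi)

end CanonicalTableaux

section Blocks

variable {n k : ℕ} {ν : Fin k → ℕ}

/-- The bijection between the consecutive blocks of sizes `ν` and `{0,…,n-1}`. -/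
def blockEquiv (h : ∑ i, ν i = n) : (Σ i, Fin (ν i)) ≃ Fin n :=
  finSigmaFinEquiv.trans (finCongr h)

theorem blockEquiv_val (h : ∑ i, ν i = n) (p : Σ i, Fin (ν i)) :
    (blockEquiv h p : ℕ) = blockOffset ν p.1 + p.2 := by
  have : (blockEquiv h p : ℕ) = (finSigmaFinEquiv p : ℕ) := rfl
  rw [this, finSigmaFinEquiv_apply, blockOffset]
  congr 1
  refine Finset.sum_bij (fun a _ => Fin.castLE p.1.2.le a) ?_ ?_ ?_ ?_
  · intro a _
    simp only [Finset.mem_filter, Finset.mem_univ, true_and, Fin.lt_def, Fin.val_castLE]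
    exact a.2
  · intro a _ b _ hab
    exact Fin.castLE_injective _ hab
  · intro b hb
    exact ⟨⟨b, (Finset.mem_filter.1 hb).2⟩, Finset.mem_univ _, rfl⟩
  · intro a _
    rfl

/-- The Young subgroup, as the image of a product of symmetric groups. -/
def youngHom (θ : (Σ i, Fin (ν i)) ≃ Fin n) : (∀ i, Equiv.Perm (Fin (ν i))) →* Equiv.Perm (Fin n) :=
  (θ.permCongrHom : _ →* _).comp (Equiv.Perm.sigmaCongrRightHom _)

theorem youngHom_apply (θ : (Σ i, Fin (ν i)) ≃ Fin n) (g : ∀ i, Equiv.Perm (Fin (ν i))) (i : Fin k)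
    (t : Fin (ν i)) : youngHom θ g (θ ⟨i, t⟩) = θ ⟨i, g i t⟩ := by
  simp [youngHom, Equiv.permCongrHom]

/-- The embedding of the symmetric group of the `i`-th block. -/
def blockHom (θ : (Σ i, Fin (ν i)) ≃ Fin n) (i : Fin k) :
    Equiv.Perm (Fin (ν i)) →* Equiv.Perm (Fin n) :=
  (youngHom θ).comp (MonoidHom.mulSingle (fun i => Equiv.Perm (Fin (ν i))) i)

theorem blockHom_apply_same (θ : (Σ i, Fin (ν i)) ≃ Fin n) (i : Fin k)
    (g : Equiv.Perm (Fin (ν i))) (t : Fin (ν i)) :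
    blockHom θ i g (θ ⟨i, t⟩) = θ ⟨i, g t⟩ := by
  rw [blockHom, MonoidHom.comp_apply, youngHom_apply, MonoidHom.mulSingle_apply, Pi.mulSingle_eq_same]

theorem blockHom_apply_ne (θ : (Σ i, Fin (ν i)) ≃ Fin n) {i j : Fin k} (h : j ≠ i)
    (g : Equiv.Perm (Fin (ν i))) (t : Fin (ν j)) :
    blockHom θ i g (θ ⟨j, t⟩) = θ ⟨j, t⟩ := by
  rw [blockHom, MonoidHom.comp_apply, youngHom_apply, MonoidHom.mulSingle_apply,
    Pi.mulSingle_eq_of_ne h]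
  rfl

theorem sign_blockHom (θ : (Σ i, Fin (ν i)) ≃ Fin n) (i : Fin k) (g : Equiv.Perm (Fin (ν i))) :
    Equiv.Perm.sign (blockHom θ i g) = Equiv.Perm.sign g := by
  induction g using Equiv.Perm.swap_induction_on with
  | one => simp
  | swap_mul f x y hxy ih =>
    rw [map_mul, map_mul, map_mul, ih, Equiv.Perm.sign_swap hxy]
    have : blockHom θ i (Equiv.swap x y) = Equiv.swap (θ ⟨i, x⟩) (θ ⟨i, y⟩) := by
      ext1 t
      obtain ⟨⟨j, t⟩, rfl⟩ := θ.surjective t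
      by_cases hj : j = i
      · subst hj
        rw [blockHom_apply_same, Equiv.swap_apply_def, Equiv.swap_apply_def]
        simp only [EmbeddingLike.apply_eq_iff_eq, Sigma.mk.injEq, heq_eq_eq, true_and]
        split_ifs <;> rfl
      · rw [blockHom_apply_ne θ hj, Equiv.swap_apply_of_ne_of_ne] <;>
        simp [hj]
    rw [this, Equiv.Perm.sign_swap]
    simpa using hxy

theorem blockHom_injective (θ : (Σ i, Fin (ν i)) ≃ Fin n) (i : Fin k) :
    Function.Injective (blockHom θ i) := by
  intro g h hgh
  ext1 t
  have := Equiv.congr_fun hgh (θ ⟨i, t⟩)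
  rw [blockHom_apply_same, blockHom_apply_same] at this
  simpa using this

theorem fiberPerms_block (θ : (Σ i, Fin (ν i)) ≃ Fin n) (i : Fin k) {f : Fin n → ℕ}
    {g : Fin (ν i) → ℕ} (h1 : ∀ t, f (θ ⟨i, t⟩) = n + g t)
    (h2 : ∀ j t, j ≠ i → f (θ ⟨j, t⟩) = θ ⟨j, t⟩) :
    fiberPerms f = (fiberPerms g).map ⟨blockHom θ i, blockHom_injective θ i⟩ := by
  ext σ
  simp only [Finset.mem_map, Function.Embedding.coeFn_mk]
  constructor
  · intro hσ
    rw [mem_fiberPerms] at hσ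
    have h3 : ∀ t, ∃ t', σ (θ ⟨i, t⟩) = θ ⟨i, t'⟩ := by
      intro t
      obtain ⟨⟨j, t'⟩, ht'⟩ := θ.surjective (σ (θ ⟨i, t⟩))
      by_cases hj : j = i
      · subst hj
        exact ⟨t', ht'.symm⟩
      · have h4 := hσ (θ ⟨i, t⟩)
        rw [← ht', h1, h2 j t' hj] at h4
        have := (θ ⟨j, t'⟩).2
        omega
    choose τ hτ using h3
    have hτi : Function.Injective τ := by
      intro s t hst
      have := hτ s
      rw [hst, ← hτ t, σ.injective.eq_iff, θ.injective.eq_iff] at this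
      simpa using this
    refine ⟨Equiv.ofBijective τ (Finite.injective_iff_bijective.1 hτi), ?_, ?_⟩
    · rw [mem_fiberPerms]
      intro t
      have := hσ (θ ⟨i, t⟩)
      rw [hτ, h1, h1] at this
      exact Nat.add_left_cancel this
    · ext1 t
      obtain ⟨⟨j, t⟩, rfl⟩ := θ.surjective t
      by_cases hj : j = i
      · subst hj
        rw [blockHom_apply_same, hτ]
        rfl
      · rw [blockHom_apply_ne θ hj]
        have h4 := hσ (θ ⟨j, t⟩)
        rw [h2 j t hj] at h4
        obtain ⟨⟨j', t'⟩, ht'⟩ := θ.surjective (σ (θ ⟨j, t⟩))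
        rw [← ht'] at h4 ⊢
        by_cases hj' : j' = i
        · subst hj'
          rw [h1] at h4
          have := (θ ⟨j, t⟩).2
          omega
        · rw [h2 _ _ hj'] at h4
          exact Fin.ext h4.symm
  · rintro ⟨τ, hτ, rfl⟩
    rw [mem_fiberPerms] at *
    intro t
    obtain ⟨⟨j, t⟩, rfl⟩ := θ.surjective t
    by_cases hj : j = i
    · subst hj
      rw [blockHom_apply_same, h1, h1, hτ]
    · rw [blockHom_apply_ne θ hj]

/-- The embedding of the group algebra of the `i`-th block. -/
noncomputable def blockAlgHom (K : Type*) [Field K] (θ : (Σ i, Fin (ν i)) ≃ Fin n) (i : Fin k) :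
    MonoidAlgebra K (Equiv.Perm (Fin (ν i))) →ₐ[K] MonoidAlgebra K (Equiv.Perm (Fin n)) :=
  MonoidAlgebra.mapDomainAlgHom K K (blockHom θ i)

theorem blockAlgHom_single (K : Type*) [Field K] (θ : (Σ i, Fin (ν i)) ≃ Fin n) (i : Fin k)
    (g : Equiv.Perm (Fin (ν i))) (a : K) :
    blockAlgHom K θ i (MonoidAlgebra.single g a) = MonoidAlgebra.single (blockHom θ i g) a := by
  simp [blockAlgHom]

theorem blockYoungSymmetrizer_eq_blockAlgHom (K : Type) [Field K] (h : ∑ i, ν i = n) (i : Fin k)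
    (mu : Nat.Partition (ν i)) :
    blockYoungSymmetrizer K n (blockOffset ν i) (ν i) mu =
      blockAlgHom K (blockEquiv h) i (youngSym K mu) := by
  have hin : ∀ t : Fin (ν i), blockOffset ν i ≤ (blockEquiv h ⟨i, t⟩).val ∧
      (blockEquiv h ⟨i, t⟩).val < blockOffset ν i + ν i := by
    intro t
    rw [blockEquiv_val]
    have := t.2
    simp only
    omega
  have hout : ∀ j, ∀ t : Fin (ν j), j ≠ i → ¬ (blockOffset ν i ≤ (blockEquiv h ⟨j, t⟩).val ∧
      (blockEquiv h ⟨j, t⟩).val < blockOffset ν i + ν i) := by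
    intro j t hj hh
    have h3 : (blockEquiv h ⟨j, t⟩).val - blockOffset ν i < ν i := by omega
    have h4 : blockEquiv h ⟨j, t⟩ = blockEquiv h ⟨i, ⟨_, h3⟩⟩ := by
      refine Fin.ext ?_
      rw [blockEquiv_val h ⟨i, ⟨_, h3⟩⟩]
      simp only
      omega
    exact hj (congrArg Sigma.fst ((blockEquiv h).injective h4))
  have hsub : ∀ t : Fin (ν i), (blockEquiv h ⟨i, t⟩).val - blockOffset ν i = t := by
    intro t
    rw [blockEquiv_val]
    simp
  rw [blockYoungSymmetrizer_eq, youngSym, map_mul, rowSym, rowSym, colAnti, colAnti,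
    fiberPerms_block (blockEquiv h) i (g := rowFn mu), Finset.sum_map,
    fiberPerms_block (blockEquiv h) i (g := colFn mu), Finset.sum_map, map_sum, map_sum]
  · simp only [Function.Embedding.coeFn_mk, blockAlgHom_single, sign_blockHom]
  · intro t
    rw [shiftedColFn, if_pos (hin t), hsub, colFn]
  · intro j t hj
    rw [shiftedColFn, if_neg (hout j t hj)]
  · intro t
    rw [shiftedRowFn, if_pos (hin t), hsub, rowFn]
  · intro j t hj
    rw [shiftedRowFn, if_neg (hout j t hj)]

/-- The (ordered) product of elements of the group algebras of the blocks. -/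
noncomputable def blockProd (K : Type*) [Field K] (θ : (Σ i, Fin (ν i)) ≃ Fin n) :
    MultilinearMap K (fun i => MonoidAlgebra K (Equiv.Perm (Fin (ν i))))
      (MonoidAlgebra K (Equiv.Perm (Fin n))) :=
  (MultilinearMap.mkPiAlgebraFin K k _).compLinearMap fun i => (blockAlgHom K θ i).toLinearMap

theorem blockProd_apply (K : Type*) [Field K] (θ : (Σ i, Fin (ν i)) ≃ Fin n)
    (x : ∀ i, MonoidAlgebra K (Equiv.Perm (Fin (ν i)))) :
    blockProd K θ x = (List.ofFn fun i => blockAlgHom K θ i (x i)).prod := rfl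

theorem prod_ofFn_eq_of_forall_ne {M : Type*} [Monoid M] {k : ℕ} (f : Fin k → M) (j : Fin k)
    (h : ∀ i, i ≠ j → f i = 1) : (List.ofFn f).prod = f j := by
  induction k with
  | zero => exact j.elim0
  | succ k ih =>
    rw [List.ofFn_succ, List.prod_cons]
    induction j using Fin.cases with
    | zero =>
      rw [List.prod_eq_one, mul_one]
      intro x hx
      obtain ⟨i, rfl⟩ := List.mem_ofFn.1 hx
      exact h _ (Fin.succ_ne_zero i)
    | succ j =>
      rw [h 0 (Fin.succ_ne_zero j).symm, one_mul, ih _ j fun i hi => h _ (by simpa using hi)]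

theorem prod_ofFn_mulSingle {k : ℕ} {M : Fin k → Type*} [∀ i, Monoid (M i)] (g : ∀ i, M i) :
    (List.ofFn fun i => Pi.mulSingle i (g i)).prod = g := by
  funext j
  change Pi.evalMonoidHom M j (List.ofFn fun i => Pi.mulSingle i (g i)).prod = _
  rw [map_list_prod, List.map_ofFn, prod_ofFn_eq_of_forall_ne _ j]
  · simp
  · intro i hi
    simp [Pi.mulSingle_eq_of_ne hi.symm]

theorem blockProd_of (K : Type*) [Field K] (θ : (Σ i, Fin (ν i)) ≃ Fin n)
    (g : ∀ i, Equiv.Perm (Fin (ν i))) :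
    blockProd K θ (fun i => MonoidAlgebra.of K _ (g i)) = MonoidAlgebra.of K _ (youngHom θ g) := by
  rw [blockProd_apply]
  nth_rewrite 2 [← prod_ofFn_mulSingle g]
  rw [map_list_prod, map_list_prod, List.map_ofFn, List.map_ofFn]
  simp only [MonoidAlgebra.of_apply, blockAlgHom_single]
  rfl

theorem blockProd_ext {K : Type*} [Field K] {M : Type*} [AddCommGroup M] [Module K M]
    {φ ψ : MultilinearMap K (fun i => MonoidAlgebra K (Equiv.Perm (Fin (ν i)))) M}
    (h : ∀ g : ∀ i, Equiv.Perm (Fin (ν i)), φ (fun i => MonoidAlgebra.of K _ (g i)) =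
      ψ (fun i => MonoidAlgebra.of K _ (g i))) : φ = ψ := by
  refine Module.Basis.ext_multilinear (fun i => MonoidAlgebra.basis _ K) fun g => ?_
  simpa [MonoidAlgebra.basis_apply] using h g

theorem blockProd_mul (K : Type*) [Field K] (θ : (Σ i, Fin (ν i)) ≃ Fin n)
    (x y : ∀ i, MonoidAlgebra K (Equiv.Perm (Fin (ν i)))) :
    blockProd K θ x * blockProd K θ y = blockProd K θ (x * y) := by
  have h1 : ∀ g : ∀ i, Equiv.Perm (Fin (ν i)),
      (LinearMap.mulLeft K (blockProd K θ fun i => MonoidAlgebra.of K _ (g i))).compMultilinearMap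
        (blockProd K θ) = (blockProd K θ).compLinearMap fun i =>
          LinearMap.mulLeft K (MonoidAlgebra.of K _ (g i)) := by
    intro g
    refine blockProd_ext fun g' => ?_
    simp only [LinearMap.compMultilinearMap_apply, LinearMap.mulLeft_apply,
      MultilinearMap.compLinearMap_apply, ← map_mul]
    rw [blockProd_of, blockProd_of, ← map_mul, ← map_mul]
    exact (blockProd_of K θ (g * g')).symm
  have h2 : (LinearMap.mulRight K (blockProd K θ y)).compMultilinearMap
        (blockProd K θ) = (blockProd K θ).compLinearMap fun i => LinearMap.mulRight K (y i) :=
    blockProd_ext fun g => congrArg (fun φ => φ y) (h1 g)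
  exact congrArg (fun φ => φ x) h2

theorem blockProd_mem_groupSpan (K : Type*) [Field K] (θ : (Σ i, Fin (ν i)) ≃ Fin n)
    (x : ∀ i, MonoidAlgebra K (Equiv.Perm (Fin (ν i)))) :
    blockProd K θ x ∈ groupSpan K (youngHom θ) := by
  have h : (groupSpan K (youngHom θ)).mkQ.compMultilinearMap (blockProd K θ) = 0 := by
    refine blockProd_ext fun g => ?_
    rw [LinearMap.compMultilinearMap_apply, blockProd_of, zero_apply,
      Submodule.mkQ_apply, Submodule.Quotient.mk_eq_zero]
    exact Submodule.subset_span ⟨g, rfl⟩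
  have h2 := congrArg (fun φ => φ x) h
  rwa [zero_apply, LinearMap.compMultilinearMap_apply,
      Submodule.mkQ_apply, Submodule.Quotient.mk_eq_zero] at h2

theorem multilinear_mem_of_mem_span {K ι : Type*} [Field K] [Finite ι] {E : ι → Type*}
    [∀ i, AddCommGroup (E i)] [∀ i, Module K (E i)] {M : Type*} [AddCommGroup M] [Module K M]
    (φ : MultilinearMap K E M) {S : ∀ i, Set (E i)} {N : Submodule K M}
    (h : ∀ s : ∀ i, E i, (∀ i, s i ∈ S i) → φ s ∈ N) {x : ∀ i, E i}
    (hx : ∀ i, x i ∈ Submodule.span K (S i)) : φ x ∈ N := by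
  classical
  have := Fintype.ofFinite ι
  choose m c v hv using fun i => Submodule.mem_span_set'.1 (hx i)
  rw [← funext hv, φ.map_sum]
  refine sum_mem fun r _ => ?_
  rw [φ.map_smul_univ]
  exact N.smul_mem _ (h _ fun i => (v i (r i)).2)

theorem blockProd_system (K : Type*) [Field K] [CharZero K] (θ : (Σ i, Fin (ν i)) ≃ Fin n) :
    SymmetrizerSystem (youngHom θ)
      (fun lams : ∀ i, Nat.Partition (ν i) => blockProd K θ fun i => youngSym K (lams i)) where
  sandwich lams g := by
    choose s hs using fun i => (youngSym_system K (ν i)).1.sandwich (lams i) (g i)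
    refine ⟨∏ i, s i, ?_⟩
    rw [← blockProd_of, blockProd_mul, blockProd_mul, ← MultilinearMap.map_smul_univ]
    exact congrArg _ (funext hs)
  ortho lams mus g h := by
    obtain ⟨i, hi⟩ := Function.ne_iff.1 h
    rw [← blockProd_of, blockProd_mul, blockProd_mul]
    exact MultilinearMap.map_coord_zero _ i ((youngSym_system K (ν i)).1.ortho _ _ (g i) hi)
  idem lams := by
    choose c hc h using fun i => (youngSym_system K (ν i)).1.idem (lams i)
    refine ⟨∏ i, c i, Finset.prod_ne_zero_iff.2 fun i _ => hc i, ?_⟩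
    rw [blockProd_mul, ← MultilinearMap.map_smul_univ]
    exact congrArg _ (funext h)
  mem lams := blockProd_mem_groupSpan K θ _
  complete := by
    have h1 : (1 : MonoidAlgebra K (Equiv.Perm (Fin n))) = blockProd K θ fun i => 1 := by
      have := blockProd_of K θ 1
      simpa [MonoidAlgebra.one_def] using this.symm
    rw [h1]
    refine multilinear_mem_of_mem_span _ ?_ fun i => (youngSym_system K (ν i)).1.complete
    intro s hs
    choose lams h h' hs using hs
    refine Submodule.subset_span ⟨lams, h, h', ?_⟩
    rw [← blockProd_of, ← blockProd_of, blockProd_mul, blockProd_mul]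
    exact congrArg _ (funext hs)

end Blocks

section RepHom

variable {K : Type} [Field K] {G : Type} [Group G]

/-- The representation attached to a left ideal of the group algebra. -/
noncomputable abbrev idealRep (I : Submodule (MonoidAlgebra K G) (MonoidAlgebra K G)) : Rep K G :=
  Rep.equivalenceModuleMonoidAlgebra.inverse.obj (ModuleCat.of (MonoidAlgebra K G) I)

theorem idealRep_hom (I J : Submodule (MonoidAlgebra K G) (MonoidAlgebra K G))
    (φ : idealRep I ⟶ idealRep J) : ∃ f : I →ₗ[MonoidAlgebra K G] J, ∀ x : I,
      (show J from φ.hom (show (idealRep I).V from x)) = f x := by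
  obtain ⟨f, hf⟩ := Rep.equivalenceModuleMonoidAlgebra.inverse.map_surjective φ
  refine ⟨f.hom, fun x => ?_⟩
  rw [← hf]
  rfl

/-- Evaluation of a morphism at an element of the ideal. -/
noncomputable def idealRepEval (I J : Submodule (MonoidAlgebra K G) (MonoidAlgebra K G)) (x : I) :
    (idealRep I ⟶ idealRep J) →ₗ[K] MonoidAlgebra K G where
  toFun φ := (show J from φ.hom (show (idealRep I).V from x)).1
  map_add' φ ψ := rfl
  map_smul' c φ := by
    change algebraMap K (MonoidAlgebra K G) c * _ = _
    rw [← Algebra.smul_def]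
    rfl

theorem finrank_idealRep_hom (x y : MonoidAlgebra K G) (c : K) (hc : c ≠ 0) (hx : x * x = c • x) :
    Module.finrank K (idealRep (Submodule.span (MonoidAlgebra K G) {x}) ⟶
      idealRep (Submodule.span (MonoidAlgebra K G) {y})) =
    Module.finrank K (corner (K := K) x y) := by
  set I := Submodule.span (MonoidAlgebra K G) {x} with hI
  set J := Submodule.span (MonoidAlgebra K G) {y} with hJ
  have hxI : x ∈ I := Submodule.mem_span_singleton_self x
  have hinj : Function.Injective (idealRepEval I J ⟨x, hxI⟩) := by
    intro φ ψ h
    obtain ⟨f, hf⟩ := idealRep_hom I J φ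
    obtain ⟨g, hg⟩ := idealRep_hom I J ψ
    have h1 : f ⟨x, hxI⟩ = g ⟨x, hxI⟩ := by
      rw [← hf, ← hg]
      exact Subtype.ext h
    refine Rep.hom_ext (DFunLike.ext _ _ fun u => ?_)
    obtain ⟨a, ha⟩ := Submodule.mem_span_singleton.1 (show I from u).2
    have h2 : (show I from u) = a • ⟨x, hxI⟩ := Subtype.ext ha.symm
    refine (hf u).trans (Eq.trans ?_ (hg u).symm)
    rw [h2, map_smul, map_smul, h1]
  have hrange : LinearMap.range (idealRepEval I J ⟨x, hxI⟩) = corner (K := K) x y := by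
    ext u
    rw [LinearMap.mem_range, mem_corner]
    constructor
    · rintro ⟨φ, rfl⟩
      obtain ⟨f, hf⟩ := idealRep_hom I J φ
      have h1 : idealRepEval I J ⟨x, hxI⟩ φ = (f ⟨x, hxI⟩).1 := congrArg Subtype.val (hf _)
      obtain ⟨a, ha⟩ := Submodule.mem_span_singleton.1 (f ⟨x, hxI⟩).2
      have h2 : x • (⟨x, hxI⟩ : I) = algebraMap K (MonoidAlgebra K G) c • ⟨x, hxI⟩ := by
        refine Subtype.ext ?_
        simp only [Submodule.coe_smul, smul_eq_mul, hx, Algebra.smul_def]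
      have h3 := congrArg (fun v => (f v).1) h2
      simp only [map_smul, Submodule.coe_smul, smul_eq_mul, ← Algebra.smul_def] at h3
      refine ⟨c⁻¹ • a, ?_⟩
      rw [h1, ← inv_smul_smul₀ hc (f ⟨x, hxI⟩).1, ← h3, ← ha, smul_eq_mul, smul_mul_assoc,
        mul_smul_comm]
    · rintro ⟨a, rfl⟩
      let f : I →ₗ[MonoidAlgebra K G] J :=
        { toFun := fun u => ⟨u.1 * (a * y), by
            rw [← mul_assoc]
            exact Submodule.mem_span_singleton.2 ⟨_, rfl⟩⟩
          map_add' := fun u v => Subtype.ext (add_mul _ _ _)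
          map_smul' := fun b u => Subtype.ext (mul_assoc _ _ _) }
      exact ⟨Rep.equivalenceModuleMonoidAlgebra.inverse.map (ModuleCat.ofHom f), rfl⟩
  rw [← hrange]
  exact (LinearEquiv.ofInjective _ hinj).finrank_eq

end RepHom

theorem iteratedLR_eq (K : Type) [Field K] [CharZero K] {n k : ℕ} {ν : Fin k → ℕ}
    (h : ∑ i, ν i = n) (lams : ∀ i, Nat.Partition (ν i)) (lam : Nat.Partition n) :
    iteratedLR K n ν lams lam = Module.finrank K (corner (K := K)
      (blockProd K (blockEquiv h) fun i => youngSym K (lams i)) (youngSym K lam)) := by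
  obtain ⟨c, hc, h1⟩ := (blockProd_system K (blockEquiv h)).idem lams
  have h2 : (List.ofFn fun i => blockYoungSymmetrizer K n (blockOffset ν i) (ν i) (lams i)).prod =
      blockProd K (blockEquiv h) fun i => youngSym K (lams i) := by
    rw [blockProd_apply]
    exact congrArg (fun f => (List.ofFn f).prod)
      (funext fun i => blockYoungSymmetrizer_eq_blockAlgHom K h i (lams i))
  rw [← finrank_idealRep_hom _ _ c hc h1, ← h2, ← blockYoungSymmetrizer_zero]
  rfl

section Polarization

variable {K : Type*} [Field K] {T : Type*} [Fintype T] [DecidableEq T] {M N : Type*}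
  [AddCommGroup M] [Module K M] [AddCommGroup N] [Module K N]

/-- Polarization: the symmetrization of a multilinear map vanishing on the diagonal is zero. -/
theorem sum_perm_eq_zero_of_diagonal (m : MultilinearMap K (fun _ : T => M) N)
    (h : ∀ u, m (fun _ => u) = 0) (x : T → M) : ∑ σ : Equiv.Perm T, m (fun t => x (σ t)) = 0 := by
  let g : Finset T → N := fun S => ∑ f : T → T with Finset.univ.image f = S, m (fun t => x (f t))
  have h1 : ∀ S : Finset T, ∑ S' ∈ S.powerset, g S' = 0 := by
    intro S
    rw [← h (∑ i ∈ S, x i), m.map_sum_finset (fun _ i => x i) fun _ => S,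
      ← Finset.sum_fiberwise_of_maps_to (t := S.powerset) (g := fun f => Finset.univ.image f)]
    · refine Finset.sum_congr rfl fun S' hS' => Finset.sum_congr ?_ fun _ _ => rfl
      ext f
      simp only [Finset.mem_filter, Finset.mem_univ, true_and, Fintype.mem_piFinset]
      refine ⟨fun hf => ⟨fun t => ?_, hf⟩, fun hf => hf.2⟩
      exact Finset.mem_powerset.1 hS' (hf ▸ Finset.mem_image_of_mem f (Finset.mem_univ t))
    · intro f hf
      rw [Finset.mem_powerset, Finset.image_subset_iff]
      exact fun t _ => Fintype.mem_piFinset.1 hf t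
  have h2 : ∀ S, g S = 0 := by
    intro S
    induction S using Finset.strongInduction with
    | H S ih =>
      have := h1 S
      rw [← Finset.add_sum_erase _ _ (Finset.mem_powerset_self S), Finset.sum_eq_zero, add_zero]
        at this
      · exact this
      · intro S' hS'
        rw [Finset.mem_erase, Finset.mem_powerset] at hS'
        exact ih S' (hS'.2.ssubset_of_ne hS'.1)
  rw [← h2 Finset.univ]
  refine Finset.sum_bij (fun σ _ => σ) ?_ ?_ ?_ ?_
  · intro σ _
    simp
  · intro σ _ τ _ hστ
    exact DFunLike.coe_injective hστ
  · intro f hf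
    have hs : Function.Surjective f := by
      intro t
      have : t ∈ Finset.univ.image f := by
        rw [(Finset.mem_filter.1 hf).2]
        exact Finset.mem_univ t
      simpa using this
    exact ⟨Equiv.ofBijective f (Finite.surjective_iff_bijective.1 hs), Finset.mem_univ _, rfl⟩
  · intro σ _
    rfl

end Polarization

section DoubleCommutant

variable {K : Type*} [Field K] {N : Type*} [Fintype N] [DecidableEq N]

theorem mem_span_of_commute_centralizer [CharZero K] {G : Type*} [Group G] [Finite G]
    (R : G →* Matrix N N K) {X : Matrix N N K}
    (hX : ∀ B : Matrix N N K, (∀ g, R g * B = B * R g) → X * B = B * X) :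
    X ∈ Submodule.span K (Set.range R) := by
  have := Fintype.ofFinite G
  set S := Submodule.span K (Set.range R) with hS
  obtain ⟨π, hπ⟩ := S.subtype.exists_leftInverse_of_injective (Submodule.ker_subtype S)
  let Q : Matrix N N K →ₗ[K] Matrix N N K :=
    ∑ g, LinearMap.mulLeft K (R g⁻¹) ∘ₗ S.subtype ∘ₗ π ∘ₗ LinearMap.mulLeft K (R g)
  have hQ : ∀ Y, Q Y = ∑ g, R g⁻¹ * (π (R g * Y) : Matrix N N K) := by
    intro Y
    simp [Q]
  have hSl : ∀ g Y, Y ∈ S → R g * Y ∈ S := by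
    intro g Y hY
    induction hY using Submodule.span_induction with
    | mem Y h =>
      obtain ⟨g', rfl⟩ := h
      rw [← map_mul]
      exact Submodule.subset_span ⟨_, rfl⟩
    | zero => simp
    | add Y Z _ _ hY hZ => rw [mul_add]; exact S.add_mem hY hZ
    | smul c Y _ hY => rw [mul_smul_comm]; exact S.smul_mem c hY
  have hQS : ∀ Y, Q Y ∈ S := fun Y => by
    rw [hQ]
    exact sum_mem fun g _ => hSl _ _ (π _).2
  have hQ1 : Q 1 = (Fintype.card G : K) • 1 := by
    have : ∀ g, R g⁻¹ * (π (R g * 1) : Matrix N N K) = 1 := by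
      intro g
      have h1 : π (R g) = ⟨R g, Submodule.subset_span ⟨g, rfl⟩⟩ :=
        LinearMap.congr_fun hπ ⟨R g, Submodule.subset_span ⟨g, rfl⟩⟩
      rw [mul_one, h1, ← map_mul, inv_mul_cancel, map_one]
    rw [hQ, Finset.sum_congr rfl fun g _ => this g, Finset.sum_const, Finset.card_univ,
      Nat.cast_smul_eq_nsmul]
  have hQe : ∀ g Y, Q (R g * Y) = R g * Q Y := by
    intro g Y
    rw [hQ, hQ, Finset.mul_sum]
    refine Fintype.sum_equiv (Equiv.mulRight g) _ _ fun g' => ?_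
    simp only [Equiv.coe_mulRight, mul_inv_rev, map_mul, ← mul_assoc]
    rw [← map_mul R g g⁻¹, mul_inv_cancel, map_one, one_mul]
  let B : N → N → Matrix N N K := fun J J' =>
    Matrix.of fun I I' => Q (Matrix.single I' J' 1) I J
  have hl : ∀ (Y : Matrix N N K) J J' I I',
      (Y * B J J') I I' = (Y * Q (Matrix.single I' J' 1)) I J := by
    intro Y J J' I I'
    simp [Matrix.mul_apply, B]
  have hr : ∀ (Y : Matrix N N K) J J' I I',
      (B J J' * Y) I I' = Q (Y * Matrix.single I' J' 1) I J := by
    intro Y J J' I I'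
    have : Y * Matrix.single I' J' 1 = ∑ L, Y L I' • Matrix.single L J' (1 : K) := by
      ext a b
      simp only [Matrix.mul_apply, Matrix.sum_apply, Matrix.smul_apply, Matrix.single_apply,
        smul_eq_mul]
      by_cases hb : J' = b <;> simp [hb]
    rw [this, map_sum, Matrix.sum_apply, Matrix.mul_apply]
    refine Finset.sum_congr rfl fun L _ => ?_
    rw [map_smul, Matrix.smul_apply, smul_eq_mul, mul_comm]
    rfl
  have hB : ∀ J J', X * B J J' = B J J' * X := by
    intro J J'
    refine hX _ fun g => ?_
    ext I I'
    rw [hl, hr, hQe]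
  have hXs : ∀ I' J', Q (X * Matrix.single I' J' 1) = X * Q (Matrix.single I' J' 1) := by
    intro I' J'
    ext I J
    rw [← hl, ← hr, hB]
  have h1 : Q X = X * Q 1 := by
    have hone : (1 : Matrix N N K) = ∑ I, Matrix.single I I 1 := by
      ext a b
      rw [Matrix.sum_apply, Matrix.one_apply, Finset.sum_eq_single a]
      · simp [Matrix.single_apply]
      · intro I _ hI
        simp [hI]
      · simp
    nth_rewrite 1 [← mul_one X]
    rw [hone, Finset.mul_sum, map_sum, map_sum, Finset.mul_sum]
    exact Finset.sum_congr rfl fun I _ => hXs I I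
  have hc : (Fintype.card G : K) ≠ 0 := Nat.cast_ne_zero.2 Fintype.card_ne_zero
  rw [hQ1, mul_smul_comm, mul_one] at h1
  rw [← inv_smul_smul₀ hc X, ← h1]
  exact S.smul_mem _ (hQS X)

end DoubleCommutant

section TensorPower

variable (K : Type*) [Field K] {T ι : Type*} [Fintype T] [DecidableEq T] [Fintype ι]
  [DecidableEq ι]

/-- The Kronecker product of a family of matrices. -/
noncomputable def tensorPow :
    MultilinearMap K (fun _ : T => Matrix ι ι K) (Matrix (T → ι) (T → ι) K) :=
  (Matrix.ofLinearEquiv K).toLinearMap.compMultilinearMap <|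
    MultilinearMap.pi fun I => MultilinearMap.pi fun J =>
      (MultilinearMap.mkPiAlgebra K T K).compLinearMap fun t =>
        Matrix.entryLinearMap K K (I t) (J t)

variable {K}

omit [DecidableEq T] [Fintype ι] [DecidableEq ι] in
theorem tensorPow_apply (x : T → Matrix ι ι K) (I J : T → ι) :
    tensorPow K x I J = ∏ t, x t (I t) (J t) := by
  simp [tensorPow]

omit [DecidableEq ι] in
theorem tensorPow_mul (x y : T → Matrix ι ι K) :
    tensorPow K x * tensorPow K y = tensorPow K fun t => x t * y t := by
  ext I J
  simp only [Matrix.mul_apply, tensorPow_apply, Finset.prod_univ_sum, Fintype.piFinset_univ,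
    Finset.prod_mul_distrib]

omit [DecidableEq T] [Fintype ι] in
theorem tensorPow_single (I J : T → ι) :
    tensorPow K (fun t => Matrix.single (I t) (J t) (1 : K)) = Matrix.single I J 1 := by
  ext I' J'
  rw [tensorPow_apply, Matrix.single_apply]
  simp only [Matrix.single_apply]
  split_ifs with h
  · simp [h.1, h.2]
  · rw [not_and_or, ← ne_eq, ← ne_eq, Function.ne_iff, Function.ne_iff] at h
    rcases h with ⟨t, ht⟩ | ⟨t, ht⟩ <;>
    exact Finset.prod_eq_zero (Finset.mem_univ t) (by simp [ht])

theorem matrix_eq_sum_single_one {N : Type*} [Fintype N] [DecidableEq N] (X : Matrix N N K) :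
    X = ∑ I, ∑ J, X I J • Matrix.single I J (1 : K) := by
  nth_rewrite 1 [Matrix.matrix_eq_sum_single X]
  simp

theorem eq_zero_of_forall_tensorPow {M : Type*} [AddCommGroup M] [Module K M]
    (φ : Matrix (T → ι) (T → ι) K →ₗ[K] M) (h : ∀ x : T → Matrix ι ι K, φ (tensorPow K x) = 0) :
    φ = 0 := by
  ext X
  rw [matrix_eq_sum_single_one X]
  simp [← tensorPow_single, h]

variable (K T ι) in
/-- The action of the symmetric group on tensors by permutation of the factors. -/
def permMat : Equiv.Perm T →* Matrix (T → ι) (T → ι) K where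
  toFun σ := Matrix.of fun I J => if I ∘ σ = J then 1 else 0
  map_one' := by
    ext I J
    simp [Matrix.one_apply]
  map_mul' σ τ := by
    ext I J
    simp only [Matrix.mul_apply, Matrix.of_apply, ite_mul, one_mul, zero_mul, Finset.sum_ite_eq,
      Finset.mem_univ, if_true]
    rfl

theorem permMat_apply (σ : Equiv.Perm T) (I J : T → ι) :
    permMat K T ι σ I J = if I ∘ σ = J then 1 else 0 := rfl

theorem permMat_mul_apply (σ : Equiv.Perm T) (X : Matrix (T → ι) (T → ι) K) (I J : T → ι) :
    (permMat K T ι σ * X) I J = X (I ∘ σ) J := by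
  simp [Matrix.mul_apply, permMat_apply]

theorem mul_permMat_apply (σ : Equiv.Perm T) (X : Matrix (T → ι) (T → ι) K) (I J : T → ι) :
    (X * permMat K T ι σ) I J = X I (J ∘ σ.symm) := by
  have : ∀ L : T → ι, L ∘ σ = J ↔ L = J ∘ σ.symm := fun L => (Equiv.eq_comp_symm _ _ _).symm
  simp [Matrix.mul_apply, permMat_apply, this]

theorem permMat_mul_tensorPow (σ : Equiv.Perm T) (x : T → Matrix ι ι K) :
    permMat K T ι σ * tensorPow K x = tensorPow K (fun t => x (σ.symm t)) * permMat K T ι σ := by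
  ext I J
  rw [permMat_mul_apply, mul_permMat_apply, tensorPow_apply, tensorPow_apply]
  exact Fintype.prod_equiv σ _ _ fun t => by simp

theorem commute_tensorPow_of_units [Infinite K] {X : Matrix (T → ι) (T → ι) K}
    (h : ∀ g : (Matrix ι ι K)ˣ, X * tensorPow K (fun _ => g.1) = tensorPow K (fun _ => g.1) * X)
    (x : Matrix ι ι K) : X * tensorPow K (fun _ => x) = tensorPow K (fun _ => x) * X := by
  ext I J
  let Y : Matrix ι ι (Polynomial K) := (-x).charmatrix
  let p : Polynomial K := ∑ L, Polynomial.C (X I L) * ∏ t, Y (L t) (J t) -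
    ∑ L, (∏ t, Y (I t) (L t)) * Polynomial.C (X L J)
  have hY : ∀ s : K, (Polynomial.evalRingHom s).mapMatrix Y = Matrix.scalar ι s + x := by
    intro s
    ext a b
    by_cases hab : a = b
    · subst hab
      simp [Y]
    · simp [Y, hab]
  have hYe : ∀ s a b, (Y a b).eval s = (Matrix.scalar ι s + x) a b := fun s a b => by
    rw [← hY]
    rfl
  have hp : ∀ s : K, p.eval s = (X * tensorPow K (fun _ : T => Matrix.scalar ι s + x)) I J -
      (tensorPow K (fun _ : T => Matrix.scalar ι s + x) * X) I J := by
    intro s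
    simp only [p, Polynomial.eval_sub, Polynomial.eval_finsetSum, Polynomial.eval_mul,
      Polynomial.eval_C, Polynomial.eval_prod, hYe, Matrix.mul_apply, tensorPow_apply]
  have hdet : Y.det ≠ 0 := (Matrix.charpoly_monic (-x)).ne_zero
  have hmul : p * Y.det = 0 := by
    refine Polynomial.funext fun s => ?_
    rw [Polynomial.eval_mul, Polynomial.eval_zero]
    by_cases hs : Polynomial.eval s Y.det = 0
    · rw [hs, mul_zero]
    · have h1 : Polynomial.eval s Y.det = (Matrix.scalar ι s + x).det := by
        rw [← hY, ← RingHom.map_det]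
        rfl
      rw [h1] at hs
      have h2 := h (Matrix.GeneralLinearGroup.mkOfDetNeZero _ hs)
      have h3 : (Matrix.GeneralLinearGroup.mkOfDetNeZero _ hs).1 = Matrix.scalar ι s + x := rfl
      rw [h3] at h2
      rw [hp, h2, sub_self, zero_mul]
  have h0 : p = 0 := (mul_eq_zero.1 hmul).resolve_right hdet
  have := hp 0
  rw [h0, Polynomial.eval_zero, map_zero, zero_add] at this
  exact sub_eq_zero.1 this.symm

theorem mem_span_permMat [CharZero K] {X : Matrix (T → ι) (T → ι) K}
    (h : ∀ g : (Matrix ι ι K)ˣ, X * tensorPow K (fun _ => g.1) = tensorPow K (fun _ => g.1) * X) :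
    X ∈ Submodule.span K (Set.range (permMat K T ι)) := by
  refine mem_span_of_commute_centralizer _ fun B hB => ?_
  let C : Matrix (T → ι) (T → ι) K →ₗ[K] Matrix (T → ι) (T → ι) K :=
    LinearMap.mulLeft K X - LinearMap.mulRight K X
  have hC : ∀ Y, C Y = X * Y - Y * X := fun Y => rfl
  have h1 := sum_perm_eq_zero_of_diagonal (C.compMultilinearMap (tensorPow K)) fun u => by
    rw [LinearMap.compMultilinearMap_apply, hC, commute_tensorPow_of_units h, sub_self]
  let D : Matrix (T → ι) (T → ι) K →ₗ[K] Matrix (T → ι) (T → ι) K :=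
    ∑ σ : Equiv.Perm T, LinearMap.mulLeft K (permMat K T ι σ⁻¹) ∘ₗ
      LinearMap.mulRight K (permMat K T ι σ)
  have hD : ∀ Y, D Y = ∑ σ : Equiv.Perm T, permMat K T ι σ⁻¹ * (Y * permMat K T ι σ) := by
    intro Y
    simp [D]
  have h2 : C ∘ₗ D = 0 := by
    refine eq_zero_of_forall_tensorPow _ fun x => ?_
    rw [LinearMap.comp_apply, hD, ← h1 x, map_sum]
    refine Finset.sum_congr rfl fun σ _ => ?_
    rw [LinearMap.compMultilinearMap_apply, ← mul_assoc, permMat_mul_tensorPow, mul_assoc,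
      ← map_mul, inv_mul_cancel, map_one, mul_one]
    rfl
  have h3 := LinearMap.congr_fun h2 B
  have h4 : D B = (Fintype.card (Equiv.Perm T) : K) • B := by
    rw [hD, Nat.cast_smul_eq_nsmul, ← Finset.card_univ, ← Finset.sum_const]
    refine Finset.sum_congr rfl fun σ _ => ?_
    rw [← hB, ← mul_assoc, ← map_mul, inv_mul_cancel, map_one, one_mul]
  rw [LinearMap.comp_apply, h4, map_smul, LinearMap.zero_apply, smul_eq_zero_iff_right
    (Nat.cast_ne_zero.2 Fintype.card_ne_zero), hC] at h3
  exact sub_eq_zero.1 h3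

end TensorPower

section SchurWeyl

variable (K : Type*) [Field K] (n : ℕ) (ι : Type*) [Fintype ι] [DecidableEq ι]

/-- The action of the group algebra of the symmetric group on tensors. -/
noncomputable def permRep : MonoidAlgebra K (Equiv.Perm (Fin n)) →ₐ[K]
    Matrix (Fin n → ι) (Fin n → ι) K :=
  MonoidAlgebra.lift K _ _ (permMat K (Fin n) ι)

variable {K n ι}

theorem permRep_of (σ : Equiv.Perm (Fin n)) :
    permRep K n ι (MonoidAlgebra.of K _ σ) = permMat K (Fin n) ι σ := by
  simp [permRep]

theorem exists_permRep_of_mem_span {X : Matrix (Fin n → ι) (Fin n → ι) K}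
    (h : X ∈ Submodule.span K (Set.range (permMat K (Fin n) ι))) : ∃ a, permRep K n ι a = X := by
  have : Submodule.span K (Set.range (permMat K (Fin n) ι)) ≤
      LinearMap.range (permRep K n ι).toLinearMap := by
    rw [Submodule.span_le]
    rintro _ ⟨σ, rfl⟩
    exact ⟨_, permRep_of σ⟩
  exact this h

theorem permRep_youngSym_eq_zero [CharZero K] {lam : Nat.Partition n}
    (h : Fintype.card ι < lam.parts.card) : permRep K n ι (youngSym K lam) = 0 := by
  have hcol : permRep K n ι (colAnti K (colFn lam)) = 0 := by
    ext I J
    have hc : (Finset.univ.filter fun t => colFn lam t = 0).card = lam.parts.card := by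
      rw [card_colFn, Multiset.countP_eq_card]
      exact fun a ha => lam.parts_pos ha
    obtain ⟨s, hs, t, ht, hst, hJ⟩ := Finset.exists_ne_map_eq_of_card_lt_of_maps_to
      (s := Finset.univ.filter fun t => colFn lam t = 0) (t := (Finset.univ : Finset ι)) (f := J)
      (by rwa [hc, Finset.card_univ]) fun _ _ => Finset.mem_univ _
    have h1 := congrArg (fun a => permRep K n ι a I J) (colAnti_mul_of (K := K)
      (swap_mem_fiberPerms (r := colFn lam) (s := s) (t := t)
        ((Finset.mem_filter.1 hs).2.trans (Finset.mem_filter.1 ht).2.symm)))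
    have h2 : J ∘ (Equiv.swap s t).symm = J := by
      funext u
      simp only [Function.comp_apply, Equiv.symm_swap, Equiv.swap_apply_def]
      split_ifs with h3 h4
      · rw [h3, hJ]
      · rw [h4, hJ]
      · rfl
    simp only [map_mul, permRep_of, mul_permMat_apply, h2] at h1
    refine eq_zero_of_eq_neg (K := K) (h1.trans ?_)
    simp [Equiv.Perm.sign_swap hst]
  rw [youngSym, map_mul, hcol, mul_zero]

theorem permRep_youngSym_ne_zero [CharZero K] {lam : Nat.Partition n}
    (h : lam.parts.card ≤ Fintype.card ι) : permRep K n ι (youngSym K lam) ≠ 0 := by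
  have htab := isTableau lam
  have hrow : ∀ t, rowFn lam t < Fintype.card ι := by
    intro t
    refine lt_of_lt_of_le ?_ h
    have h1 := htab.lt t
    rw [← partsList_coe, Multiset.coe_card]
    by_contra h2
    rw [List.getD_eq_default _ _ (not_lt.1 h2)] at h1
    exact Nat.not_lt_zero _ h1
  let J : Fin n → ι := fun t => (Fintype.equivFin ι).symm ⟨rowFn lam t, hrow t⟩
  have hJ : ∀ s t, J s = J t ↔ rowFn lam s = rowFn lam t := by
    intro s t
    simp [J]
  have hJs : ∀ σ : Equiv.Perm (Fin n), J ∘ σ = J ↔ σ ∈ fiberPerms (rowFn lam) := by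
    intro σ
    rw [mem_fiberPerms, funext_iff]
    exact forall_congr' fun t => hJ _ _
  intro h0
  have h1 := congrFun (congrFun h0 J) J
  have hr : ∀ X : Matrix (Fin n → ι) (Fin n → ι) K, (permRep K n ι (rowSym K (rowFn lam)) * X) J J =
      (fiberPerms (rowFn lam)).card • X J J := by
    intro X
    rw [rowSym, map_sum, Finset.sum_mul, Matrix.sum_apply, ← Finset.sum_const]
    refine Finset.sum_congr rfl fun σ hσ => ?_
    have h2 : MonoidAlgebra.single σ (1 : K) = MonoidAlgebra.of K _ σ := rfl
    rw [h2, permRep_of, permMat_mul_apply, (hJs σ).2 hσ]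
  rw [youngSym, map_mul, hr, colAnti, map_sum, Matrix.sum_apply, Finset.sum_eq_single 1] at h1
  · have h2 : MonoidAlgebra.single (1 : Equiv.Perm (Fin n)) ((Equiv.Perm.sign
        (1 : Equiv.Perm (Fin n)) : ℤ) : K) = 1 := by simp [MonoidAlgebra.one_def]
    rw [h2, map_one, Matrix.one_apply_eq, Matrix.zero_apply, nsmul_one, Nat.cast_eq_zero,
      Finset.card_eq_zero] at h1
    have : (1 : Equiv.Perm (Fin n)) ∈ fiberPerms (rowFn lam) := mem_fiberPerms.2 fun _ => rfl
    rw [h1] at this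
    exact absurd this (Finset.notMem_empty _)
  · intro σ hσ hne
    have h2 : ∀ a : K, MonoidAlgebra.single σ a = a • MonoidAlgebra.of K _ σ := by simp
    rw [h2, map_smul, permRep_of, Matrix.smul_apply, permMat_apply, if_neg, smul_zero]
    intro hσJ
    rw [hJs, mem_fiberPerms] at hσJ
    rw [mem_fiberPerms] at hσ
    exact hne (Equiv.ext fun t => htab.inj _ _ (hσJ t) (hσ t))
  · intro hne
    exact absurd (mem_fiberPerms.2 fun _ => rfl) hne

theorem permRep_central_projection [CharZero K] {z : MonoidAlgebra K (Equiv.Perm (Fin n))}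
    (hzc : ∀ x, Commute z x)
    (hz1 : ∀ l : Nat.Partition n, l.parts.card ≤ Fintype.card ι → z * youngSym K l = youngSym K l) :
    permRep K n ι z = 1 := by
  have h := (youngSym_system K n).1.map_one_eq_zero
    ((permRep K n ι).toLinearMap ∘ₗ LinearMap.mulLeft K (1 - z)) fun l g g' => by
      by_cases hl : l.parts.card ≤ Fintype.card ι
      · rw [LinearMap.comp_apply, LinearMap.mulLeft_apply, sub_mul, one_mul, mul_assoc,
          ← mul_assoc z, (hzc _).eq, mul_assoc, ← mul_assoc z, hz1 l hl, sub_self, map_zero]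
      · simp [permRep_youngSym_eq_zero (not_le.1 hl)]
  simp only [LinearMap.comp_apply, LinearMap.mulLeft_apply, mul_one, AlgHom.toLinearMap_apply,
    map_sub, map_one] at h
  exact (sub_eq_zero.1 h).symm

theorem eq_zero_of_permRep_eq_zero [CharZero K] {z a : MonoidAlgebra K (Equiv.Perm (Fin n))}
    (hzc : ∀ x, Commute z x)
    (hz0 : ∀ l : Nat.Partition n, ¬ l.parts.card ≤ Fintype.card ι → z * youngSym K l = 0)
    (hza : z * a = a) (ha : permRep K n ι a = 0) : a = 0 := by
  have he := (youngSym_system K n).1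
  refine he.eq_zero_of_forall_mul fun l x => ?_
  by_cases hl : l.parts.card ≤ Fintype.card ι
  · refine he.eq_zero_of_forall_mul_left fun m y => ?_
    by_cases hm : m = l
    · subst hm
      obtain ⟨s, hs⟩ := he.sandwich_of_id m (y * (a * x))
      have h1 : youngSym K m * y * (a * (x * youngSym K m)) = s • youngSym K m := by
        rw [← hs]
        simp only [mul_assoc]
      have h2 := congrArg (permRep K n ι) h1
      rw [map_mul, map_mul, map_mul, ha, zero_mul, mul_zero, map_smul, eq_comm,
        smul_eq_zero_iff_left (permRep_youngSym_ne_zero hl)] at h2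
      rw [h1, h2, zero_smul]
    · have := he.ortho_of_id hm (y * (a * x))
      simpa only [mul_assoc] using this
  · rw [← hza, mul_assoc, ← mul_assoc a, (hzc _).eq, mul_assoc, (hzc _).symm.eq, hz0 l hl, mul_zero]

end SchurWeyl

section Words

variable {K : Type*} [Field K] {n k : ℕ}

/-- Equivariant families, indexed by words, of elements of the group algebra fixed by `z`. -/
def wordFamilies (k : ℕ) (z : MonoidAlgebra K (Equiv.Perm (Fin n))) :
    Submodule K ((Fin n → Fin k) → MonoidAlgebra K (Equiv.Perm (Fin n))) where
  carrier := {a | ∀ w, z * a w = a w ∧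
    ∀ σ : Equiv.Perm (Fin n), MonoidAlgebra.of K _ σ * a (w ∘ σ) = a w * MonoidAlgebra.of K _ σ}
  add_mem' ha hb w := ⟨by rw [Pi.add_apply, mul_add, (ha w).1, (hb w).1], fun σ => by
    rw [Pi.add_apply, Pi.add_apply, mul_add, add_mul, (ha w).2, (hb w).2]⟩
  zero_mem' w := by simp
  smul_mem' c a ha w := ⟨by rw [Pi.smul_apply, mul_smul_comm, (ha w).1], fun σ => by
    rw [Pi.smul_apply, Pi.smul_apply, mul_smul_comm, smul_mul_assoc, (ha w).2]⟩

theorem finrank_wordFamilies {N : Type*} [Fintype N] {z : MonoidAlgebra K (Equiv.Perm (Fin n))}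
    (hzc : ∀ x, Commute z x) (r : N → Fin n → Fin k)
    (h1 : ∀ w, ∃ ν, ∃ σ : Equiv.Perm (Fin n), w = r ν ∘ σ)
    (h2 : ∀ ν ν', ∀ σ : Equiv.Perm (Fin n), r ν ∘ σ = r ν' → ν = ν')
    (C : N → Submodule K (MonoidAlgebra K (Equiv.Perm (Fin n))))
    (hC : ∀ ν a, a ∈ C ν ↔ z * a = a ∧ ∀ σ : Equiv.Perm (Fin n), r ν ∘ σ = r ν →
      Commute (MonoidAlgebra.of K _ σ) a) :
    Module.finrank K (wordFamilies k z) = ∑ ν, Module.finrank K (C ν) := by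
  have hinv : ∀ σ : Equiv.Perm (Fin n),
      MonoidAlgebra.of K _ σ⁻¹ * MonoidAlgebra.of K _ σ = 1 := fun σ => by
    rw [← map_mul, inv_mul_cancel, map_one]
  have hinv' : ∀ σ : Equiv.Perm (Fin n),
      MonoidAlgebra.of K _ σ * MonoidAlgebra.of K _ σ⁻¹ = 1 := fun σ => by
    rw [← map_mul, mul_inv_cancel, map_one]
  have hmem : ∀ a ∈ wordFamilies k z, ∀ ν, a (r ν) ∈ C ν := by
    intro a ha ν
    refine (hC _ _).2 ⟨(ha _).1, fun σ hσ => ?_⟩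
    have := (ha (r ν)).2 σ
    rwa [hσ] at this
  let Θ : wordFamilies k z →ₗ[K] ∀ ν, C ν :=
    { toFun := fun a ν => ⟨a.1 (r ν), hmem a.1 a.2 ν⟩
      map_add' := fun a b => rfl
      map_smul' := fun c a => rfl }
  have hinj : Function.Injective Θ := by
    rw [injective_iff_map_eq_zero]
    intro a ha
    refine Subtype.ext (funext fun w => ?_)
    obtain ⟨ν, σ, rfl⟩ := h1 w
    have h3 : a.1 (r ν) = 0 := congrArg Subtype.val (congrFun ha ν)
    have h4 := (a.2 (r ν)).2 σ
    rw [h3, zero_mul] at h4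
    have h5 := congrArg (MonoidAlgebra.of K _ σ⁻¹ * ·) h4
    have h6 : a.1 (r ν ∘ σ) = 0 := by
      simpa only [← mul_assoc, hinv, one_mul, mul_zero] using h5
    exact h6
  have hsurj : Function.Surjective Θ := by
    intro c
    choose ν σ hσ using h1
    let a : (Fin n → Fin k) → MonoidAlgebra K (Equiv.Perm (Fin n)) := fun w =>
      MonoidAlgebra.of K _ (σ w)⁻¹ * ((c (ν w)).1 * MonoidAlgebra.of K _ (σ w))
    have key : ∀ w ν', ∀ τ : Equiv.Perm (Fin n), w = r ν' ∘ τ →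
        a w = MonoidAlgebra.of K _ τ⁻¹ * ((c ν').1 * MonoidAlgebra.of K _ τ) := by
      intro w ν' τ hτ
      have h3 : r (ν w) ∘ (σ w * τ⁻¹ : Equiv.Perm (Fin n)) = r ν' := by
        rw [Equiv.Perm.coe_mul, ← Function.comp_assoc, ← hσ, hτ, Function.comp_assoc]
        funext t
        simp
      obtain rfl := h2 _ _ _ h3
      have h4 := ((hC _ _).1 (c (ν w)).2).2 _ h3
      have h5 : MonoidAlgebra.of K _ (σ w) = MonoidAlgebra.of K _ (σ w * τ⁻¹) *
          MonoidAlgebra.of K _ τ := by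
        rw [← map_mul, inv_mul_cancel_right]
      have h6 : MonoidAlgebra.of K _ (σ w)⁻¹ = MonoidAlgebra.of K _ τ⁻¹ *
          MonoidAlgebra.of K _ (σ w * τ⁻¹)⁻¹ := by
        rw [← map_mul, mul_inv_rev, inv_inv, inv_mul_cancel_left]
      change MonoidAlgebra.of K _ (σ w)⁻¹ * ((c (ν w)).1 * MonoidAlgebra.of K _ (σ w)) = _
      rw [h6, h5, ← mul_assoc (c (ν w)).1, ← h4.eq, mul_assoc, mul_assoc,
        ← mul_assoc (MonoidAlgebra.of K _ (σ w * τ⁻¹)⁻¹), hinv, one_mul]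
    refine ⟨⟨a, fun w => ⟨?_, fun τ => ?_⟩⟩, ?_⟩
    · change z * (MonoidAlgebra.of K _ (σ w)⁻¹ * ((c (ν w)).1 * MonoidAlgebra.of K _ (σ w))) =
        MonoidAlgebra.of K _ (σ w)⁻¹ * ((c (ν w)).1 * MonoidAlgebra.of K _ (σ w))
      rw [← mul_assoc, (hzc _).eq, mul_assoc, ← mul_assoc z, ((hC _ _).1 (c (ν w)).2).1]
    · rw [key (w ∘ τ) (ν w) (σ w * τ) (by
        rw [Equiv.Perm.coe_mul, ← Function.comp_assoc, ← hσ]), key w (ν w) (σ w) (hσ w)]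
      simp only [mul_inv_rev, map_mul, mul_assoc]
      rw [← mul_assoc (MonoidAlgebra.of K _ τ), hinv', one_mul]
    · refine funext fun ν' => Subtype.ext ?_
      have := key (r ν') ν' 1 rfl
      rw [inv_one, map_one, one_mul, mul_one] at this
      exact this
  have : Module.Finite K (MonoidAlgebra K (Equiv.Perm (Fin n))) := monoidAlgebra_finite
  rw [(LinearEquiv.ofBijective Θ ⟨hinj, hsurj⟩).finrank_eq, Module.finrank_pi_fintype]

/-- The weakly increasing word with prescribed multiplicities. -/
def sortedWord {ν : Fin k → ℕ} (h : ∑ i, ν i = n) (t : Fin n) : Fin k :=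
  ((blockEquiv h).symm t).1

theorem card_sortedWord {ν : Fin k → ℕ} (h : ∑ i, ν i = n) (i : Fin k) :
    (Finset.univ.filter fun t => sortedWord h t = i).card = ν i := by
  rw [← Fintype.card_fin (ν i), ← Finset.card_univ]
  symm
  refine Finset.card_bij (fun t _ => blockEquiv h ⟨i, t⟩) ?_ ?_ ?_
  · intro t _
    rw [Finset.mem_filter]
    exact ⟨Finset.mem_univ _, by simp [sortedWord]⟩
  · intro s _ t _ hst
    simpa using hst
  · intro t ht
    obtain ⟨⟨j, s⟩, rfl⟩ := (blockEquiv h).surjective t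
    have ht' := (Finset.mem_filter.1 ht).2
    simp only [sortedWord, Equiv.symm_apply_apply] at ht'
    subst ht'
    exact ⟨s, Finset.mem_univ _, rfl⟩

theorem sortedWord_comp_eq_iff {ν : Fin k → ℕ} (h : ∑ i, ν i = n) (σ : Equiv.Perm (Fin n)) :
    sortedWord h ∘ σ = sortedWord h ↔ ∃ g, youngHom (blockEquiv h) g = σ := by
  constructor
  · intro hσ
    have h1 : ∀ i (t : Fin (ν i)), ∃ t', σ (blockEquiv h ⟨i, t⟩) = blockEquiv h ⟨i, t'⟩ := by
      intro i t
      obtain ⟨⟨j, t'⟩, ht'⟩ := (blockEquiv h).surjective (σ (blockEquiv h ⟨i, t⟩))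
      have h2 := congrFun hσ (blockEquiv h ⟨i, t⟩)
      simp only [Function.comp_apply, ← ht', sortedWord, Equiv.symm_apply_apply] at h2
      subst h2
      exact ⟨t', ht'.symm⟩
    choose τ hτ using h1
    have hinj : ∀ i, Function.Injective (τ i) := by
      intro i s t hst
      have := hτ i s
      rw [hst, ← hτ i t, σ.injective.eq_iff, (blockEquiv h).injective.eq_iff] at this
      simpa using this
    refine ⟨fun i => Equiv.ofBijective (τ i) (Finite.injective_iff_bijective.1 (hinj i)), ?_⟩
    ext1 t
    obtain ⟨⟨i, t⟩, rfl⟩ := (blockEquiv h).surjective t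
    rw [youngHom_apply, hτ]
    rfl
  · rintro ⟨g, rfl⟩
    funext t
    obtain ⟨⟨i, t⟩, rfl⟩ := (blockEquiv h).surjective t
    rw [Function.comp_apply, youngHom_apply]
    simp [sortedWord]

theorem exists_sortedWord_comp (w : Fin n → Fin k) : ∃ ν : Fin k → ℕ, ∃ h : ∑ i, ν i = n,
    ∃ σ : Equiv.Perm (Fin n), w = sortedWord h ∘ σ := by
  let ν : Fin k → ℕ := fun i => Fintype.card {t // w t = i}
  have h : ∑ i, ν i = n := by
    rw [← Fintype.card_sigma, Fintype.card_congr (Equiv.sigmaFiberEquiv w), Fintype.card_fin]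
  refine ⟨ν, h, (Equiv.sigmaFiberEquiv w).symm.trans
    ((Equiv.sigmaCongrRight fun i => Fintype.equivFin _).trans (blockEquiv h)), ?_⟩
  funext t
  simp [sortedWord, Equiv.sigmaFiberEquiv]

end Words

theorem finrank_wordFamilies_eq (K : Type) [Field K] [CharZero K] {n : ℕ} (k d : ℕ)
    {z : MonoidAlgebra K (Equiv.Perm (Fin n))} (hzc : ∀ x, Commute z x)
    (hz1 : ∀ l : Nat.Partition n, l.parts.card ≤ d → z * youngSym K l = youngSym K l)
    (hz0 : ∀ l : Nat.Partition n, ¬ l.parts.card ≤ d → z * youngSym K l = 0) :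
    Module.finrank K (wordFamilies k z) =
      ∑ ν ∈ Finset.Nat.antidiagonalTuple k n, ∑ lam : Nat.Partition n,
        if lam.parts.card ≤ d then
          ∑ lams : (∀ i : Fin k, Nat.Partition (ν i)), iteratedLR K n ν lams lam ^ 2
        else 0 := by
  have hν : ∀ ν : Finset.Nat.antidiagonalTuple k n, ∑ i, ν.1 i = n := fun ν =>
    Finset.Nat.mem_antidiagonalTuple.1 ν.2
  refine (finrank_wordFamilies hzc
    (fun ν : Finset.Nat.antidiagonalTuple k n => sortedWord (hν ν)) ?_ ?_
    (fun ν => centralizerPart (youngHom (blockEquiv (hν ν))) z) ?_).trans ?_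
  rotate_right
  · refine Eq.trans ?_ (Finset.sum_coe_sort (Finset.Nat.antidiagonalTuple k n) fun ν =>
      ∑ lam : Nat.Partition n, if lam.parts.card ≤ d then
        ∑ lams : (∀ i : Fin k, Nat.Partition (ν i)), iteratedLR K n ν lams lam ^ 2 else 0)
    refine Finset.sum_congr rfl fun ν _ => ?_
    rw [(blockProd_system K (blockEquiv (hν ν))).finrank_centralizerPart (youngSym_system K n).1
      (fun l => l.parts.card ≤ d) hzc hz1 hz0]
    simp only [iteratedLR_eq K (hν ν)]
  · intro w
    obtain ⟨ν, h, σ, hσ⟩ := exists_sortedWord_comp w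
    exact ⟨⟨ν, Finset.Nat.mem_antidiagonalTuple.2 h⟩, σ, hσ⟩
  · intro ν ν' σ h
    refine Subtype.ext (funext fun i => ?_)
    rw [← card_sortedWord (hν ν), ← card_sortedWord (hν ν'), ← h]
    symm
    refine Finset.card_bij (fun t _ => σ t) ?_ ?_ ?_
    · intro t ht
      simpa using ht
    · intro s _ t _ hst
      exact σ.injective hst
    · intro t ht
      exact ⟨σ.symm t, by simpa using ht, by simp⟩
  · intro ν a
    rw [mem_centralizerPart]
    refine and_congr_right fun _ => ⟨fun h σ hσ => ?_, fun h g => ?_⟩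
    · obtain ⟨g, rfl⟩ := (sortedWord_comp_eq_iff _ _).1 hσ
      exact h g
    · exact h _ ((sortedWord_comp_eq_iff _ _).2 ⟨g, rfl⟩)

section Invariants

variable {K : Type} [Field K] {n : ℕ}

theorem exists_symmetric_polarization [CharZero K] {M : Type*} [AddCommGroup M] [Module K M]
    (m : MultilinearMap K (fun _ : Fin n => M) K) :
    ∃ m' : MultilinearMap K (fun _ : Fin n => M) K, (∀ u, m' (fun _ => u) = m fun _ => u) ∧
      (∀ (σ : Equiv.Perm (Fin n)) x, m' (fun t => x (σ t)) = m' x) ∧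
      ∀ L : M →ₗ[K] M, (∀ u, m (fun _ => L u) = m fun _ => u) →
        ∀ x, m' (fun t => L (x t)) = m' x := by
  have hn : ((n.factorial : ℕ) : K) ≠ 0 := Nat.cast_ne_zero.2 n.factorial_ne_zero
  let m' : MultilinearMap K (fun _ : Fin n => M) K :=
    (n.factorial : K)⁻¹ • ∑ σ : Equiv.Perm (Fin n), m.domDomCongr σ
  have hm' : ∀ x, m' x = (n.factorial : K)⁻¹ * ∑ σ : Equiv.Perm (Fin n), m fun t => x (σ t) := by
    intro x
    simp [m']
  refine ⟨m', fun u => ?_, fun σ x => ?_, fun L hL x => ?_⟩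
  · rw [hm', Finset.sum_const, Finset.card_univ, Fintype.card_perm, Fintype.card_fin, nsmul_eq_mul,
      inv_mul_cancel_left₀ hn]
  · rw [hm', hm']
    congr 1
    exact Fintype.sum_equiv (Equiv.mulLeft σ) _ _ fun τ => rfl
  · have h := sum_perm_eq_zero_of_diagonal (m.compLinearMap (fun _ => L) - m)
      (fun u => by simp [hL]) x
    simp only [sub_apply, MultilinearMap.compLinearMap_apply,
      Finset.sum_sub_distrib, sub_eq_zero] at h
    rw [hm', hm', h]

/-- Simultaneous conjugation of tuples of elements of a ring by units. -/
def unitConj (A : Type) [Ring A] (k : ℕ) (g : Aˣ) (u : Fin k → A) : Fin k → A :=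
  fun i => g * u i * ↑g⁻¹

variable {A : Type} [Ring A] [Algebra K A] {k : ℕ}

theorem exists_components [CharZero K] {F : (Fin k → A) → K}
    (hF : F ∈ invariantPolynomials K (unitConj A k) n) :
    ∃ m : (Fin n → Fin k) → MultilinearMap K (fun _ : Fin n => A) K,
      (∀ u, F u = ∑ w, m w fun t => u (w t)) ∧
      (∀ w (g : Aˣ) x, m w (fun t => g * x t * ↑g⁻¹) = m w x) ∧
      ∀ w (σ : Equiv.Perm (Fin n)) x, m (w ∘ σ) (fun t => x (σ t)) = m w x := by
  obtain ⟨⟨m₀, hm₀⟩, hinv⟩ := hF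
  obtain ⟨m', h1, h2, h3⟩ := exists_symmetric_polarization m₀
  refine ⟨fun w => m'.compLinearMap fun t => LinearMap.single K (fun _ => A) (w t), fun u => ?_,
    fun w g x => ?_, fun w σ x => ?_⟩
  · rw [hm₀, ← h1]
    have : (fun _ : Fin n => u) = fun _ => ∑ i, Pi.single i (u i) :=
      funext fun _ => (Finset.univ_sum_single u).symm
    rw [this, m'.map_sum]
    rfl
  · let L : (Fin k → A) →ₗ[K] (Fin k → A) := LinearMap.pi fun i =>
      (LinearMap.mulLeft K (g : A) ∘ₗ LinearMap.mulRight K (↑g⁻¹ : A)) ∘ₗ LinearMap.proj i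
    have hL : ∀ u, L u = unitConj A k g u := fun u => funext fun i => by
      simp [L, unitConj, mul_assoc]
    have h4 := h3 L (fun u => by rw [hL, ← hm₀, hinv, hm₀])
      fun t => LinearMap.single K (fun _ => A) (w t) (x t)
    rw [MultilinearMap.compLinearMap_apply, MultilinearMap.compLinearMap_apply, ← h4]
    congr 1
    funext t
    rw [hL]
    funext i
    by_cases hi : i = w t
    · subst hi
      simp [unitConj]
    · simp [unitConj, hi]
  · exact h2 σ fun t => LinearMap.single K (fun _ => A) (w t) (x t)

theorem components_eq_zero [CharZero K]
    {m : (Fin n → Fin k) → MultilinearMap K (fun _ : Fin n => A) K}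
    (hm : ∀ w (σ : Equiv.Perm (Fin n)) x, m (w ∘ σ) (fun t => x (σ t)) = m w x)
    (h : ∀ u : Fin k → A, ∑ w, m w (fun t => u (w t)) = 0) (w : Fin n → Fin k) : m w = 0 := by
  have hn : ((n.factorial : ℕ) : K) ≠ 0 := Nat.cast_ne_zero.2 n.factorial_ne_zero
  let M : MultilinearMap K (fun _ : Fin n => Fin k → A) K :=
    ∑ w, (m w).compLinearMap fun t => LinearMap.proj (w t)
  have hM : ∀ x, M x = ∑ w, m w fun t => x t (w t) := fun x => by
    simp [M]
  have hsym : ∀ (σ : Equiv.Perm (Fin n)) x, M (fun t => x (σ t)) = M x := by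
    intro σ x
    rw [hM, hM]
    exact Fintype.sum_equiv (Equiv.arrowCongr σ (Equiv.refl (Fin k))) _ _ fun v => by
      refine Eq.trans ?_ (hm (Equiv.arrowCongr σ (Equiv.refl (Fin k)) v) σ
        fun t => x t (Equiv.arrowCongr σ (Equiv.refl (Fin k)) v t))
      congr 2
      · funext t
        simp [Equiv.arrowCongr]
      · funext t
        simp [Equiv.arrowCongr]
  ext x
  have h1 := sum_perm_eq_zero_of_diagonal M (fun u => by rw [hM, h])
    fun t => Pi.single (w t) (x t)
  have h2 : ∀ σ : Equiv.Perm (Fin n), (M fun t => Pi.single (w (σ t)) (x (σ t))) = m w x := by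
    intro σ
    rw [hsym σ fun t => Pi.single (w t) (x t), hM, Finset.sum_eq_single w]
    · simp
    · intro v _ hv
      obtain ⟨t, ht⟩ := Function.ne_iff.1 hv
      exact (m v).map_coord_zero t (by simp [ht])
    · simp
  rw [Finset.sum_congr rfl fun σ _ => h2 σ, Finset.sum_const, Finset.card_univ, Fintype.card_perm,
    Fintype.card_fin, nsmul_eq_mul] at h1
  exact (mul_eq_zero.1 h1).resolve_left hn

theorem finrank_invariantPolynomials_unitConj_congr {B : Type} [Ring B] [Algebra K B]
    (e : A ≃ₐ[K] B) (k n : ℕ) : Module.finrank K (invariantPolynomials K (unitConj A k) n) =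
      Module.finrank K (invariantPolynomials K (unitConj B k) n) := by
  have aux : ∀ {A B : Type} [Ring A] [Algebra K A] [Ring B] [Algebra K B] (e : A ≃ₐ[K] B)
      (F : (Fin k → A) → K), F ∈ invariantPolynomials K (unitConj A k) n →
      (fun u => F fun i => e.symm (u i)) ∈ invariantPolynomials K (unitConj B k) n := by
    rintro A B _ _ _ _ e F ⟨⟨m, hm⟩, hinv⟩
    refine ⟨⟨m.compLinearMap fun _ => LinearMap.pi fun i =>
      e.symm.toLinearMap ∘ₗ LinearMap.proj i, fun u => ?_⟩, fun g u => ?_⟩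
    · exact hm _
    · refine Eq.trans ?_ (hinv (Units.map e.symm.toRingEquiv.toMonoidHom g) _)
      change F _ = F _
      congr 1
      funext i
      simp [unitConj, ← map_inv]
  refine LinearEquiv.finrank_eq
    { toFun := fun F => ⟨_, aux e F.1 F.2⟩
      invFun := fun F => ⟨_, aux e.symm F.1 F.2⟩
      map_add' := fun F G => rfl
      map_smul' := fun c F => rfl
      left_inv := fun F => ?_
      right_inv := fun F => ?_ }
  · refine Subtype.ext (funext fun u => ?_)
    simp
  · refine Subtype.ext (funext fun u => ?_)
    simp

theorem invariantPolynomials_conjAction (W : Type) [AddCommGroup W] [Module K W] (k n : ℕ) :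
    invariantPolynomials K (conjAction K W k) n =
      invariantPolynomials K (unitConj (Module.End K W) k) n := by
  ext F
  refine and_congr_right fun _ => ⟨fun h g u => ?_, fun h g u => ?_⟩
  · exact h (LinearMap.GeneralLinearGroup.generalLinearEquiv K W g) u
  · have := h ((LinearMap.GeneralLinearGroup.generalLinearEquiv K W).symm g) u
    exact this

end Invariants

section MatrixInvariants

variable {K : Type} [Field K] {ι : Type} [Fintype ι] [DecidableEq ι] {n : ℕ}

theorem eq_of_trace_mul_tensorPow {S T : Matrix (Fin n → ι) (Fin n → ι) K}
    (h : ∀ x, (S * tensorPow K x).trace = (T * tensorPow K x).trace) : S = T := by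
  have h1 := eq_zero_of_forall_tensorPow
    (Matrix.traceLinearMap (Fin n → ι) K K ∘ₗ LinearMap.mulLeft K (S - T)) fun x => by
      simp [sub_mul, h]
  refine Matrix.ext_iff_trace_mul_right.2 fun X => ?_
  have h2 := LinearMap.congr_fun h1 X
  simpa [sub_mul, sub_eq_zero] using h2

theorem exists_trace_mul_tensorPow (m : MultilinearMap K (fun _ : Fin n => Matrix ι ι K) K) :
    ∃ T : Matrix (Fin n → ι) (Fin n → ι) K, ∀ x, m x = (T * tensorPow K x).trace := by
  let T : Matrix (Fin n → ι) (Fin n → ι) K := Matrix.of fun I J =>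
    m fun t => Matrix.single (J t) (I t) 1
  have h : m = (Matrix.traceLinearMap (Fin n → ι) K K ∘ₗ LinearMap.mulLeft K T).compMultilinearMap
      (tensorPow K) := by
    refine Module.Basis.ext_multilinear (fun _ => Matrix.stdBasis K ι ι) fun v => ?_
    have h1 := tensorPow_single (K := K) (fun t => (v t).1) (fun t => (v t).2)
    have h2 : ∀ p, Matrix.stdBasis K ι ι p = Matrix.single p.1 p.2 1 := fun p =>
      Matrix.stdBasis_eq_single K p.1 p.2
    simp only [LinearMap.compMultilinearMap_apply, h2, h1, LinearMap.comp_apply, LinearMap.mulLeft_apply, Matrix.traceLinearMap_apply,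
      Matrix.trace_mul_single]
    simp [T]
  exact ⟨T, fun x => by rw [h]; rfl⟩

theorem trace_mul_tensorPow_comp_iff {S T : Matrix (Fin n → ι) (Fin n → ι) K}
    (σ : Equiv.Perm (Fin n)) :
    (∀ x, (S * tensorPow K fun t => x (σ t)).trace = (T * tensorPow K x).trace) ↔
      permMat K (Fin n) ι σ * S = T * permMat K (Fin n) ι σ := by
  have h1 : permMat K (Fin n) ι σ⁻¹ * permMat K (Fin n) ι σ = 1 := by
    rw [← map_mul, inv_mul_cancel, map_one]
  have h1' : permMat K (Fin n) ι σ * permMat K (Fin n) ι σ⁻¹ = 1 := by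
    rw [← map_mul, mul_inv_cancel, map_one]
  have h2 : ∀ x, (T * tensorPow K x).trace =
      (permMat K (Fin n) ι σ⁻¹ * T * permMat K (Fin n) ι σ *
        tensorPow K fun t => x (σ t)).trace := by
    intro x
    have h3 : (permMat K (Fin n) ι σ * tensorPow K fun t => x (σ t)) =
        tensorPow K x * permMat K (Fin n) ι σ := by
      rw [permMat_mul_tensorPow]
      simp
    rw [mul_assoc, h3, mul_assoc (permMat K (Fin n) ι σ⁻¹),
      Matrix.trace_mul_comm (permMat K (Fin n) ι σ⁻¹), mul_assoc, mul_assoc, h1', mul_one]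
  constructor
  · intro h
    have h3 : S = permMat K (Fin n) ι σ⁻¹ * T * permMat K (Fin n) ι σ := by
      refine eq_of_trace_mul_tensorPow fun x => ?_
      have := h fun t => x (σ.symm t)
      rw [h2] at this
      simpa using this
    rw [h3, ← mul_assoc, ← mul_assoc, h1', one_mul]
  · intro h x
    rw [h2, mul_assoc (permMat K (Fin n) ι σ⁻¹), ← h, ← mul_assoc, h1, one_mul]

theorem trace_mul_tensorPow_conj_iff {T : Matrix (Fin n → ι) (Fin n → ι) K}
    (g : (Matrix ι ι K)ˣ) :
    (∀ x, (T * tensorPow K fun t => g.1 * x t * g⁻¹.1).trace = (T * tensorPow K x).trace) ↔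
      T * tensorPow K (fun _ => g.1) = tensorPow K (fun _ => g.1) * T := by
  set G : Matrix (Fin n → ι) (Fin n → ι) K := tensorPow K fun _ => g.1
  set G' : Matrix (Fin n → ι) (Fin n → ι) K := tensorPow K fun _ => (↑g⁻¹ : Matrix ι ι K)
  have hone : tensorPow K (fun _ : Fin n => (1 : Matrix ι ι K)) = 1 := by
    ext I J
    rw [tensorPow_apply, Matrix.one_apply]
    simp only [Matrix.one_apply, Finset.prod_ite_zero, funext_iff]
    simp
  have h1 : G' * G = 1 := by rw [← hone, tensorPow_mul]; simp
  have h1' : G * G' = 1 := by rw [← hone, tensorPow_mul]; simp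
  have h2 : ∀ x, (T * tensorPow K fun t => g.1 * x t * g⁻¹.1).trace =
      (G' * T * G * tensorPow K x).trace := by
    intro x
    have : (tensorPow K fun t => g.1 * x t * g⁻¹.1) = G * tensorPow K x * G' := by
      rw [tensorPow_mul, tensorPow_mul]
    rw [this, ← mul_assoc, Matrix.trace_mul_comm]
    simp only [mul_assoc]
  simp only [h2]
  constructor
  · intro h
    have h3 := eq_of_trace_mul_tensorPow h
    calc T * G = G * G' * (T * G) := by rw [h1', one_mul]
      _ = G * (G' * T * G) := by simp only [mul_assoc]
      _ = G * T := by rw [h3]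
  · intro h x
    rw [mul_assoc G', h, ← mul_assoc, h1, one_mul]

theorem permRep_mul_tensorPow_const (a : MonoidAlgebra K (Equiv.Perm (Fin n)))
    (g : Matrix ι ι K) : permRep K n ι a * tensorPow K (fun _ => g) =
      tensorPow K (fun _ => g) * permRep K n ι a := by
  induction a using MonoidAlgebra.induction_on with
  | of σ => rw [permRep_of, permMat_mul_tensorPow]
  | add a b ha hb => rw [map_add, add_mul, mul_add, ha, hb]
  | smul c a ha => rw [map_smul, smul_mul_assoc, mul_smul_comm, ha]

/-- The multilinear form attached to an element of the group algebra. -/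
noncomputable def traceForm : MonoidAlgebra K (Equiv.Perm (Fin n)) →ₗ[K]
    MultilinearMap K (fun _ : Fin n => Matrix ι ι K) K where
  toFun a := (Matrix.traceLinearMap (Fin n → ι) K K ∘ₗ
    LinearMap.mulLeft K (permRep K n ι a)).compMultilinearMap (tensorPow K)
  map_add' a b := by refine MultilinearMap.ext fun x => ?_; simp [add_mul]
  map_smul' c a := by refine MultilinearMap.ext fun x => ?_; simp

theorem traceForm_apply (a : MonoidAlgebra K (Equiv.Perm (Fin n))) (x : Fin n → Matrix ι ι K) :
    traceForm a x = (permRep K n ι a * tensorPow K x).trace := rfl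

theorem central_projection_mul_self [CharZero K] {z : MonoidAlgebra K (Equiv.Perm (Fin n))}
    {P : Nat.Partition n → Prop} (hzc : ∀ x, Commute z x)
    (hz1 : ∀ l, P l → z * youngSym K l = youngSym K l)
    (hz0 : ∀ l, ¬ P l → z * youngSym K l = 0) : z * z = z := by
  have h := (youngSym_system K n).1.map_one_eq_zero
    (LinearMap.mulLeft K (z * z - z)) fun l g g' => by
      have h1 : ∀ x y, z * (x * youngSym K l * y) = x * (z * youngSym K l) * y := fun x y => by
        rw [← mul_assoc, ← mul_assoc, (hzc _).eq, mul_assoc x]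
      rw [LinearMap.mulLeft_apply, sub_mul, mul_assoc z]
      by_cases hl : P l
      · simp only [h1, hz1 l hl, sub_self]
      · simp only [h1, hz0 l hl, mul_zero, zero_mul, sub_self]
  rw [LinearMap.mulLeft_apply, mul_one] at h
  exact sub_eq_zero.1 h

theorem finrank_invariantPolynomials_matrix [CharZero K] (k : ℕ)
    {z : MonoidAlgebra K (Equiv.Perm (Fin n))} (hzc : ∀ x, Commute z x) (hzz : z * z = z)
    (hz1 : ∀ l : Nat.Partition n, l.parts.card ≤ Fintype.card ι → z * youngSym K l = youngSym K l)
    (hz0 : ∀ l : Nat.Partition n, ¬ l.parts.card ≤ Fintype.card ι → z * youngSym K l = 0) :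
    Module.finrank K (invariantPolynomials K (unitConj (Matrix ι ι K) k) n) =
      Module.finrank K (wordFamilies k z) := by
  have hρz := permRep_central_projection hzc hz1
  let Θ : wordFamilies k z →ₗ[K] invariantPolynomials K (unitConj (Matrix ι ι K) k) n :=
    { toFun := fun a => ⟨fun u => ∑ w, traceForm (a.1 w) fun t => u (w t), by
        refine ⟨⟨∑ w, (traceForm (a.1 w)).compLinearMap fun t => LinearMap.proj (w t),
          fun u => by simp⟩, fun g u => Finset.sum_congr rfl fun w _ => ?_⟩
        exact (trace_mul_tensorPow_conj_iff g).2 (permRep_mul_tensorPow_const _ _)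
          fun t => u (w t)⟩
      map_add' := fun a b => Subtype.ext <| funext fun u => by
        simp [Finset.sum_add_distrib]
      map_smul' := fun c a => Subtype.ext <| funext fun u => by
        simp [Finset.mul_sum] }
  symm
  refine (LinearEquiv.ofBijective Θ ⟨?_, ?_⟩).finrank_eq
  · rw [injective_iff_map_eq_zero]
    intro a ha
    have h1 := components_eq_zero (m := fun w => traceForm (ι := ι) (a.1 w)) (fun w σ => by
      refine (trace_mul_tensorPow_comp_iff σ).2 ?_
      rw [← permRep_of, ← map_mul, ← map_mul, (a.2 w).2 σ])
      fun u => congrFun (congrArg Subtype.val ha) u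
    refine Subtype.ext (funext fun w => ?_)
    refine eq_zero_of_permRep_eq_zero (ι := ι) hzc hz0 (a.2 w).1
      (eq_of_trace_mul_tensorPow fun x => ?_)
    rw [← traceForm_apply, h1 w]
    simp
  · rintro ⟨F, hF⟩
    obtain ⟨m, h1, h2, h3⟩ := exists_components hF
    choose T hT using fun w => exists_trace_mul_tensorPow (m w)
    have h4 : ∀ w, ∃ a, permRep K n ι a = T w := fun w => by
      refine exists_permRep_of_mem_span (mem_span_permMat fun g => ?_)
      refine (trace_mul_tensorPow_conj_iff g).1 fun x => ?_
      rw [← hT, ← hT, h2]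
    choose a ha using h4
    have hza : ∀ w, permRep K n ι (z * a w) = T w := fun w => by
      rw [map_mul, hρz, one_mul, ha]
    refine ⟨⟨fun w => z * a w, fun w => ⟨by rw [← mul_assoc, hzz], fun σ => ?_⟩⟩, ?_⟩
    · refine sub_eq_zero.1 (eq_zero_of_permRep_eq_zero (ι := ι) hzc hz0 ?_ ?_)
      · rw [mul_sub, ← mul_assoc, (hzc _).eq, mul_assoc, ← mul_assoc z, hzz,
          ← mul_assoc z (z * a w), ← mul_assoc z z, hzz]
      · rw [map_sub, map_mul, map_mul _ (z * a w), hza, hza, permRep_of, sub_eq_zero]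
        refine (trace_mul_tensorPow_comp_iff σ).1 fun x => ?_
        rw [← hT, ← hT, h3]
    · refine Subtype.ext (funext fun u => ?_)
      refine Eq.trans (Finset.sum_congr rfl fun w _ => ?_) (h1 u).symm
      rw [traceForm_apply, hza, hT]

end MatrixInvariants

section Swindle

/-- A copy of the algebra `A` in the corner complementary to the idempotent `e`, for which an
infinite repetition swindle inside `A` is available. -/
def HasSwindle (K : Type) {A : Type} [Field K] [Ring A] [Algebra K A] (e : A) : Prop :=
  ∃ (φ ψ : A →ₗ[K] A) (s : Aˣ), (∀ x y, φ (x * y) = φ x * φ y) ∧ (∀ x y, φ x * ψ y = 0) ∧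
    (∀ x y, ψ x * φ y = 0) ∧ (∀ y, (1 - e) * y * (1 - e) = y → ∃ x, φ x = y) ∧
    ∀ x, s * (φ x + ψ x) * ↑s⁻¹ = ψ x

variable {K A : Type} [Field K] [Ring A] [Algebra K A]

/-- Invariance of a multilinear form under simultaneous conjugation by units. -/
def IsConjInvariant {T : Type} (m : MultilinearMap K (fun _ : T => A) K) : Prop :=
  ∀ (g : Aˣ) x, m (fun t => g * x t * ↑g⁻¹) = m x

theorem IsConjInvariant.eq_zero_on_copy {T : Type} [Fintype T] [DecidableEq T] [Nonempty T]
    {m : MultilinearMap K (fun _ : T => A) K} (hm : IsConjInvariant m)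
    (ih : ∀ (T' : Type) [Fintype T'] [DecidableEq T'] [Nonempty T'],
      Fintype.card T' < Fintype.card T →
      ∀ m' : MultilinearMap K (fun _ : T' => A) K, IsConjInvariant m' → m' = 0)
    {e : A} (he : HasSwindle K e) {x : T → A} (hx : ∀ t, (1 - e) * x t * (1 - e) = x t) :
    m x = 0 := by
  obtain ⟨φ, ψ, s, hφ, hφψ, hψφ, hr, hs⟩ := he
  choose y hy using fun t => hr _ (hx t)
  obtain rfl : (fun t => φ (y t)) = x := funext hy
  have h1 := hm s fun t => φ (y t) + ψ (y t)
  simp only [hs] at h1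
  have h2 := m.map_add_univ (fun t => φ (y t)) fun t => ψ (y t)
  have h3 : ∀ B : Finset T, B ≠ ∅ → B ≠ Finset.univ →
      m (B.piecewise (fun t => φ (y t)) fun t => ψ (y t)) = 0 := by
    intro B hB0 hB1
    have : Nonempty {t // t ∈ B} := (Finset.nonempty_iff_ne_empty.2 hB0).to_subtype
    let m' : MultilinearMap K (fun _ : {t // t ∈ B} => A) K :=
      (m.domDomRestrict (fun t => t ∈ B) fun t => ψ (y t)).compLinearMap fun _ => φ
    have hm' : ∀ v, m' v = m fun t => if h : t ∈ B then φ (v ⟨t, h⟩) else ψ (y t) := fun v => rfl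
    have h4 : m' = 0 := by
      refine ih _ ?_ _ fun g v => ?_
      · rw [Fintype.card_coe]
        exact (Finset.card_lt_iff_ne_univ B).2 hB1
      · have hφ1 : ∀ x, φ 1 * φ x = φ x := fun x => by rw [← hφ, one_mul]
        have hφ1' : ∀ x, φ x * φ 1 = φ x := fun x => by rw [← hφ, mul_one]
        let G : Aˣ :=
          { val := φ g + (1 - φ 1)
            inv := φ ↑g⁻¹ + (1 - φ 1)
            val_inv := by
              simp only [mul_add, add_mul, mul_sub, sub_mul, one_mul, mul_one, hφ1, hφ1', ← hφ,
                Units.mul_inv]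
              abel
            inv_val := by
              simp only [mul_add, add_mul, mul_sub, sub_mul, one_mul, mul_one, hφ1, hφ1', ← hφ,
                Units.inv_mul]
              abel }
        have hG : G.1 = φ g + (1 - φ 1) := rfl
        have hG' : G⁻¹.1 = φ ↑g⁻¹ + (1 - φ 1) := rfl
        rw [hm', hm']
        refine Eq.trans ?_ (hm G _)
        congr 1
        funext t
        split_ifs with h
        · simp only [hG, hG', mul_add, add_mul, mul_sub, sub_mul, one_mul, mul_one, ← hφ]
          abel
        · simp only [hG, hG', mul_add, add_mul, mul_sub, sub_mul, one_mul, mul_one, hφψ, hψφ,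
            sub_zero, zero_add]
    have h5 := hm' fun t => y t
    rw [h4, zero_apply] at h5
    exact h5.symm
  rw [show (fun t => φ (y t) + ψ (y t)) = (fun t => φ (y t)) + fun t => ψ (y t) from rfl, h2,
    ← Finset.add_sum_erase _ _ (Finset.mem_univ ∅), Finset.piecewise_empty, left_eq_add,
    Finset.sum_eq_single Finset.univ, Finset.piecewise_univ] at h1
  · exact h1
  · intro B hB hB1
    exact h3 B (Finset.ne_of_mem_erase hB) hB1
  · intro h
    exact absurd (Finset.mem_erase.2 ⟨Finset.univ_nonempty.ne_empty, Finset.mem_univ _⟩) h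

theorem IsConjInvariant.eq_zero_of_blocks [CharZero K] {T N : Type} [Fintype T] [DecidableEq T]
    [Fintype N] [DecidableEq N] (hTN : Fintype.card T < Fintype.card N)
    {m : MultilinearMap K (fun _ : T => A) K} (hm : IsConjInvariant m) {e : N → A}
    (he : ∀ a b, e a * e b = if a = b then e a else 0) (he1 : ∑ a, e a = 1)
    (h : ∀ a x, (∀ t, (1 - e a) * x t * (1 - e a) = x t) → m x = 0) : m = 0 := by
  ext x
  have hx : x = fun t => ∑ p : N × N, e p.1 * x t * e p.2 := by
    funext t
    rw [Fintype.sum_prod_type]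
    simp only [← Finset.mul_sum, he1, mul_one]
    rw [← Finset.sum_mul, he1, one_mul]
  rw [hx, m.map_sum, zero_apply]
  refine Finset.sum_eq_zero fun r _ => ?_
  obtain ⟨a, ha⟩ : ∃ a, ∀ t, (r t).1 ≠ a := by
    by_contra! hcon
    exact absurd (Fintype.card_le_of_surjective _ hcon) (not_le.2 hTN)
  by_cases hb : ∃ t, (r t).2 = a
  · have h2 : (2 : K) ≠ 0 := two_ne_zero
    let g : Aˣ :=
      { val := 1 + e a
        inv := 1 - (2 : K)⁻¹ • e a
        val_inv := by
          simp only [add_mul, mul_sub, one_mul, mul_one, mul_smul_comm, smul_add, he, if_true]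
          have : e a = (2 : K)⁻¹ • e a + (2 : K)⁻¹ • e a := by
            rw [← add_smul, ← two_mul, mul_inv_cancel₀ h2, one_smul]
          generalize (2 : K)⁻¹ • e a = f at this ⊢
          rw [this]
          abel
        inv_val := by
          simp only [mul_add, sub_mul, one_mul, mul_one, smul_mul_assoc, he, if_true]
          have : e a = (2 : K)⁻¹ • e a + (2 : K)⁻¹ • e a := by
            rw [← add_smul, ← two_mul, mul_inv_cancel₀ h2, one_smul]
          generalize (2 : K)⁻¹ • e a = f at this ⊢
          rw [this]
          abel }
    have hg : g.1 = 1 + e a := rfl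
    have hg' : g⁻¹.1 = 1 - (2 : K)⁻¹ • e a := rfl
    have h3 := hm g fun t => e (r t).1 * x t * e (r t).2
    have h4 : ∀ t, g * (e (r t).1 * x t * e (r t).2) * ↑g⁻¹ =
        (if (r t).2 = a then (2 : K)⁻¹ else 1) • (e (r t).1 * x t * e (r t).2) := by
      intro t
      have h5 : g * (e (r t).1 * x t * e (r t).2) = e (r t).1 * x t * e (r t).2 := by
        rw [hg, add_mul, one_mul, ← mul_assoc, ← mul_assoc, he, if_neg (ha t).symm, zero_mul,
          zero_mul, add_zero]
      rw [h5, hg', mul_sub, mul_one, mul_smul_comm, mul_assoc _ (e (r t).2), he]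
      split_ifs
      · have : (2 : K)⁻¹ = 1 - 2⁻¹ := by field_simp; norm_num
        nth_rewrite 2 [this]
        rw [sub_smul, one_smul]
      · rw [mul_zero, smul_zero, sub_zero, one_smul]
    simp only [h4] at h3
    rw [m.map_smul_univ, Finset.prod_ite, Finset.prod_const, Finset.prod_const_one, mul_one,
      smul_eq_mul, mul_left_eq_self₀] at h3
    refine h3.resolve_left fun h6 => ?_
    obtain ⟨t, ht⟩ := hb
    have h7 : 0 < (Finset.univ.filter fun t => (r t).2 = a).card :=
      Finset.card_pos.2 ⟨t, Finset.mem_filter.2 ⟨Finset.mem_univ _, ht⟩⟩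
    have h8 := congrArg (fun c : K => c⁻¹) h6
    simp only [inv_pow, inv_inv, inv_one] at h8
    exact (Nat.one_lt_two_pow h7.ne').ne' (by exact_mod_cast h8)
  · refine h a _ fun t => ?_
    have hb' : (r t).2 ≠ a := fun h' => hb ⟨t, h'⟩
    rw [sub_mul, one_mul, ← mul_assoc, ← mul_assoc, he, if_neg (ha t).symm, zero_mul, zero_mul,
      sub_zero, mul_sub, mul_one, mul_assoc _ (e (r t).2), he, if_neg hb', mul_zero, sub_zero]

theorem IsConjInvariant.eq_zero [CharZero K]
    (h : ∀ n : ℕ, 2 ≤ n → ∃ e : Fin n → A, (∀ a b, e a * e b = if a = b then e a else 0) ∧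
      ∑ a, e a = 1 ∧ ∀ a, HasSwindle K (e a))
    {T : Type} [Fintype T] [DecidableEq T] [Nonempty T]
    {m : MultilinearMap K (fun _ : T => A) K} (hm : IsConjInvariant m) : m = 0 := by
  induction hn : Fintype.card T using Nat.strong_induction_on generalizing T with
  | _ n ih =>
    have hn1 : 0 < n := hn ▸ Fintype.card_pos
    obtain ⟨e, he, he1, hs⟩ := h (n + 1) (by omega)
    refine hm.eq_zero_of_blocks (by simp [hn]) he he1 fun a x hx => ?_
    refine hm.eq_zero_on_copy (fun T' _ _ _ hT' m' hm' => ?_) (hs a) hx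
    exact ih _ (hn ▸ hT') hm' rfl

end Swindle

section Copies

variable {K : Type} [Field K] {J V : Type} [AddCommGroup V] [Module K V]

/-- The endomorphism of a direct sum of copies of `V` acting on the `j`-th copy by `c j • x`. -/
noncomputable def copies (c : J → K) : Module.End K V →ₗ[K] Module.End K (J →₀ V) where
  toFun x :=
    { toFun := fun f => Finsupp.onFinset f.support (fun j => c j • x (f j)) fun j hj => by
        rw [Finsupp.mem_support_iff]
        rintro h0
        simp [h0] at hj
      map_add' := fun f g => by ext j; simp
      map_smul' := fun a f => by ext j; simp [smul_comm (c j) a] }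
  map_add' x y := by refine LinearMap.ext fun f => Finsupp.ext fun j => ?_; simp
  map_smul' a x := by
    refine LinearMap.ext fun f => Finsupp.ext fun j => ?_
    simp [smul_comm (c j) a]

theorem copies_apply (c : J → K) (x : Module.End K V) (f : J →₀ V) (j : J) :
    copies c x f j = c j • x (f j) := rfl

theorem copies_mul (c c' : J → K) (x y : Module.End K V) :
    copies c x * copies c' y = copies (c * c') (x * y) := by
  refine LinearMap.ext fun f => Finsupp.ext fun j => ?_
  simp [copies_apply, mul_smul]

theorem hasSwindle_of_equiv (Θ : (ℤ →₀ V) ≃ₗ[K] V) {e : Module.End K V}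
    (he : ∀ f, Θ (copies (Pi.single 0 1 : ℤ → K) 1 f) = Θ f - e (Θ f)) : HasSwindle K e := by
  let C : Module.End K (ℤ →₀ V) ≃ₐ[K] Module.End K V := Θ.conjAlgEquiv K
  let c₀ : ℤ → K := Pi.single 0 1
  let c₁ : ℤ → K := fun j => if 0 < j then 1 else 0
  let S : (ℤ →₀ V) ≃ₗ[K] (ℤ →₀ V) := Finsupp.domLCongr (Equiv.addRight 1)
  let s : (Module.End K (ℤ →₀ V))ˣ :=
    (LinearMap.GeneralLinearGroup.generalLinearEquiv K (ℤ →₀ V)).symm S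
  have h00 : c₀ * c₀ = c₀ := by
    funext j
    by_cases hj : j = 0 <;> simp [c₀, hj]
  have h01 : c₀ * c₁ = 0 := by
    funext j
    by_cases hj : j = 0 <;> simp [c₀, c₁, hj]
  have h10 : c₁ * c₀ = 0 := by rw [mul_comm, h01]
  have hz : ∀ x : Module.End K V, copies (0 : ℤ → K) x = 0 := fun x =>
    LinearMap.ext fun f => Finsupp.ext fun j => by simp [copies_apply]
  have he' : 1 - e = C (copies c₀ 1) := by
    refine LinearMap.ext fun v => ?_
    have := he (Θ.symm v)
    rw [Θ.apply_symm_apply] at this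
    exact this.symm
  refine ⟨C.toLinearMap ∘ₗ copies c₀, C.toLinearMap ∘ₗ copies c₁,
    Units.map C.toRingEquiv.toMonoidHom s, fun x y => ?_, fun x y => ?_, fun x y => ?_,
    fun y hy => ?_, fun x => ?_⟩
  · change C _ = C _ * C _
    rw [← map_mul, copies_mul, h00]
  · change C _ * C _ = 0
    rw [← map_mul, copies_mul, h01, hz, map_zero]
  · change C _ * C _ = 0
    rw [← map_mul, copies_mul, h10, hz, map_zero]
  · obtain ⟨y, rfl⟩ := C.surjective y
    rw [he', ← map_mul, ← map_mul, C.injective.eq_iff] at hy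
    refine ⟨Finsupp.lapply 0 ∘ₗ y ∘ₗ Finsupp.lsingle 0, ?_⟩
    change C _ = C _
    congr 1
    refine LinearMap.ext fun f => Finsupp.ext fun j => ?_
    have h0 : copies c₀ 1 f = Finsupp.single 0 (f 0) := by
      ext j
      by_cases hj : j = 0
      · subst hj
        simp [copies_apply, c₀]
      · simp [copies_apply, c₀, hj]
    have h1 : y f j = c₀ j • y (Finsupp.single 0 (f 0)) j := by
      conv_lhs => rw [← hy]
      rw [Module.End.mul_apply, Module.End.mul_apply, h0, copies_apply, Module.End.one_apply]
    rw [copies_apply, h1]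
    by_cases hj : j = 0
    · subst hj
      rfl
    · simp [c₀, hj]
  · have h1 : s.1 * (copies c₀ x + copies c₁ x) * s⁻¹.1 = copies c₁ x := by
      refine LinearMap.ext fun f => Finsupp.ext fun j => ?_
      change (S ((copies c₀ x + copies c₁ x) (S.symm f))) j = _
      have h2 : S.symm f (j - 1) = f j := by simp [S]
      have h3 : ∀ f' : ℤ →₀ V, S f' j = f' (j - 1) := fun f' => by
        simp [S, sub_eq_add_neg]
      rw [h3, LinearMap.add_apply, Finsupp.add_apply, copies_apply, copies_apply, copies_apply,
        h2, ← add_smul]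
      congr 1
      rcases lt_trichotomy (j - 1) 0 with h | h | h
      · rw [show c₀ (j - 1) = 0 by simp [c₀, h.ne],
          show c₁ (j - 1) = 0 from if_neg h.not_gt, show c₁ j = 0 from if_neg (by omega), add_zero]
      · rw [h, show c₀ 0 = 1 by simp [c₀], show c₁ 0 = 0 from if_neg (lt_irrefl 0),
          show c₁ j = 1 from if_pos (by omega), add_zero]
      · rw [show c₀ (j - 1) = 0 by simp [c₀, h.ne'],
          show c₁ (j - 1) = 1 from if_pos h, show c₁ j = 1 from if_pos (by omega), zero_add]
    change C s.1 * (C _ + C _) * C s⁻¹.1 = C _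
    rw [← map_add, ← map_mul, ← map_mul, h1]

theorem exists_equiv_int_prod {ι N : Type} [Infinite ι] [Finite N] [Nontrivial N]
    [DecidableEq N] (b : ι ≃ N × ι) (a : N) :
    ∃ θ : ℤ × ι ≃ ι, ∀ p, (b (θ p)).1 = a ↔ p.1 ≠ 0 := by
  have hne : ∀ (P : ι → Prop), (∃ f : ι → ι, f.Injective ∧ ∀ i, P (f i)) →
      Nonempty (ι ≃ {i // P i}) := by
    rintro P ⟨f, hf, hP⟩
    exact Function.Embedding.antisymm ⟨fun i => ⟨f i, hP i⟩, fun i j h => hf (congrArg Subtype.val h)⟩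
      (Function.Embedding.subtype P)
  obtain ⟨a', ha'⟩ := exists_ne a
  obtain ⟨e1⟩ := hne (fun i => (b i).1 = a) ⟨fun i => b.symm (a, i),
    fun i j h => by simpa using h, fun i => by simp⟩
  obtain ⟨e2⟩ := hne (fun i => ¬ (b i).1 = a) ⟨fun i => b.symm (a', i),
    fun i j h => by simpa using h, fun i => by simpa using ha'⟩
  have h3 : Nonempty ({p : ℤ × ι // p.1 ≠ 0} ≃ ι) := by
    have h4 : Cardinal.mk (ℤ × ι) ≤ Cardinal.mk ι := by
      rw [Cardinal.mk_prod, Cardinal.lift_id, Cardinal.lift_id, Cardinal.mk_int,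
        Cardinal.aleph0_mul_eq (Cardinal.aleph0_le_mk ι)]
    obtain ⟨g⟩ := Cardinal.le_def _ _ |>.1 h4
    exact Function.Embedding.antisymm ((Function.Embedding.subtype _).trans g)
      ⟨fun i => ⟨(1, i), by simp⟩, fun i j h => by simpa using h⟩
  obtain ⟨e3⟩ := h3
  let e4 : {p : ℤ × ι // ¬ p.1 ≠ 0} ≃ ι :=
    { toFun := fun p => p.1.2
      invFun := fun i => ⟨(0, i), by simp⟩
      left_inv := fun p => by
        obtain ⟨⟨j, i⟩, h⟩ := p
        simp only [ne_eq, not_not] at h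
        subst h
        rfl
      right_inv := fun i => rfl }
  let θ := (Equiv.sumCompl fun p : ℤ × ι => p.1 ≠ 0).symm.trans
    (((e3.trans e1).sumCongr (e4.trans e2)).trans (Equiv.sumCompl fun i => (b i).1 = a))
  refine ⟨θ, fun p => ?_⟩
  by_cases hp : p.1 ≠ 0
  · refine iff_of_true ?_ hp
    simp [θ, Equiv.sumCompl_symm_apply_of_pos, hp, (e1 _).2]
  · refine iff_of_false ?_ hp
    simp [θ, Equiv.sumCompl_symm_apply_of_neg, hp, (e2 _).2]

theorem exists_swindle_idempotents (K ι : Type) [Field K] [Infinite ι] (n : ℕ) (hn : 2 ≤ n) :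
    ∃ e : Fin n → Module.End K (ι →₀ K), (∀ a b, e a * e b = if a = b then e a else 0) ∧
      ∑ a, e a = 1 ∧ ∀ a, HasSwindle K (e a) := by
  have : Nontrivial (Fin n) := Fin.nontrivial_iff_two_le.2 hn
  have : Nonempty (Fin n) := ⟨⟨0, by omega⟩⟩
  have h1 : Cardinal.mk ι = Cardinal.mk (Fin n × ι) := by
    rw [Cardinal.mk_prod, Cardinal.lift_id, Cardinal.lift_id,
      Cardinal.mul_eq_right (Cardinal.aleph0_le_mk ι)
        ((Cardinal.lt_aleph0_of_finite (Fin n)).le.trans (Cardinal.aleph0_le_mk ι))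
        (Cardinal.mk_ne_zero _)]
  obtain ⟨b⟩ := Cardinal.eq.1 h1
  refine ⟨fun a => copies (fun i => if (b i).1 = a then 1 else 0) 1, fun a a' => ?_, ?_,
    fun a => ?_⟩
  · refine LinearMap.ext fun f => Finsupp.ext fun i => ?_
    by_cases h : a = a'
    · subst h
      simpa [copies_apply] using fun h h' => absurd h' h
    · by_cases h' : (b i).1 = a
      · simp [copies_apply, h, h']
      · simp [copies_apply, h, h']
  · refine LinearMap.ext fun f => Finsupp.ext fun i => ?_
    rw [LinearMap.sum_apply, Finsupp.finsetSum_apply]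
    simp [copies_apply]
  · obtain ⟨θ, hθ⟩ := exists_equiv_int_prod b a
    let Θ : (ℤ →₀ ι →₀ K) ≃ₗ[K] (ι →₀ K) :=
      (Finsupp.curryLinearEquiv K).symm ≪≫ₗ Finsupp.domLCongr θ
    have hΘ : ∀ f p, Θ f (θ p) = f p.1 p.2 := fun f p => by
      simp [Θ, Finsupp.uncurry_apply]
    refine hasSwindle_of_equiv Θ fun f => Finsupp.ext fun i => ?_
    obtain ⟨p, rfl⟩ := θ.surjective i
    rw [Finsupp.sub_apply, hΘ, hΘ, copies_apply, copies_apply, Module.End.one_apply,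
      Module.End.one_apply, hΘ]
    by_cases hp : p.1 = 0
    · rw [if_neg (by simp [hθ, hp])]
      simp [hp]
    · rw [if_pos ((hθ p).2 hp)]
      simp [hp]

end Copies

theorem finrank_invariantPolynomials_degree_zero (K : Type) [Field K] {U Γ : Type}
    [AddCommGroup U] [Module K U] (act : Γ → U → U) :
    Module.finrank K (invariantPolynomials K act 0) = 1 := by
  have hconst : ∀ c : K, (fun _ => c) ∈ invariantPolynomials K act 0 := fun c =>
    ⟨⟨MultilinearMap.constOfIsEmpty K _ c, fun u => rfl⟩, fun _ _ => rfl⟩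
  let e : invariantPolynomials K act 0 ≃ₗ[K] K :=
    { toFun := fun F => F.1 0
      map_add' := fun F G => rfl
      map_smul' := fun c F => rfl
      invFun := fun c => ⟨fun _ => c, hconst c⟩
      left_inv := by
        rintro ⟨F, ⟨m, hm⟩, -⟩
        refine Subtype.ext (funext fun u => ?_)
        change F 0 = F u
        rw [hm, hm]
        congr 1
        exact Subsingleton.elim _ _
      right_inv := fun c => rfl }
  rw [e.finrank_eq, Module.finrank_self]

theorem finrank_invariantPolynomials_of_infinite_basis (K ι : Type) [Field K] [CharZero K]
    [Infinite ι] (k : ℕ) {n : ℕ} (hn : n ≠ 0) :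
    Module.finrank K (invariantPolynomials K (unitConj (Module.End K (ι →₀ K)) k) n) = 0 := by
  have : Nonempty (Fin n) := ⟨⟨0, Nat.pos_of_ne_zero hn⟩⟩
  have h : invariantPolynomials K (unitConj (Module.End K (ι →₀ K)) k) n = ⊥ := by
    refine (Submodule.eq_bot_iff _).2 fun F hF => funext fun u => ?_
    obtain ⟨m, hFm, hm, -⟩ := exists_components hF
    rw [hFm]
    refine Finset.sum_eq_zero fun w _ => ?_
    rw [IsConjInvariant.eq_zero (exists_swindle_idempotents K ι) (hm w), zero_apply]
  rw [h, finrank_bot]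

/-- For `dim W = d`, the dimension of the `n`-th homogeneous component of the invariant ring
`K[End(W)^{⊕k}]^{GL(W)}` is
`Σ_{n₁+⋯+n_k=n} Σ_{λ⊢n, r(λ)≤d} Σ_{λ₁⊢n₁} ⋯ Σ_{λ_k⊢n_k} (c^λ_{(λᵢ)})²`. -/
theorem stmt2 (K : Type) [Field K] [CharZero K] (W : Type) [AddCommGroup W] [Module K W]
    (d : ℕ) (hW : Module.finrank K W = d) (k : ℕ) (n : ℕ) :
    Module.finrank K (invariantPolynomials K (conjAction K W k) n) =
      ∑ ν ∈ Finset.Nat.antidiagonalTuple k n, ∑ lam : Nat.Partition n,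
        if lam.parts.card ≤ d then
          ∑ lams : (∀ i : Fin k, Nat.Partition (ν i)), iteratedLR K n ν lams lam ^ 2
        else 0 := by
  obtain ⟨z, hzc, hz1, hz0⟩ := exists_central_projection K n fun l => l.parts.card ≤ d
  have hmat : Module.finrank K (invariantPolynomials K (unitConj (Matrix (Fin d) (Fin d) K) k) n) =
      _ := (finrank_invariantPolynomials_matrix (ι := Fin d) k hzc
    (central_projection_mul_self hzc hz1 hz0) (by simpa using hz1) (by simpa using hz0)).trans
    (finrank_wordFamilies_eq K k d hzc hz1 hz0)
  rw [← hmat]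
  by_cases hfin : Module.Finite K W
  · subst hW
    rw [invariantPolynomials_conjAction]
    exact finrank_invariantPolynomials_unitConj_congr
      (LinearMap.toMatrixAlgEquiv (Module.finBasis K W)) k n
  rcases eq_or_ne n 0 with rfl | hn
  · rw [finrank_invariantPolynomials_degree_zero, finrank_invariantPolynomials_degree_zero]
  have hinf : Infinite (Module.Basis.ofVectorSpaceIndex K W) := by
    refine not_finite_iff_infinite.1 fun h => hfin ?_
    exact Module.Finite.of_basis (Module.Basis.ofVectorSpace K W)
  rw [invariantPolynomials_conjAction, finrank_invariantPolynomials_unitConj_congr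
    (A := Module.End K W) (B := Module.End K (Module.Basis.ofVectorSpaceIndex K W →₀ K))
    ((Module.Basis.ofVectorSpace K W).repr.conjAlgEquiv K),
    finrank_invariantPolynomials_of_infinite_basis _ _ _ hn, hmat]
  rw [Module.finrank_of_not_finite hfin] at hW
  subst hW
  refine (Finset.sum_eq_zero fun ν _ => Finset.sum_eq_zero fun l _ => if_neg fun hl => hn ?_).symm
  rw [← l.parts_sum, Multiset.card_eq_zero.1 (Nat.le_zero.1 hl), Multiset.sum_zero]
end

section
/- Let G be a finite group, H₁ and H₂ subgroups of G, K a field of characteristic zero, and let D ⊆ G be a set of representatives for the double cosets H₁\G/H₂ (so G is the disjoint union of H₁gH₂ for g ∈ D). Then there is an isomorphism of G-representations Ind_{H₁}^G 𝟏 ⊗ Ind_{H₂}^G 𝟏 ≅ ⊕_{g∈D} Ind_{H₁ ∩ gH₂g⁻¹}^G 𝟏, where 𝟏 denotes the trivial one-dimensional representation and G acts diagonally on the tensor product. -/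
open CategoryTheory MonoidalCategory CategoryTheory.Limits

attribute [local instance] CategoryTheory.Abelian.hasFiniteBiproducts

namespace Rep

universe u

noncomputable section

/-- The morphism `K[X] ⟶ A` of representations extending an equivariant function `φ : X → A`. -/
def ofMulActionLift {K G X : Type u} [CommRing K] [Monoid G] [MulAction G X] (A : Rep.{u} K G)
    (φ : X → A) (hφ : ∀ (g : G) (x : X), φ (g • x) = A.ρ g (φ x)) :
    Rep.ofMulAction K G X ⟶ A :=
  Rep.ofHom (σ := A.ρ) ⟨Finsupp.lift _ _ _ φ ∘ₗ (MonoidAlgebra.coeffLinearEquiv K).toLinearMap,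
    fun g ↦ by
      ext x
      simp [Representation.ofMulAction_single, hφ]⟩

lemma ofMulActionLift_single {K G X : Type u} [CommRing K] [Monoid G] [MulAction G X]
    (A : Rep.{u} K G) (φ : X → A) (hφ : ∀ (g : G) (x : X), φ (g • x) = A.ρ g (φ x)) (x : X) :
    (ofMulActionLift A φ hφ).hom (MonoidAlgebra.single x (1 : K)) = φ x := by
  simp [ofMulActionLift]

lemma ofMulAction_hom_ext {K G X : Type u} [CommRing K] [Monoid G] [MulAction G X]
    {A : Rep.{u} K G} {f f' : Rep.ofMulAction K G X ⟶ A}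
    (h : ∀ x : X, f.hom (MonoidAlgebra.single x (1 : K)) =
      f'.hom (MonoidAlgebra.single x (1 : K))) : f = f' := by
  ext x
  simpa using h x

/-- The morphism `K[X] ⟶ K[Y]` of permutation representations induced by an equivariant map. -/
def ofMulActionMap (K : Type u) {G X Y : Type u} [CommRing K] [Monoid G] [MulAction G X]
    [MulAction G Y] (f : X →[G] Y) : Rep.ofMulAction K G X ⟶ Rep.ofMulAction K G Y :=
  ofMulActionLift (Rep.ofMulAction K G Y) (fun x ↦ MonoidAlgebra.single (f x) (1 : K))
    fun g x ↦ by simp [Representation.ofMulAction_single]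

lemma ofMulActionMap_single {K G X Y : Type u} [CommRing K] [Monoid G] [MulAction G X]
    [MulAction G Y] (f : X →[G] Y) (x : X) :
    (ofMulActionMap K f).hom (MonoidAlgebra.single x (1 : K)) = MonoidAlgebra.single (f x) 1 :=
  ofMulActionLift_single _ _ _ x

/-- If a `G`-set `X` is the disjoint union of `G`-sets `Y d`, then `K[X]` is the coproduct of the
permutation representations `K[Y d]`. -/
def ofMulActionIsColimit {K G X ι : Type u} [CommRing K] [Monoid G] [MulAction G X]
    {Y : ι → Type u} [∀ d, MulAction G (Y d)] (f : ∀ d, Y d →[G] X)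
    (hf : Function.Bijective fun p : Σ d, Y d ↦ f p.1 p.2) :
    IsColimit (Cofan.mk (Rep.ofMulAction K G X) fun d ↦ ofMulActionMap K (f d)) :=
  let e := Equiv.ofBijective _ hf
  have he (d : ι) (y : Y d) : e.symm (f d y) = ⟨d, y⟩ := e.symm_apply_apply ⟨d, y⟩
  let v (t : Cofan fun d ↦ Rep.ofMulAction K G (Y d)) (p : Σ d, Y d) : t.pt :=
    (t.inj p.1).hom (MonoidAlgebra.single p.2 (1 : K))
  have hv (t) (g : G) (x : X) : v t (e.symm (g • x)) = t.pt.ρ g (v t (e.symm x)) := by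
    obtain ⟨⟨d, y⟩, rfl⟩ := hf.2 x
    change v t (e.symm (g • f d y)) = t.pt.ρ g (v t (e.symm (f d y)))
    rw [← map_smul, he, he]
    simp only [v]
    rw [← Rep.hom_comm_apply, Representation.ofMulAction_single]
  Cofan.IsColimit.mk _
    (fun t ↦ ofMulActionLift t.pt (fun x ↦ v t (e.symm x)) (hv t))
    (fun t d ↦ ofMulAction_hom_ext fun y ↦ by
      change (ofMulActionLift t.pt (fun x ↦ v t (e.symm x)) (hv t)).hom
        ((ofMulActionMap K (f d)).hom (MonoidAlgebra.single y 1)) = _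
      rw [ofMulActionMap_single, ofMulActionLift_single, he])
    (fun t m hm ↦ ofMulAction_hom_ext fun x ↦ by
      obtain ⟨⟨d, y⟩, rfl⟩ := hf.2 x
      rw [ofMulActionLift_single]
      change m.hom (MonoidAlgebra.single (f d y) 1) = v t (e.symm (f d y))
      rw [he, ← ofMulActionMap_single]
      simp only [v, ← hm]
      rfl)

/-- The tensor product of permutation representations is the permutation representation on the
product. -/
def ofMulActionTensorIso (K G X Y : Type u) [CommRing K] [Monoid G] [MulAction G X]
    [MulAction G Y] :
    Rep.ofMulAction K G X ⊗ Rep.ofMulAction K G Y ≅ Rep.ofMulAction K G (X × Y) :=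
  Rep.mkIso <| .mk
    (TensorProduct.congr (MonoidAlgebra.coeffLinearEquiv K) (MonoidAlgebra.coeffLinearEquiv K) ≪≫ₗ
      finsuppTensorFinsupp' K X Y ≪≫ₗ (MonoidAlgebra.coeffLinearEquiv K).symm)
    fun g ↦ by
      ext x y
      simp [Representation.ofMulAction_single]

end

end Rep

/-- The equivariant map `G ⧸ (H₁ ⊓ dH₂d⁻¹) → G ⧸ H₁ × G ⧸ H₂` sending the coset of `g`
to the cosets of `g` and `g * d`. -/
def Subgroup.quotientInfConjToProd {G : Type*} [Group G] (H₁ H₂ : Subgroup G) (d : G) :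
    G ⧸ (H₁ ⊓ Subgroup.map (MulAut.conj d).toMonoidHom H₂) →[G] (G ⧸ H₁) × (G ⧸ H₂) where
  toFun := Quotient.lift (fun g ↦ ((g : G ⧸ H₁), ((g * d : G) : G ⧸ H₂))) <| by
    intro a b h
    obtain ⟨h₁, h, h₂, e⟩ := QuotientGroup.leftRel_apply.1 h
    refine Prod.ext (QuotientGroup.eq.2 h₁) (QuotientGroup.eq.2 ?_)
    suffices h = (a * d)⁻¹ * (b * d) from this ▸ h₂
    simp only [MulEquiv.toMonoidHom_eq_coe, MonoidHom.coe_coe, MulAut.conj_apply] at e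
    rw [mul_inv_rev, mul_assoc, ← mul_assoc a⁻¹, ← e]
    group
  map_smul' g x := by
    induction x using QuotientGroup.induction_on with
    | H x => exact Prod.ext rfl (congrArg (QuotientGroup.mk (s := H₂)) (mul_assoc g x d))

lemma Subgroup.quotientInfConjToProd_mk {G : Type*} [Group G] (H₁ H₂ : Subgroup G) (d g : G) :
    H₁.quotientInfConjToProd H₂ d (g : G ⧸ _) = ((g : G ⧸ H₁), ((g * d : G) : G ⧸ H₂)) :=
  rfl

/-- If `D` represents the double cosets `H₁\G/H₂`, then `G ⧸ H₁ × G ⧸ H₂` is the disjoint union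
of the `G ⧸ (H₁ ⊓ dH₂d⁻¹)` for `d ∈ D`. -/
lemma Subgroup.bijective_sigma_quotientInfConjToProd {G : Type*} [Group G] (H₁ H₂ : Subgroup G)
    (D : Finset G)
    (hD : ∀ x : G, ∃! d, d ∈ D ∧ ∃ h₁ ∈ H₁, ∃ h₂ ∈ H₂, x = h₁ * d * h₂) :
    Function.Bijective
      fun p : Σ d : D, G ⧸ (H₁ ⊓ Subgroup.map (MulAut.conj (d : G)).toMonoidHom H₂) ↦
        H₁.quotientInfConjToProd H₂ (p.1 : G) p.2 := by
  constructor
  · rintro ⟨⟨d, hd⟩, x⟩ ⟨⟨d', hd'⟩, x'⟩ h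
    induction x using QuotientGroup.induction_on with | H g => ?_
    induction x' using QuotientGroup.induction_on with | H g' => ?_
    simp only [quotientInfConjToProd_mk, Prod.mk.injEq, QuotientGroup.eq] at h
    obtain ⟨h₁, h₂⟩ := h
    have hdd : d = d' := (hD d).unique ⟨hd, 1, H₁.one_mem, 1, H₂.one_mem, by simp⟩
      ⟨hd', _, h₁, _, H₂.inv_mem h₂, by group⟩
    subst hdd
    refine Sigma.ext rfl (heq_of_eq (QuotientGroup.eq.2 ⟨h₁, _, h₂, ?_⟩))
    simp only [MulEquiv.toMonoidHom_eq_coe, MonoidHom.coe_coe, MulAut.conj_apply]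
    group
  · rintro ⟨x, y⟩
    induction x using QuotientGroup.induction_on with | H a => ?_
    induction y using QuotientGroup.induction_on with | H b => ?_
    obtain ⟨d, ⟨hd, h₁, hh₁, h₂, hh₂, e⟩, -⟩ := hD (a⁻¹ * b)
    refine ⟨⟨⟨d, hd⟩, ((a * h₁ : G) : G ⧸ _)⟩, ?_⟩
    simp only [quotientInfConjToProd_mk, Prod.mk.injEq, QuotientGroup.eq]
    refine ⟨by simpa using hh₁, ?_⟩
    convert hh₂ using 1
    rw [show b = a * (h₁ * d * h₂) by rw [← e]; group]
    group

/-- Let `G` be a finite group, `H₁, H₂ ≤ G`, `K` a field of characteristic zero, and let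
`D` be a set of representatives for the double cosets `H₁\G/H₂` (each element of `G` lies
in `H₁dH₂` for exactly one `d ∈ D`).  Then there is an isomorphism of `G`-representations
`Ind_{H₁}^G 𝟏 ⊗ Ind_{H₂}^G 𝟏 ≅ ⊕_{d∈D} Ind_{H₁ ∩ dH₂d⁻¹}^G 𝟏`, where the induced
representation of the trivial representation of a subgroup `H` is the permutation
representation `K[G/H]` on the left cosets (`Rep.ofMulAction K G (G ⧸ H)`), and `G` acts
diagonally on the tensor product. -/
theorem stmt6 (K : Type) [Field K] [CharZero K] (G : Type) [Group G] [Fintype G]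
    [DecidableEq G] (H₁ H₂ : Subgroup G) (D : Finset G)
    (hD : ∀ x : G, ∃! d, d ∈ D ∧ ∃ h₁ ∈ H₁, ∃ h₂ ∈ H₂, x = h₁ * d * h₂) :
    Nonempty (
      (Rep.ofMulAction K G (G ⧸ H₁) ⊗ Rep.ofMulAction K G (G ⧸ H₂)) ≅
      ⨁ fun d : D => Rep.ofMulAction K G
        (G ⧸ (H₁ ⊓ Subgroup.map (MulAut.conj (d : G)).toMonoidHom H₂))) := by
  exact ⟨Rep.ofMulActionTensorIso K G _ _ ≪≫
    (Rep.ofMulActionIsColimit (fun d : D ↦ H₁.quotientInfConjToProd H₂ (d : G))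
      (H₁.bijective_sigma_quotientInfConjToProd H₂ D hD)).coconePointUniqueUpToIso
      (biproduct.isColimit _)⟩
end
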